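/- Realization theorem: let f ∈ L_p^0(T²), 1<p<∞, α₁,α₂>0, and n₁,n₂ ∈ ℕ. Then ω_{α₁,α₂}(f, π/n₁, π/n₂)_p ≍ n₁^{−α₁} n₂^{−α₂} ‖s_{n₁,n₂}^{(α₁,α₂)}(f)‖_p + n₁^{−α₁} ‖s_{n₁,∞}^{(α₁,0)}(f − s_{∞,n₂}(f))‖_p + n₂^{−α₂} ‖s_{∞,n₂}^{(0,α₂)}(f − s_{n₁,∞}(f))‖_p + ‖f − s_{n₁,∞}(f) − s_{∞,n₂}(f) + s_{n₁,n₂}(f)‖_p, with constants independent of f, n₁, n₂. -/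

import Mathlib

open MeasureTheory Real
open scoped ENNReal

noncomputable section

/-- The `L_p` norm of a function of two variables over the period square `(0,2π]²`. -/
def Lp2Norm (p : ℝ) (f : ℝ → ℝ → ℝ) : ℝ≥0∞ :=
  (∫⁻ x in Set.Ioc (0:ℝ) (2*π), ∫⁻ y in Set.Ioc (0:ℝ) (2*π),
      ENNReal.ofReal (|f x y| ^ p)) ^ (1/p)

/-- `f ∈ L_p^0(T²)`: measurable, `2π`-periodic in each variable, finite `L_p` norm,
and zero mean in each variable separately. -/
structure MemLp0 (p : ℝ) (f : ℝ → ℝ → ℝ) : Prop where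
  meas : Measurable (Function.uncurry f)
  periodic_x : ∀ y, Function.Periodic (fun x => f x y) (2*π)
  periodic_y : ∀ x, Function.Periodic (f x) (2*π)
  norm_ne_top : Lp2Norm p f ≠ ⊤
  mean_x : ∀ᵐ (y : ℝ) ∂volume, (∫ x in (0:ℝ)..(2*π), f x y) = 0
  mean_y : ∀ᵐ (x : ℝ) ∂volume, (∫ y in (0:ℝ)..(2*π), f x y) = 0

/-- Generalized (fractional) binomial coefficient `C(α,ν) = α(α-1)⋯(α-ν+1)/ν!`. -/
def fracBinom (α : ℝ) : ℕ → ℝ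
  | 0 => 1
  | n+1 => fracBinom α n * (α - (n : ℝ)) / ((n : ℝ) + 1)

/-- Fractional difference of order `α` with step `h` in the first variable. -/
def diffX (α h : ℝ) (f : ℝ → ℝ → ℝ) : ℝ → ℝ → ℝ :=
  fun x y => ∑' ν : ℕ, (-1 : ℝ) ^ ν * fracBinom α ν * f (x + (α - (ν : ℝ)) * h) y

/-- Fractional difference of order `α` with step `h` in the second variable. -/
def diffY (α h : ℝ) (f : ℝ → ℝ → ℝ) : ℝ → ℝ → ℝ :=
  fun x y => ∑' ν : ℕ, (-1 : ℝ) ^ ν * fracBinom α ν * f x (y + (α - (ν : ℝ)) * h)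

/-- The mixed (fractional) modulus of smoothness `ω_{α₁,α₂}(f, δ₁, δ₂)_p`. -/
def mixedMod (p α₁ α₂ δ₁ δ₂ : ℝ) (f : ℝ → ℝ → ℝ) : ℝ≥0∞ :=
  ⨆ (h₁ : ℝ) (_ : |h₁| ≤ δ₁) (h₂ : ℝ) (_ : |h₂| ≤ δ₂),
    Lp2Norm p (diffX α₁ h₁ (diffY α₂ h₂ f))

/-- Fractionally differentiated Dirichlet kernel `Σ_{k=1}^n k^α cos(kt + απ/2)`;
for `α = 0` this is the Dirichlet kernel without the constant term. -/
def fracDirichlet (α : ℝ) (n : ℕ) (t : ℝ) : ℝ :=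
  ∑ k ∈ Finset.Icc 1 n, (k : ℝ) ^ α * Real.cos ((k : ℝ) * t + α * π / 2)

/-- `s_{n,∞}^{(α,0)}(f)`: the `α`-th Weyl derivative in `x` of the partial Fourier sum
of order `n` in the first variable (for `α = 0`, the partial sum `s_{n,∞}(f)` itself,
for functions with zero mean in `x`). -/
def sX (α : ℝ) (n : ℕ) (f : ℝ → ℝ → ℝ) : ℝ → ℝ → ℝ :=
  fun x y => (1/π) * ∫ t in (0:ℝ)..(2*π), f (x + t) y * fracDirichlet α n t

/-- `s_{∞,n}^{(0,α)}(f)`. -/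
def sY (α : ℝ) (n : ℕ) (f : ℝ → ℝ → ℝ) : ℝ → ℝ → ℝ :=
  fun x y => (1/π) * ∫ t in (0:ℝ)..(2*π), f x (y + t) * fracDirichlet α n t

/-- `s_{n₁,n₂}^{(α₁,α₂)}(f)`. -/
def sXY (α₁ α₂ : ℝ) (n₁ n₂ : ℕ) (f : ℝ → ℝ → ℝ) : ℝ → ℝ → ℝ :=
  fun x y => (1/π^2) * ∫ t₁ in (0:ℝ)..(2*π), ∫ t₂ in (0:ℝ)..(2*π),
    f (x + t₁) (y + t₂) * fracDirichlet α₁ n₁ t₁ * fracDirichlet α₂ n₂ t₂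

/-- The realization quantity: the right-hand side of Theorem 5.1. -/
def realizationRHS (p α₁ α₂ : ℝ) (n₁ n₂ : ℕ) (f : ℝ → ℝ → ℝ) : ℝ≥0∞ :=
  ENNReal.ofReal ((n₁ : ℝ) ^ (-α₁) * (n₂ : ℝ) ^ (-α₂)) * Lp2Norm p (sXY α₁ α₂ n₁ n₂ f)
  + ENNReal.ofReal ((n₁ : ℝ) ^ (-α₁)) *
      Lp2Norm p (sX α₁ n₁ (fun x y => f x y - sY 0 n₂ f x y))
  + ENNReal.ofReal ((n₂ : ℝ) ^ (-α₂)) *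
      Lp2Norm p (sY α₂ n₂ (fun x y => f x y - sX 0 n₁ f x y))
  + Lp2Norm p (fun x y => f x y - sX 0 n₁ f x y - sY 0 n₂ f x y + sXY 0 0 n₁ n₂ f x y)

/-- The mean of a continuous function over the circle of radius `exp s` tends to its value at the
centre as `s → -∞`. -/
theorem tendsto_integral_circle_exp {E : Type*} [NormedAddCommGroup E] [NormedSpace ℝ E]
    [CompleteSpace E] {Ψ : ℂ → E} (hΨ : Continuous Ψ) :
    Filter.Tendsto (fun s : ℝ => ∫ θ in (0:ℝ)..(2*π), Ψ (Complex.exp (s + θ * Complex.I)))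
      Filter.atBot (nhds ((2 * π) • Ψ 0)) := by
  have h1 : Continuous fun r : ℝ =>
      ∫ θ in (0:ℝ)..(2*π), Ψ ((r : ℂ) * Complex.exp (θ * Complex.I)) := by
    apply intervalIntegral.continuous_parametric_intervalIntegral_of_continuous'
    fun_prop
  have h2 := (h1.tendsto 0).comp Real.tendsto_exp_atBot
  simp only [Complex.ofReal_zero, zero_mul, intervalIntegral.integral_const, sub_zero] at h2
  refine h2.congr fun s => ?_
  simp [Complex.exp_add]

theorem integral_interval_swap_of_continuous {E : Type*} [NormedAddCommGroup E] [NormedSpace ℝ E]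
    {f : ℝ → ℝ → E} (hf : Continuous (Function.uncurry f)) {a b c d : ℝ} (hcd : c ≤ d) :
    ∫ x in a..b, ∫ y in c..d, f x y = ∫ y in c..d, ∫ x in a..b, f x y := by
  simp only [intervalIntegral.integral_of_le hcd]
  refine intervalIntegral_integral_swap ?_
  rw [Measure.prod_restrict, ← Measure.volume_eq_prod]
  refine (hf.locallyIntegrable.integrableOn_isCompact
    (isCompact_uIcc (a := a) (b := b) |>.prod (isCompact_Icc (a := c) (b := d)))).mono_set ?_
  exact Set.prod_mono Set.uIoc_subset_uIcc Set.Ioc_subset_Icc_self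

/-- The sub-mean value property of a subharmonic function `Φ` of class `C²` along a holomorphic
function. -/
theorem subharmonic_comp_le_integral {Φ Φx Φy : ℂ → ℝ} {Ax Ay : ℂ → ℂ →L[ℝ] ℝ}
    (hΦ : ∀ z, HasFDerivAt Φ (Φx z • Complex.reCLM + Φy z • Complex.imCLM) z)
    (hx : ∀ z, HasFDerivAt Φx (Ax z) z) (hy : ∀ z, HasFDerivAt Φy (Ay z) z)
    (cAx : Continuous Ax) (cAy : Continuous Ay)
    (hΔ : ∀ z, 0 ≤ Ax z 1 + Ay z Complex.I) {P : ℂ → ℂ} (hP : Differentiable ℂ P) :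
    2 * π * Φ (P 0) ≤ ∫ θ in (0:ℝ)..(2*π), Φ (P (Complex.exp (θ * Complex.I))) := by
  have cΦ : Continuous Φ := continuous_iff_continuousAt.2 fun z => (hΦ z).continuousAt
  have cx : Continuous Φx := continuous_iff_continuousAt.2 fun z => (hx z).continuousAt
  have cy : Continuous Φy := continuous_iff_continuousAt.2 fun z => (hy z).continuousAt
  have cP := hP.continuous
  have hP' : Differentiable ℂ (deriv P) := fun z => (hP.analyticAt z).deriv.differentiableAt
  have cP' := hP'.continuous
  set Ψ : ℂ → ℂ := fun z => ((Φx (P z) : ℂ) - Complex.I * (Φy (P z) : ℂ)) * (z * deriv P z) with hΨ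
  have cΨ : Continuous Ψ := by fun_prop
  set g : ℂ → ℂ := fun ζ => Complex.exp ζ * deriv P (Complex.exp ζ) with hg
  have cg : Continuous g := by fun_prop
  have dg : Differentiable ℂ g := Complex.differentiable_exp.mul (hP'.comp Complex.differentiable_exp)
  have dG : ∀ ζ, HasDerivAt (fun ζ => P (Complex.exp ζ)) (g ζ) ζ := fun ζ => by
    have := (hP (Complex.exp ζ)).hasDerivAt.comp ζ (Complex.hasDerivAt_exp ζ)
    rwa [mul_comm] at this
  set u : ℂ → ℂ := fun ζ => (Φx (P (Complex.exp ζ)) : ℂ) - Complex.I * (Φy (P (Complex.exp ζ)) : ℂ)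
    with hu
  set Du : ℂ → ℂ →L[ℝ] ℂ := fun ζ =>
    (Complex.ofRealCLM.comp (Ax (P (Complex.exp ζ))) -
      Complex.I • Complex.ofRealCLM.comp (Ay (P (Complex.exp ζ)))).comp
      (g ζ • (1 : ℂ →L[ℝ] ℂ)) with hDu
  have du : ∀ ζ, HasFDerivAt u (Du ζ) ζ := fun ζ => by
    have hG : HasFDerivAt (fun ζ => P (Complex.exp ζ)) (g ζ • (1 : ℂ →L[ℝ] ℂ)) ζ := by
      simpa using (dG ζ).complexToReal_fderiv
    have h1 := Complex.ofRealCLM.hasFDerivAt.comp ζ ((hx _).comp ζ hG)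
    have h2 := Complex.ofRealCLM.hasFDerivAt.comp ζ ((hy _).comp ζ hG)
    exact h1.sub (h2.const_mul Complex.I)
  set F' : ℂ → ℂ →L[ℝ] ℂ := fun ζ => u ζ • (deriv g ζ • (1 : ℂ →L[ℝ] ℂ)) + g ζ • Du ζ with hF'
  have dF : ∀ ζ, HasFDerivAt (fun ζ => Ψ (Complex.exp ζ)) (F' ζ) ζ := fun ζ => by
    have hG : HasFDerivAt g (deriv g ζ • (1 : ℂ →L[ℝ] ℂ)) ζ := by
      simpa using (dg ζ).hasDerivAt.complexToReal_fderiv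
    exact (du ζ).mul hG
  set L : ℂ → ℂ := fun ζ => Complex.I • F' ζ 1 - F' ζ Complex.I with hL
  have cL : Continuous L := by
    have hu' : Continuous u := by fun_prop
    have hdg : Continuous (deriv g) := by
      have : Differentiable ℂ (deriv g) := fun z => (dg.analyticAt z).deriv.differentiableAt
      exact this.continuous
    have hDu' : Continuous Du := by
      simp only [hDu]
      fun_prop
    have : Continuous F' := by fun_prop
    fun_prop
  have hLim : ∀ ζ, 0 ≤ (L ζ).im := fun ζ => by
    have key : ∀ A : ℂ →L[ℝ] ℝ, ∀ w : ℂ, A w = w.re * A 1 + w.im * A Complex.I := fun A w => by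
      conv_lhs => rw [← Complex.re_add_im w]
      have : (w.re : ℂ) + w.im * Complex.I = w.re • (1:ℂ) + w.im • Complex.I := by simp
      rw [this, map_add, map_smul, map_smul, smul_eq_mul, smul_eq_mul]
    have : (L ζ).im = ((g ζ).re ^ 2 + (g ζ).im ^ 2) *
        (Ax (P (Complex.exp ζ)) 1 + Ay (P (Complex.exp ζ)) Complex.I) := by
      have e1 := key (Ax (P (Complex.exp ζ))) (g ζ)
      have e2 := key (Ay (P (Complex.exp ζ))) (g ζ)
      have e3 := key (Ax (P (Complex.exp ζ))) (g ζ * Complex.I)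
      have e4 := key (Ay (P (Complex.exp ζ))) (g ζ * Complex.I)
      simp [hL, hF', hDu, e1, e2, e3, e4]
      ring
    rw [this]
    exact mul_nonneg (by positivity) (hΔ _)
  set J : ℝ → ℂ := fun s => ∫ θ in (0:ℝ)..(2*π), Ψ (Complex.exp (s + θ * Complex.I)) with hJ
  have Jmono : ∀ s₀ s₁ : ℝ, s₀ ≤ s₁ → (J s₀).re ≤ (J s₁).re := fun s₀ s₁ hs => by
    have h := Complex.integral_boundary_rect_of_hasFDerivAt_real_off_countable
      (fun ζ => Ψ (Complex.exp ζ)) F' (s₀ : ℂ) ((s₁ : ℂ) + (2 * π : ℝ) * Complex.I) ∅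
      Set.countable_empty (by fun_prop) (fun x _ => dF x)
      (cL.locallyIntegrable.integrableOn_isCompact
        (isCompact_uIcc.reProdIm isCompact_uIcc))
    have hper : ∀ x : ℝ, Complex.exp ((x : ℂ) + ((2 * π : ℝ) : ℂ) * Complex.I) =
        Complex.exp (x : ℂ) := fun x => by
      push_cast
      exact Complex.exp_periodic x
    simp only [Complex.ofReal_re, Complex.ofReal_im, Complex.add_re, Complex.add_im,
      Complex.mul_re, Complex.mul_im, Complex.I_re, Complex.I_im, mul_zero, mul_one, zero_mul,
      add_zero, zero_add, Complex.ofReal_zero, hper, sub_self] at h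
    have h' := congrArg Complex.im h
    have e : ∀ s : ℝ, (Complex.I • J s).im = (J s).re := fun s => by simp
    rw [Complex.sub_im] at h'
    change (Complex.I • J s₁).im - (Complex.I • J s₀).im =
      (∫ x in s₀..s₁, ∫ y in (0:ℝ)..(2*π), L (x + y * Complex.I)).im at h'
    rw [e, e] at h'
    have cI : Continuous fun x : ℝ => ∫ y in (0:ℝ)..(2*π), L (x + y * Complex.I) :=
      intervalIntegral.continuous_parametric_intervalIntegral_of_continuous' (by fun_prop) _ _
    have h2 := Complex.imCLM.intervalIntegral_comp_comm (cI.intervalIntegrable (μ := volume) s₀ s₁)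
    have h3 : 0 ≤ (∫ x in s₀..s₁, ∫ y in (0:ℝ)..(2*π), L (x + y * Complex.I)).im := by
      refine le_of_le_of_eq ?_ h2
      refine intervalIntegral.integral_nonneg hs fun x _ => ?_
      have c2 : Continuous fun y : ℝ => L (x + y * Complex.I) := by fun_prop
      rw [← Complex.imCLM.intervalIntegral_comp_comm (c2.intervalIntegrable _ _)]
      exact intervalIntegral.integral_nonneg (by positivity) fun y _ => hLim _
    linarith
  have Jnonneg : ∀ s, 0 ≤ (J s).re := fun s => by
    have h1 := (Complex.continuous_re.tendsto _).comp (tendsto_integral_circle_exp cΨ)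
    have h0 : ((2 * π) • Ψ 0).re = 0 := by simp [hΨ]
    rw [h0] at h1
    exact le_of_tendsto h1 ((Filter.eventually_le_atBot s).mono fun t ht => Jmono t s ht)
  set H : ℝ → ℝ := fun s => ∫ θ in (0:ℝ)..(2*π), Φ (P (Complex.exp (s + θ * Complex.I))) with hH
  have Hmono : ∀ s : ℝ, s ≤ 0 → H s ≤ H 0 := fun s hs => by
    have hftc : ∀ θ : ℝ, Φ (P (Complex.exp ((0:ℝ) + θ * Complex.I))) -
        Φ (P (Complex.exp (s + θ * Complex.I))) =
        ∫ σ in s..(0:ℝ), (Ψ (Complex.exp (σ + θ * Complex.I))).re := fun θ => by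
      symm
      apply intervalIntegral.integral_eq_sub_of_hasDerivAt
        (f := fun σ : ℝ => Φ (P (Complex.exp (σ + θ * Complex.I))))
      · intro σ _
        have h1 : HasDerivAt (fun σ : ℝ => P (Complex.exp ((σ : ℂ) + θ * Complex.I)))
            (g (σ + θ * Complex.I)) σ := by
          have := (dG (σ + θ * Complex.I)).comp_add_const (σ : ℂ) (θ * Complex.I)
          exact this.comp_ofReal
        have h2 := (hΦ (P (Complex.exp ((σ : ℂ) + θ * Complex.I)))).comp_hasDerivAt σ h1
        refine HasDerivAt.congr_deriv (f := fun σ : ℝ => Φ (P (Complex.exp (σ + θ * Complex.I))))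
          h2 ?_
        simp [hΨ, hg]
      · apply Continuous.intervalIntegrable
        fun_prop
    have hd : H 0 - H s = ∫ σ in s..(0:ℝ), (J σ).re := by
      rw [hH]; beta_reduce
      rw [← intervalIntegral.integral_sub]
      · rw [intervalIntegral.integral_congr fun θ _ => hftc θ,
          ← integral_interval_swap_of_continuous (by fun_prop) (by positivity)]
        refine intervalIntegral.integral_congr fun σ _ => ?_
        have c2 : Continuous fun θ : ℝ => Ψ (Complex.exp (σ + θ * Complex.I)) := by fun_prop
        exact Complex.reCLM.intervalIntegral_comp_comm (c2.intervalIntegrable _ _)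
      · apply Continuous.intervalIntegrable
        fun_prop
      · apply Continuous.intervalIntegrable
        fun_prop
    have : 0 ≤ ∫ σ in s..(0:ℝ), (J σ).re :=
      intervalIntegral.integral_nonneg hs fun σ _ => Jnonneg σ
    linarith
  have h1 := tendsto_integral_circle_exp (cΦ.comp cP)
  have h2 := le_of_tendsto h1 ((Filter.eventually_le_atBot (0:ℝ)).mono fun t ht => Hmono t ht)
  simpa [hH] using h2

/-- `f` is differentiable at `z` with partial derivatives `a` and `b`. -/
def HasGradAt (f : ℂ → ℝ) (a b : ℝ) (z : ℂ) : Prop :=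
  HasFDerivAt f (a • Complex.reCLM + b • Complex.imCLM) z

namespace HasGradAt

variable {f g : ℂ → ℝ} {a b a' b' : ℝ} {z : ℂ}

theorem congr_grad (h : HasGradAt f a b z) (ha : a' = a) (hb : b' = b) : HasGradAt f a' b' z := by
  rw [ha, hb]; exact h

theorem re (z : ℂ) : HasGradAt Complex.re 1 0 z := by
  simp only [HasGradAt, one_smul, zero_smul, add_zero]
  exact Complex.reCLM.hasFDerivAt

theorem im (z : ℂ) : HasGradAt Complex.im 0 1 z := by
  simp only [HasGradAt, one_smul, zero_smul, zero_add]
  exact Complex.imCLM.hasFDerivAt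

theorem const (c : ℝ) (z : ℂ) : HasGradAt (fun _ => c) 0 0 z := by
  simpa [HasGradAt] using hasFDerivAt_const c z

theorem add (hf : HasGradAt f a b z) (hg : HasGradAt g a' b' z) :
    HasGradAt (fun w => f w + g w) (a + a') (b + b') z := by
  refine HasFDerivAt.congr_fderiv (HasFDerivAt.add hf hg) ?_
  ext
  simp
  ring

theorem sub (hf : HasGradAt f a b z) (hg : HasGradAt g a' b' z) :
    HasGradAt (fun w => f w - g w) (a - a') (b - b') z := by
  refine HasFDerivAt.congr_fderiv (HasFDerivAt.sub hf hg) ?_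
  ext
  simp
  ring

theorem mul (hf : HasGradAt f a b z) (hg : HasGradAt g a' b' z) :
    HasGradAt (fun w => f w * g w) (f z * a' + g z * a) (f z * b' + g z * b) z := by
  refine HasFDerivAt.congr_fderiv (HasFDerivAt.mul hf hg) ?_
  ext
  simp
  ring

theorem rpow (hf : HasGradAt f a b z) (h0 : f z ≠ 0) (r : ℝ) :
    HasGradAt (fun w => f w ^ r) (r * f z ^ (r - 1) * a) (r * f z ^ (r - 1) * b) z := by
  refine HasFDerivAt.congr_fderiv (HasFDerivAt.rpow_const hf (Or.inl h0)) ?_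
  ext
  simp
  ring

end HasGradAt

/-- Sub-mean value property in terms of partial derivatives. -/
theorem subharmonic_comp_le_integral_of_hasGradAt {Φ Φx Φy Φxx Φxy Φyx Φyy : ℂ → ℝ}
    (hΦ : ∀ z, HasGradAt Φ (Φx z) (Φy z) z)
    (hx : ∀ z, HasGradAt Φx (Φxx z) (Φxy z) z) (hy : ∀ z, HasGradAt Φy (Φyx z) (Φyy z) z)
    (cxx : Continuous Φxx) (cxy : Continuous Φxy) (cyx : Continuous Φyx) (cyy : Continuous Φyy)
    (hΔ : ∀ z, 0 ≤ Φxx z + Φyy z) {P : ℂ → ℂ} (hP : Differentiable ℂ P) :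
    2 * π * Φ (P 0) ≤ ∫ θ in (0:ℝ)..(2*π), Φ (P (Complex.exp (θ * Complex.I))) :=
  subharmonic_comp_le_integral hΦ hx hy (by fun_prop) (by fun_prop) (fun z => by simpa using hΔ z) hP

theorem integral_rpow_le_of_le_two {p : ℝ} (hp : 1 < p) (hp2 : p ≤ 2) {ε : ℝ} (hε : 0 < ε)
    {P : ℂ → ℂ} (hP : Differentiable ℂ P) (h0 : P 0 = 0) :
    ∫ θ in (0:ℝ)..(2*π), (ε + ‖P (Complex.exp (θ * Complex.I))‖ ^ 2) ^ (p / 2) ≤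
      (2 / (p - 1)) * (∫ θ in (0:ℝ)..(2*π), (ε + (P (Complex.exp (θ * Complex.I))).re ^ 2) ^ (p / 2))
        + 2 * π * ε ^ (p / 2) := by
  set q := p / 2 with hq
  set c := 2 / (p - 1) with hc
  set S : ℂ → ℝ := fun z => ε + (z.re * z.re + z.im * z.im) with hS
  set R : ℂ → ℝ := fun z => ε + z.re * z.re with hR
  have Spos : ∀ z, 0 < S z := fun z => by
    have := mul_self_nonneg z.re
    have := mul_self_nonneg z.im
    simp only [hS]; linarith
  have Rpos : ∀ z, 0 < R z := fun z => by
    have := mul_self_nonneg z.re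
    simp only [hR]; linarith
  have cS : ∀ r : ℝ, Continuous fun z => S z ^ r := fun r =>
    Continuous.rpow_const (by fun_prop) fun z => Or.inl (Spos z).ne'
  have cR : ∀ r : ℝ, Continuous fun z => R z ^ r := fun r =>
    Continuous.rpow_const (by fun_prop) fun z => Or.inl (Rpos z).ne'
  have dS : ∀ (r : ℝ) z, HasGradAt (fun z => S z ^ r) (2 * r * z.re * S z ^ (r - 1))
      (2 * r * z.im * S z ^ (r - 1)) z := fun r z => by
    refine HasGradAt.congr_grad (((HasGradAt.const ε z).add (((HasGradAt.re z).mul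
      (HasGradAt.re z)).add ((HasGradAt.im z).mul (HasGradAt.im z)))).rpow (Spos z).ne' r) ?_ ?_
    · simp only [hS]; ring
    · simp only [hS]; ring
  have dR : ∀ (r : ℝ) z, HasGradAt (fun z => R z ^ r) (2 * r * z.re * R z ^ (r - 1)) 0 z :=
      fun r z => by
    refine HasGradAt.congr_grad (((HasGradAt.const ε z).add ((HasGradAt.re z).mul
      (HasGradAt.re z))).rpow (Rpos z).ne' r) ?_ ?_
    · simp only [hR]; ring
    · ring
  have key := subharmonic_comp_le_integral_of_hasGradAt
    (Φ := fun z => c * R z ^ q - S z ^ q)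
    (Φx := fun z => c * (2 * q) * (z.re * R z ^ (q - 1)) - 2 * q * (z.re * S z ^ (q - 1)))
    (Φy := fun z => - (2 * q) * (z.im * S z ^ (q - 1)))
    (Φxx := fun z => c * (2 * q) * (R z ^ (q - 1) + z.re * (2 * (q - 1) * z.re * R z ^ (q - 1 - 1)))
      - 2 * q * (S z ^ (q - 1) + z.re * (2 * (q - 1) * z.re * S z ^ (q - 1 - 1))))
    (Φxy := fun z => - (2 * q) * (z.re * (2 * (q - 1) * z.im * S z ^ (q - 1 - 1))))
    (Φyx := fun z => - (2 * q) * (z.im * (2 * (q - 1) * z.re * S z ^ (q - 1 - 1))))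
    (Φyy := fun z => - (2 * q) * (S z ^ (q - 1) + z.im * (2 * (q - 1) * z.im * S z ^ (q - 1 - 1))))
    (fun z => ?_) (fun z => ?_) (fun z => ?_) ?_ ?_ ?_ ?_ (fun z => ?_) hP
  · have hcont : Continuous fun θ : ℝ => P (Complex.exp (θ * Complex.I)) := by
      have := hP.continuous
      fun_prop
    have e1 : ∀ z : ℂ, S z = ε + ‖z‖ ^ 2 := fun z => by
      rw [hS, ← Complex.normSq_eq_norm_sq, Complex.normSq_apply]
    have e2 : ∀ z : ℂ, R z = ε + z.re ^ 2 := fun z => by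
      show ε + z.re * z.re = ε + z.re ^ 2
      ring
    rw [intervalIntegral.integral_sub, intervalIntegral.integral_const_mul, h0] at key
    · simp only [e1, e2] at key
      have hc0 : 0 ≤ c := div_nonneg (by norm_num) (by linarith)
      have h3 : 0 ≤ 2 * π * (c * ε ^ q) := by positivity
      simp only [Complex.zero_re, norm_zero, ne_eq, OfNat.ofNat_ne_zero, not_false_eq_true,
        zero_pow, add_zero] at key
      linarith
    · exact (((cR q).comp hcont).const_mul c |>.intervalIntegrable _ _)
    · exact (((cS q).comp hcont).intervalIntegrable _ _)
  · refine HasGradAt.congr_grad (((HasGradAt.const c z).mul (dR q z)).sub (dS q z)) ?_ ?_ <;>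
    · ring
  · refine HasGradAt.congr_grad (((HasGradAt.const (c * (2 * q)) z).mul
      ((HasGradAt.re z).mul (dR (q - 1) z))).sub
      ((HasGradAt.const (2 * q) z).mul ((HasGradAt.re z).mul (dS (q - 1) z)))) ?_ ?_ <;>
    · ring
  · refine HasGradAt.congr_grad
      ((HasGradAt.const (-(2 * q)) z).mul ((HasGradAt.im z).mul (dS (q - 1) z))) ?_ ?_ <;>
    · ring
  · have := cR (q - 1); have := cR (q - 1 - 1); have := cS (q - 1); have := cS (q - 1 - 1)
    fun_prop
  · have := cS (q - 1 - 1)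
    fun_prop
  · have := cS (q - 1 - 1)
    fun_prop
  · have := cS (q - 1); have := cS (q - 1 - 1)
    fun_prop
  · have hq1 : 0 < 2 * q - 1 := by rw [hq]; linarith
    have hc' : c * (2 * q - 1) = 2 := by
      rw [hc, hq]; field_simp
      rw [div_self]; linarith
    have eS : S z ^ (q - 1) = S z * S z ^ (q - 1 - 1) := by
      rw [Real.rpow_sub_one (Spos z).ne' (q - 1)]; field_simp [(Spos z).ne']
    have eR : R z ^ (q - 1) = R z * R z ^ (q - 1 - 1) := by
      rw [Real.rpow_sub_one (Rpos z).ne' (q - 1)]; field_simp [(Rpos z).ne']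
    have hRS : S z ^ (q - 1) ≤ R z ^ (q - 1) :=
      Real.rpow_le_rpow_of_nonpos (Rpos z) (by simp only [hS, hR]; nlinarith [mul_self_nonneg z.im])
        (by rw [hq]; linarith)
    have h1 : (2 * q - 1) * R z ^ (q - 1) ≤
        R z ^ (q - 1) + z.re * (2 * (q - 1) * z.re * R z ^ (q - 1 - 1)) := by
      rw [eR]
      have hx : z.re * z.re = R z - ε := by simp [hR]
      have : 0 ≤ R z ^ (q - 1 - 1) := Real.rpow_nonneg (Rpos z).le _
      have h : R z * R z ^ (q - 1 - 1) + z.re * (2 * (q - 1) * z.re * R z ^ (q - 1 - 1)) -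
        (2 * q - 1) * (R z * R z ^ (q - 1 - 1)) =
        (2 * (1 - q)) * ε * R z ^ (q - 1 - 1) := by
        linear_combination 2 * (q - 1) * R z ^ (q - 1 - 1) * hx
      have : 0 ≤ (2 * (1 - q)) * ε * R z ^ (q - 1 - 1) :=
        mul_nonneg (mul_nonneg (by rw [hq]; linarith) hε.le) this
      linarith
    have h2 : (S z ^ (q - 1) + z.re * (2 * (q - 1) * z.re * S z ^ (q - 1 - 1))) +
        (S z ^ (q - 1) + z.im * (2 * (q - 1) * z.im * S z ^ (q - 1 - 1))) ≤ 2 * S z ^ (q - 1) := by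
      have : 0 ≤ S z ^ (q - 1 - 1) := Real.rpow_nonneg (Spos z).le _
      have : 0 ≤ (2 * (1 - q)) * ((z.re * z.re + z.im * z.im) * S z ^ (q - 1 - 1)) :=
        mul_nonneg (by rw [hq]; linarith) (mul_nonneg (by nlinarith [mul_self_nonneg z.im]) this)
      linarith
    have hc0 : 0 < c := div_pos (by norm_num) (by linarith)
    have hqpos : 0 < q := by rw [hq]; linarith
    have h3 := mul_le_mul_of_nonneg_left h1 (show 0 ≤ c * (2 * q) by positivity)
    have h4 := mul_le_mul_of_nonneg_left (h2.trans (mul_le_mul_of_nonneg_left hRS zero_le_two))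
      (show 0 ≤ 2 * q by positivity)
    have h5 : c * (2 * q) * ((2 * q - 1) * R z ^ (q - 1)) = 2 * q * (2 * R z ^ (q - 1)) := by
      linear_combination (2 * q) * R z ^ (q - 1) * hc'
    linarith

theorem integral_rpow_le_of_two_le {p : ℝ} (hp2 : 2 ≤ p) {ε : ℝ} (hε : 0 < ε)
    {P : ℂ → ℂ} (hP : Differentiable ℂ P) (h0 : P 0 = 0) :
    ∫ θ in (0:ℝ)..(2*π), (ε + ‖P (Complex.exp (θ * Complex.I))‖ ^ 2) ^ (p / 2) ≤
      (p ^ 2 / 2) * (∫ θ in (0:ℝ)..(2*π), (P (Complex.exp (θ * Complex.I))).re ^ 2 *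
        (ε + ‖P (Complex.exp (θ * Complex.I))‖ ^ 2) ^ (p / 2 - 1)) + 2 * π * ε ^ (p / 2) := by
  set q := p / 2 with hq
  set c := p ^ 2 / 2 with hc
  set S : ℂ → ℝ := fun z => ε + (z.re * z.re + z.im * z.im) with hS
  have Spos : ∀ z, 0 < S z := fun z => by
    have := mul_self_nonneg z.re
    have := mul_self_nonneg z.im
    simp only [hS]; linarith
  have cS : ∀ r : ℝ, Continuous fun z => S z ^ r := fun r =>
    Continuous.rpow_const (by fun_prop) fun z => Or.inl (Spos z).ne'
  have dS : ∀ (r : ℝ) z, HasGradAt (fun z => S z ^ r) (2 * r * z.re * S z ^ (r - 1))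
      (2 * r * z.im * S z ^ (r - 1)) z := fun r z => by
    refine HasGradAt.congr_grad (((HasGradAt.const ε z).add (((HasGradAt.re z).mul
      (HasGradAt.re z)).add ((HasGradAt.im z).mul (HasGradAt.im z)))).rpow (Spos z).ne' r) ?_ ?_
    · simp only [hS]; ring
    · simp only [hS]; ring
  have dq : ∀ (w : ℂ), HasGradAt (fun z => z.re * z.re) (2 * w.re) 0 w := fun w =>
    HasGradAt.congr_grad ((HasGradAt.re w).mul (HasGradAt.re w)) (by ring) (by ring)
  have dc : ∀ (w : ℂ), HasGradAt (fun z => z.re * z.re * z.re) (3 * (w.re * w.re)) 0 w := fun w =>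
    HasGradAt.congr_grad ((dq w).mul (HasGradAt.re w)) (by ring) (by ring)
  set r := q - 1 with hr
  have key := subharmonic_comp_le_integral_of_hasGradAt
    (Φ := fun z => c * (z.re * z.re * S z ^ r) - S z ^ q)
    (Φx := fun z => c * (2 * (z.re * S z ^ r) + 2 * r * (z.re * z.re * z.re * S z ^ (r - 1))) -
      2 * q * (z.re * S z ^ r))
    (Φy := fun z => c * (2 * r * (z.re * z.re * (z.im * S z ^ (r - 1)))) -
      2 * q * (z.im * S z ^ r))
    (Φxx := fun z => c * (2 * (S z ^ r + z.re * (2 * r * z.re * S z ^ (r - 1))) +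
      2 * r * (3 * (z.re * z.re) * S z ^ (r - 1) +
        z.re * z.re * z.re * (2 * (r - 1) * z.re * S z ^ (r - 1 - 1)))) -
      2 * q * (S z ^ r + z.re * (2 * r * z.re * S z ^ (r - 1))))
    (Φxy := fun z => c * (2 * (z.re * (2 * r * z.im * S z ^ (r - 1))) +
      2 * r * (z.re * z.re * z.re * (2 * (r - 1) * z.im * S z ^ (r - 1 - 1)))) -
      2 * q * (z.re * (2 * r * z.im * S z ^ (r - 1))))
    (Φyx := fun z => c * (2 * r * (2 * z.re * (z.im * S z ^ (r - 1)) +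
      z.re * z.re * (z.im * (2 * (r - 1) * z.re * S z ^ (r - 1 - 1))))) -
      2 * q * (z.im * (2 * r * z.re * S z ^ (r - 1))))
    (Φyy := fun z => c * (2 * r * (z.re * z.re * (S z ^ (r - 1) +
      z.im * (2 * (r - 1) * z.im * S z ^ (r - 1 - 1))))) -
      2 * q * (S z ^ r + z.im * (2 * r * z.im * S z ^ (r - 1))))
    (fun z => ?_) (fun z => ?_) (fun z => ?_) ?_ ?_ ?_ ?_ (fun z => ?_) hP
  · have hcont : Continuous fun θ : ℝ => P (Complex.exp (θ * Complex.I)) := by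
      have := hP.continuous
      fun_prop
    have e1 : ∀ z : ℂ, S z = ε + ‖z‖ ^ 2 := fun z => by
      rw [hS, ← Complex.normSq_eq_norm_sq, Complex.normSq_apply]
    rw [intervalIntegral.integral_sub, intervalIntegral.integral_const_mul, h0] at key
    · simp only [e1] at key
      simp only [Complex.zero_re, norm_zero, ne_eq, OfNat.ofNat_ne_zero, not_false_eq_true,
        zero_pow, add_zero, mul_zero, zero_mul, zero_sub, ← pow_two] at key
      linarith
    · have := (cS r).comp hcont
      have h2 : Continuous fun θ : ℝ => (P (Complex.exp (θ * Complex.I))).re :=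
        Complex.continuous_re.comp hcont
      exact ((((h2.mul h2).mul this).const_mul c).intervalIntegrable _ _)
    · exact (((cS q).comp hcont).intervalIntegrable _ _)
  · refine HasGradAt.congr_grad (((HasGradAt.const c z).mul ((dq z).mul (dS r z))).sub (dS q z)) ?_ ?_ <;>
    · rw [← hr]; ring
  · refine HasGradAt.congr_grad (((HasGradAt.const c z).mul
      (((HasGradAt.const 2 z).mul ((HasGradAt.re z).mul (dS r z))).add
      ((HasGradAt.const (2 * r) z).mul ((dc z).mul (dS (r - 1) z))))).sub
      ((HasGradAt.const (2 * q) z).mul ((HasGradAt.re z).mul (dS r z)))) ?_ ?_ <;>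
    · ring
  · refine HasGradAt.congr_grad (((HasGradAt.const c z).mul ((HasGradAt.const (2 * r) z).mul
      ((dq z).mul ((HasGradAt.im z).mul (dS (r - 1) z))))).sub
      ((HasGradAt.const (2 * q) z).mul ((HasGradAt.im z).mul (dS r z)))) ?_ ?_ <;>
    · ring
  · have := cS r; have := cS (r - 1); have := cS (r - 1 - 1)
    fun_prop
  · have := cS (r - 1); have := cS (r - 1 - 1)
    fun_prop
  · have := cS (r - 1); have := cS (r - 1 - 1)
    fun_prop
  · have := cS r; have := cS (r - 1); have := cS (r - 1 - 1)
    fun_prop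
  · have hr0 : 0 ≤ r := by rw [hr, hq]; linarith
    set T := S z ^ (r - 1 - 1) with hT
    have T0 : 0 ≤ T := Real.rpow_nonneg (Spos z).le _
    have e1 : S z ^ (r - 1) = S z * T := by
      rw [hT, Real.rpow_sub_one (Spos z).ne' (r - 1)]; field_simp [(Spos z).ne']
    have e2 : S z ^ r = S z * (S z * T) := by
      rw [← e1, Real.rpow_sub_one (Spos z).ne' r]; field_simp [(Spos z).ne']
    have hs : S z = ε + (z.re * z.re + z.im * z.im) := rfl
    have hc' : c = 2 * q ^ 2 := by rw [hc, hq]; ring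
    have hqr : q = r + 1 := by rw [hr]; ring
    rw [e1, e2, hc', hqr]
    have hx := mul_self_nonneg z.re
    have hy := mul_self_nonneg z.im
    set X := z.re * z.re with hX
    set Y := z.im * z.im with hY
    have : 0 ≤ 2 * (r + 1) ^ 2 * (r * X * T * (8 * S z + 4 * ε + 4 * r * (X + Y))) +
        4 * (r + 1) * r * ε * S z * T := by
      have := (Spos z).le
      positivity
    refine this.trans (le_of_eq ?_)
    rw [hs]
    ring

/-- M. Riesz: the `L_p` norm over the circle of a holomorphic function vanishing at the centre is
controlled by that of its real part. -/
theorem exists_integral_norm_rpow_le_re {p : ℝ} (hp : 1 < p) :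
    ∃ C : ℝ, 0 < C ∧ ∀ P : ℂ → ℂ, Differentiable ℂ P → P 0 = 0 →
      ∫ θ in (0:ℝ)..(2*π), ‖P (Complex.exp (θ * Complex.I))‖ ^ p ≤
        C * ∫ θ in (0:ℝ)..(2*π), |(P (Complex.exp (θ * Complex.I))).re| ^ p := by
  have hp0 : 0 < p := by linarith
  have sq : ∀ x : ℝ, 0 ≤ x → ∀ r : ℝ, (x ^ 2) ^ r = x ^ (2 * r) := fun x hx r => by
    rw [Real.rpow_mul hx, Real.rpow_two]
  have lim : ∀ {h : ℝ → ℝ → ℝ}, Continuous (Function.uncurry h) →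
      Filter.Tendsto (fun ε => ∫ θ in (0:ℝ)..(2*π), h ε θ) (nhdsWithin 0 (Set.Ioi 0))
        (nhds (∫ θ in (0:ℝ)..(2*π), h 0 θ)) := fun {h} hh =>
    ((intervalIntegral.continuous_parametric_intervalIntegral_of_continuous' hh _ _).tendsto
      0).mono_left nhdsWithin_le_nhds
  have le0 : ∀ ε : ℝ, ∀ c : ℝ, Filter.Tendsto (fun ε : ℝ => 2 * π * ε ^ (p / 2))
      (nhdsWithin 0 (Set.Ioi 0)) (nhds 0) := fun ε c => by
    have h : Continuous fun ε : ℝ => 2 * π * ε ^ (p / 2) := by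
      have : Continuous fun ε : ℝ => ε ^ (p / 2) := Real.continuous_rpow_const (by positivity)
      fun_prop
    have := (h.tendsto 0).mono_left (nhdsWithin_le_nhds (s := Set.Ioi 0))
    rwa [Real.zero_rpow (by positivity), mul_zero] at this
  rcases le_total p 2 with hp2 | hp2
  · refine ⟨2 / (p - 1), div_pos (by norm_num) (by linarith), fun P hP h0 => ?_⟩
    have hcont : Continuous fun θ : ℝ => P (Complex.exp (θ * Complex.I)) := by
      have := hP.continuous
      fun_prop
    have cP := hP.continuous
    have cr : Continuous fun x : ℝ => x ^ (p / 2) := Real.continuous_rpow_const (by positivity)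
    have l1 := lim (h := fun ε θ => (ε + ‖P (Complex.exp (θ * Complex.I))‖ ^ 2) ^ (p / 2)) (by
      refine cr.comp (f := fun z : ℝ × ℝ => z.1 + ‖P (Complex.exp (z.2 * Complex.I))‖ ^ 2) ?_
      fun_prop)
    have l2 := lim (h := fun ε θ => (ε + (P (Complex.exp (θ * Complex.I))).re ^ 2) ^ (p / 2)) (by
      refine cr.comp (f := fun z : ℝ × ℝ => z.1 + (P (Complex.exp (z.2 * Complex.I))).re ^ 2) ?_
      fun_prop)
    have := le_of_tendsto_of_tendsto l1 ((l2.const_mul (2 / (p - 1))).add (le0 1 1))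
      (Filter.eventually_of_mem self_mem_nhdsWithin fun ε hε =>
        integral_rpow_le_of_le_two hp hp2 hε hP h0)
    have hre : ∀ z : ℂ, (z.re ^ 2) ^ (p / 2) = |z.re| ^ p := fun z => by
      rw [← sq_abs, sq _ (abs_nonneg _), show 2 * (p / 2) = p by ring]
    simp only [zero_add, add_zero, sq _ (norm_nonneg _), hre] at this
    rwa [show 2 * (p / 2) = p by ring] at this
  · refine ⟨p ^ p, by positivity, fun P hP h0 => ?_⟩
    have hcont : Continuous fun θ : ℝ => P (Complex.exp (θ * Complex.I)) := by
      have := hP.continuous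
      fun_prop
    have cP := hP.continuous
    have cr : Continuous fun x : ℝ => x ^ (p / 2) := Real.continuous_rpow_const (by positivity)
    have cr' : Continuous fun x : ℝ => x ^ (p / 2 - 1) :=
      Real.continuous_rpow_const (by linarith)
    have l1 := lim (h := fun ε θ => (ε + ‖P (Complex.exp (θ * Complex.I))‖ ^ 2) ^ (p / 2)) (by
      refine cr.comp (f := fun z : ℝ × ℝ => z.1 + ‖P (Complex.exp (z.2 * Complex.I))‖ ^ 2) ?_
      fun_prop)
    have l2 := lim (h := fun ε θ => (P (Complex.exp (θ * Complex.I))).re ^ 2 *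
        (ε + ‖P (Complex.exp (θ * Complex.I))‖ ^ 2) ^ (p / 2 - 1)) (by
      have h1 : Continuous fun z : ℝ × ℝ => z.1 + ‖P (Complex.exp (z.2 * Complex.I))‖ ^ 2 := by
        fun_prop
      have h2 := cr'.comp h1
      have h3 : Continuous fun z : ℝ × ℝ => (P (Complex.exp (z.2 * Complex.I))).re ^ 2 := by
        fun_prop
      exact h3.mul h2)
    have h := le_of_tendsto_of_tendsto l1 ((l2.const_mul (p ^ 2 / 2)).add (le0 1 1))
      (Filter.eventually_of_mem self_mem_nhdsWithin fun ε hε =>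
        integral_rpow_le_of_two_le hp2 hε hP h0)
    simp only [zero_add, add_zero, sq _ (norm_nonneg _)] at h
    rw [show 2 * (p / 2) = p by ring, show 2 * (p / 2 - 1) = p - 2 by ring] at h
    have pt : ∀ z : ℂ, p ^ 2 / 2 * (z.re ^ 2 * ‖z‖ ^ (p - 2)) ≤
        1 / 2 * ‖z‖ ^ p + p ^ p / 2 * |z.re| ^ p := fun z => by
      have hz : ‖z‖ ^ 2 * ‖z‖ ^ (p - 2) = ‖z‖ ^ p := by
        rcases eq_or_lt_of_le (norm_nonneg z) with h | h
        · rw [← h, Real.zero_rpow hp0.ne']; simp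
        · rw [← Real.rpow_natCast, ← Real.rpow_add h]; congr 1; push_cast; ring
      have hn : 0 ≤ ‖z‖ ^ (p - 2) := Real.rpow_nonneg (norm_nonneg _) _
      have hpp : 0 ≤ p ^ p / 2 * |z.re| ^ p := by positivity
      rcases le_total (p * |z.re|) ‖z‖ with hle | hle
      · have h1 : (p * |z.re|) ^ 2 ≤ ‖z‖ ^ 2 := pow_le_pow_left₀ (by positivity) hle 2
        rw [mul_pow, sq_abs] at h1
        have := mul_le_mul_of_nonneg_right h1 hn
        linarith
      · have h1 : ‖z‖ ^ (p - 2) ≤ (p * |z.re|) ^ (p - 2) :=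
          Real.rpow_le_rpow (norm_nonneg _) hle (by linarith)
        have h2 : (p * |z.re|) ^ 2 * (p * |z.re|) ^ (p - 2) = (p * |z.re|) ^ p := by
          rcases eq_or_lt_of_le (show 0 ≤ p * |z.re| by positivity) with h | h
          · rw [← h, Real.zero_rpow hp0.ne']; simp
          · rw [← Real.rpow_natCast, ← Real.rpow_add h]; congr 1; push_cast; ring
        have h3 := mul_le_mul_of_nonneg_left h1 (show 0 ≤ (p * |z.re|) ^ 2 by positivity)
        rw [h2, Real.mul_rpow hp0.le (abs_nonneg _), mul_pow, sq_abs] at h3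
        have : 0 ≤ 1 / 2 * ‖z‖ ^ p := by positivity
        linarith
    have cn : Continuous fun θ : ℝ => ‖P (Complex.exp (θ * Complex.I))‖ ^ p :=
      (Real.continuous_rpow_const hp0.le).comp hcont.norm
    have cre : Continuous fun θ : ℝ => |(P (Complex.exp (θ * Complex.I))).re| ^ p :=
      (Real.continuous_rpow_const hp0.le).comp (Complex.continuous_re.comp hcont).abs
    have cm : Continuous fun θ : ℝ => (P (Complex.exp (θ * Complex.I))).re ^ 2 *
        ‖P (Complex.exp (θ * Complex.I))‖ ^ (p - 2) :=
      ((Complex.continuous_re.comp hcont).pow 2).mul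
        ((Real.continuous_rpow_const (by linarith)).comp hcont.norm)
    have h2 : p ^ 2 / 2 * (∫ θ in (0:ℝ)..(2*π), (P (Complex.exp (θ * Complex.I))).re ^ 2 *
        ‖P (Complex.exp (θ * Complex.I))‖ ^ (p - 2)) ≤
        1 / 2 * (∫ θ in (0:ℝ)..(2*π), ‖P (Complex.exp (θ * Complex.I))‖ ^ p) +
        p ^ p / 2 * ∫ θ in (0:ℝ)..(2*π), |(P (Complex.exp (θ * Complex.I))).re| ^ p := by
      rw [← intervalIntegral.integral_const_mul, ← intervalIntegral.integral_const_mul,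
        ← intervalIntegral.integral_const_mul, ← intervalIntegral.integral_add
          ((cn.const_mul _).intervalIntegrable _ _) ((cre.const_mul _).intervalIntegrable _ _)]
      exact intervalIntegral.integral_mono_on (by positivity)
        ((cm.const_mul _).intervalIntegrable _ _)
        (((cn.const_mul _).add (cre.const_mul _)).intervalIntegrable _ _) fun θ _ => pt _
    linarith

/-- The real-valued `L_p` norm over a period. -/
def circNorm (p : ℝ) (f : ℝ → ℂ) : ℝ :=
  (eLpNorm f (ENNReal.ofReal p) (volume.restrict (Set.Ioc 0 (2 * π)))).toReal

/-- The character `θ ↦ e^{ikθ}`. -/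
def expo (k : ℤ) (θ : ℝ) : ℂ := Complex.exp (k * θ * Complex.I)

@[fun_prop]
theorem continuous_expo (k : ℤ) : Continuous (expo k) := by
  unfold expo; fun_prop

theorem norm_expo (k : ℤ) (θ : ℝ) : ‖expo k θ‖ = 1 := by
  rw [expo, ← Complex.ofReal_intCast, ← Complex.ofReal_mul, Complex.norm_exp_ofReal_mul_I]

theorem expo_add (k l : ℤ) (θ : ℝ) : expo (k + l) θ = expo k θ * expo l θ := by
  rw [expo, expo, expo, ← Complex.exp_add]; push_cast; ring_nf

theorem expo_zero (θ : ℝ) : expo 0 θ = 1 := by simp [expo]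

theorem conj_expo (k : ℤ) (θ : ℝ) : starRingEnd ℂ (expo k θ) = expo (-k) θ := by
  rw [expo, expo, ← Complex.exp_conj]; simp

theorem expo_mul_arg (k l : ℤ) (θ : ℝ) : expo k (l * θ) = expo (k * l) θ := by
  rw [expo, expo]; push_cast; ring_nf

theorem expo_arg_add (k : ℤ) (θ t : ℝ) : expo k (θ + t) = expo k θ * expo k t := by
  rw [expo, expo, expo, ← Complex.exp_add]; push_cast; ring_nf

theorem expo_periodic (k : ℤ) : Function.Periodic (expo k) (2 * π) := fun θ => by
  rw [expo, expo, Complex.exp_eq_exp_iff_exists_int]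
  exact ⟨k, by push_cast; ring⟩

section circNorm

variable {p : ℝ} {f g : ℝ → ℂ}

theorem memLp_circle_of_continuous (hf : Continuous f) (q : ℝ≥0∞) :
    MemLp f q (volume.restrict (Set.Ioc 0 (2 * π))) := by
  obtain ⟨C, hC⟩ := (isCompact_Icc (a := (0:ℝ)) (b := 2 * π)).exists_bound_of_continuousOn
    hf.continuousOn
  refine MemLp.of_bound hf.aestronglyMeasurable C ?_
  exact (ae_restrict_mem measurableSet_Ioc).mono fun x hx => hC x ⟨hx.1.le, hx.2⟩

theorem circNorm_nonneg : 0 ≤ circNorm p f := ENNReal.toReal_nonneg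

theorem circNorm_rpow (hp : 1 < p) (hf : Continuous f) :
    circNorm p f ^ p = ∫ θ in (0:ℝ)..(2*π), ‖f θ‖ ^ p := by
  have hp0 : 0 < p := by linarith
  have h0 : 0 ≤ ∫ θ in Set.Ioc 0 (2 * π), ‖f θ‖ ^ p :=
    integral_nonneg fun θ => Real.rpow_nonneg (norm_nonneg _) _
  rw [circNorm, (memLp_circle_of_continuous hf _).eLpNorm_eq_integral_rpow_norm
    (by simpa using hp0) ENNReal.ofReal_ne_top, ENNReal.toReal_ofReal hp0.le,
    ENNReal.toReal_ofReal (Real.rpow_nonneg h0 _), ← Real.rpow_mul h0, inv_mul_cancel₀ hp0.ne',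
    Real.rpow_one, intervalIntegral.integral_of_le (by positivity)]

theorem circNorm_mono (hg : Continuous g) (h : ∀ θ, ‖f θ‖ ≤ ‖g θ‖) :
    circNorm p f ≤ circNorm p g :=
  ENNReal.toReal_mono (memLp_circle_of_continuous hg _).eLpNorm_ne_top
    (eLpNorm_mono h)

theorem circNorm_congr (h : ∀ θ, ‖f θ‖ = ‖g θ‖) : circNorm p f = circNorm p g :=
  congrArg ENNReal.toReal (eLpNorm_congr_norm_ae (.of_forall h))

theorem circNorm_add_le (hp : 1 < p) (hf : Continuous f) (hg : Continuous g) :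
    circNorm p (f + g) ≤ circNorm p f + circNorm p g := by
  rw [circNorm, circNorm, circNorm, ← ENNReal.toReal_add
    (memLp_circle_of_continuous hf _).eLpNorm_ne_top
    (memLp_circle_of_continuous hg _).eLpNorm_ne_top]
  refine ENNReal.toReal_mono (ENNReal.add_ne_top.2
    ⟨(memLp_circle_of_continuous hf _).eLpNorm_ne_top,
    (memLp_circle_of_continuous hg _).eLpNorm_ne_top⟩)
    (eLpNorm_add_le hf.aestronglyMeasurable hg.aestronglyMeasurable ?_)
  rw [← ENNReal.ofReal_one]
  exact ENNReal.ofReal_le_ofReal hp.le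

theorem circNorm_smul (c : ℂ) : circNorm p (c • f) = ‖c‖ * circNorm p f := by
  rw [circNorm, eLpNorm_const_smul, ENNReal.toReal_mul, toReal_enorm, circNorm]

theorem circNorm_sum_le (hp : 1 < p) {ι : Type*} (s : Finset ι) (F : ι → ℝ → ℂ)
    (hF : ∀ i, Continuous (F i)) : circNorm p (∑ i ∈ s, F i) ≤ ∑ i ∈ s, circNorm p (F i) := by
  classical
  induction s using Finset.induction_on with
  | empty => simp [circNorm]
  | insert i s hi ih =>
    rw [Finset.sum_insert hi, Finset.sum_insert hi]
    have hc : Continuous (∑ i ∈ s, F i) := by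
      have : (∑ i ∈ s, F i) = fun θ => ∑ i ∈ s, F i θ := by ext; simp
      rw [this]; exact continuous_finsetSum _ fun i _ => hF i
    exact (circNorm_add_le hp (hF i) hc).trans (by linarith)

theorem circNorm_comp_two_mul (hp : 1 < p) (hf : Continuous f)
    (hper : Function.Periodic f (2 * π)) : circNorm p (fun θ => f (2 * θ)) = circNorm p f := by
  have hp0 : 0 < p := by linarith
  have h : circNorm p (fun θ => f (2 * θ)) ^ p = circNorm p f ^ p := by
    rw [circNorm_rpow hp (by fun_prop), circNorm_rpow hp hf]
    have cont : Continuous fun θ => ‖f θ‖ ^ p := (Real.continuous_rpow_const hp0.le).comp hf.norm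
    have hper' : Function.Periodic (fun θ => ‖f θ‖ ^ p) (2 * π) := fun θ => by
      simp only [hper θ]
    rw [intervalIntegral.integral_comp_mul_left (fun θ => ‖f θ‖ ^ p) two_ne_zero,
      ← intervalIntegral.integral_add_adjacent_intervals (b := 2 * π)
      (cont.intervalIntegrable _ _) (cont.intervalIntegrable _ _)]
    have := hper'.intervalIntegral_add_eq (2 * π) 0
    rw [zero_add, ← two_mul] at this
    rw [this, mul_zero, smul_eq_mul]; ring
  exact (Real.rpow_left_inj circNorm_nonneg circNorm_nonneg hp0.ne').1 h

end circNorm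

/-- Boundary values of entire functions vanishing at the origin. -/
def IsAnalyticTrace (F : ℝ → ℂ) : Prop :=
  ∃ P : ℂ → ℂ, Differentiable ℂ P ∧ P 0 = 0 ∧ ∀ θ : ℝ, F θ = P (Complex.exp (θ * Complex.I))

namespace IsAnalyticTrace

variable {F G : ℝ → ℂ}

theorem continuous (h : IsAnalyticTrace F) : Continuous F := by
  obtain ⟨P, hP, -, h⟩ := h
  have := hP.continuous
  rw [funext h]
  fun_prop

theorem add (hF : IsAnalyticTrace F) (hG : IsAnalyticTrace G) : IsAnalyticTrace (F + G) := by
  obtain ⟨P, hP, h0, h⟩ := hF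
  obtain ⟨Q, hQ, k0, k⟩ := hG
  exact ⟨fun z => P z + Q z, hP.add hQ, by simp [h0, k0], fun θ => by simp [h, k]⟩

theorem smul (c : ℂ) (hF : IsAnalyticTrace F) : IsAnalyticTrace (c • F) := by
  obtain ⟨P, hP, h0, h⟩ := hF
  exact ⟨fun z => c * P z, hP.const_mul c, by simp [h0], fun θ => by simp [h]⟩

theorem sum_expo {ι : Type*} (s : Finset ι) (a : ι → ℂ) (d : ι → ℤ) (hd : ∀ i ∈ s, 0 < d i) :
    IsAnalyticTrace (fun θ => ∑ i ∈ s, a i * expo (d i) θ) := by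
  refine ⟨fun z => ∑ i ∈ s, a i * z ^ (d i).toNat, by fun_prop, ?_, fun θ => ?_⟩
  · exact Finset.sum_eq_zero fun i hi => by
      rw [zero_pow (by have := hd i hi; omega), mul_zero]
  · refine Finset.sum_congr rfl fun i hi => ?_
    rw [← Complex.exp_nat_mul, expo]
    have : ((d i).toNat : ℂ) = (d i : ℂ) := by
      rw [← Int.cast_natCast, Int.toNat_of_nonneg (hd i hi).le]
    rw [this, mul_assoc]

end IsAnalyticTrace

theorem exists_circNorm_le_re {p : ℝ} (hp : 1 < p) : ∃ C : ℝ, 0 < C ∧ ∀ F, IsAnalyticTrace F →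
    circNorm p F ≤ C * circNorm p (fun θ => ((F θ).re : ℂ)) := by
  have hp0 : 0 < p := by linarith
  obtain ⟨C, hC, h⟩ := exists_integral_norm_rpow_le_re hp
  refine ⟨C ^ (1 / p), by positivity, fun F hF => ?_⟩
  have cF := hF.continuous
  obtain ⟨P, hP, h0, hFP⟩ := hF
  have cR : Continuous (fun θ => ((F θ).re : ℂ)) := by fun_prop
  refine (Real.rpow_le_rpow_iff circNorm_nonneg (mul_nonneg (by positivity) circNorm_nonneg)
    hp0).1 ?_
  rw [Real.mul_rpow (by positivity) circNorm_nonneg, ← Real.rpow_mul hC.le,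
    one_div_mul_cancel hp0.ne', Real.rpow_one, circNorm_rpow hp cF, circNorm_rpow hp cR]
  simpa only [hFP, Complex.norm_real, Real.norm_eq_abs] using h P hP h0

theorem exists_circNorm_analytic_le {p : ℝ} (hp : 1 < p) : ∃ C : ℝ, 0 < C ∧
    ∀ A B, IsAnalyticTrace A → IsAnalyticTrace B →
      circNorm p A ≤ C * circNorm p (fun θ => starRingEnd ℂ (B θ) + A θ) := by
  obtain ⟨C, hC, h⟩ := exists_circNorm_le_re hp
  refine ⟨C, hC, fun A B hA hB => ?_⟩
  have cG : Continuous (fun θ => starRingEnd ℂ (B θ) + A θ) := by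
    have := hA.continuous
    have := hB.continuous
    fun_prop
  have h1 := h _ (hA.add hB)
  have h2 := h _ ((hA.add (hB.smul (-1))).smul (-Complex.I))
  have h3 : circNorm p (fun θ => (((A + B) θ).re : ℂ)) ≤
      circNorm p (fun θ => starRingEnd ℂ (B θ) + A θ) := circNorm_mono cG fun θ => by
    rw [Complex.norm_real, Real.norm_eq_abs]
    refine le_trans (le_of_eq ?_) (Complex.abs_re_le_norm _)
    simp [add_comm]
  have h4 : circNorm p (fun θ => ((((-Complex.I) • (A + (-1 : ℂ) • B)) θ).re : ℂ)) ≤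
      circNorm p (fun θ => starRingEnd ℂ (B θ) + A θ) := circNorm_mono cG fun θ => by
    rw [Complex.norm_real, Real.norm_eq_abs]
    refine le_trans (le_of_eq ?_) (Complex.abs_im_le_norm _)
    simp [add_comm]
  rw [circNorm_smul, norm_neg, Complex.norm_I, one_mul] at h2
  have h5 := circNorm_add_le hp (hA.add hB).continuous (hA.add (hB.smul (-1))).continuous
  have h6 : A + B + (A + (-1 : ℂ) • B) = (2 : ℂ) • A := by ext; simp; ring
  rw [h6, circNorm_smul, Complex.norm_two] at h5
  have := mul_le_mul_of_nonneg_left h3 hC.le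
  have := mul_le_mul_of_nonneg_left h4 hC.le
  linarith

theorem exists_circNorm_tail_le {p : ℝ} (hp : 1 < p) : ∃ C : ℝ, 0 < C ∧
    ∀ (s : Finset ℤ) (a : ℤ → ℂ) (j : ℤ),
      circNorm p (fun θ => ∑ k ∈ s with j < k, a k * expo k θ) ≤
        C * circNorm p (fun θ => ∑ k ∈ s, a k * expo k θ) := by
  obtain ⟨C, hC, h⟩ := exists_circNorm_analytic_le hp
  refine ⟨C, hC, fun s a j => ?_⟩
  have per : ∀ t : Finset ℤ, Function.Periodic (fun θ => ∑ k ∈ t, a k * expo k θ) (2 * π) :=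
    fun t θ => by simp only [expo_periodic _ θ]
  have h2 : ∀ (k : ℤ) (θ : ℝ), expo k (2 * θ) = expo (2 * j + 1) θ * expo (2 * k - 2 * j - 1) θ :=
    fun k θ => by
      have := expo_mul_arg k 2 θ
      rw [← expo_add]
      push_cast at this
      rw [this]; congr 1; ring
  have key := h (fun θ => ∑ k ∈ s with j < k, a k * expo (2 * k - 2 * j - 1) θ)
    (fun θ => ∑ k ∈ s with ¬ j < k, starRingEnd ℂ (a k) * expo (-(2 * k - 2 * j - 1)) θ)
    (.sum_expo _ _ _ fun k hk => by have := (Finset.mem_filter.1 hk).2; omega)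
    (.sum_expo _ _ _ fun k hk => by have := (Finset.mem_filter.1 hk).2; omega)
  rw [← circNorm_comp_two_mul hp (by fun_prop) (per s),
    ← circNorm_comp_two_mul hp (by fun_prop) (per _)]
  convert key using 1
  · refine circNorm_congr fun θ => ?_
    simp only [h2, mul_left_comm (a _), ← Finset.mul_sum, norm_mul, norm_expo, one_mul]
  · congr 1
    refine circNorm_congr fun θ => ?_
    have : ∑ k ∈ s, a k * expo k (2 * θ) = expo (2 * j + 1) θ *
        (starRingEnd ℂ (∑ k ∈ s with ¬ j < k, starRingEnd ℂ (a k) * expo (-(2 * k - 2 * j - 1)) θ)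
          + ∑ k ∈ s with j < k, a k * expo (2 * k - 2 * j - 1) θ) := by
      simp only [map_sum, map_mul, Complex.conj_conj, conj_expo, neg_neg]
      rw [add_comm (Finset.sum _ _), Finset.sum_filter_add_sum_filter_not, Finset.mul_sum]
      exact Finset.sum_congr rfl fun k _ => by rw [h2]; ring
    rw [this, norm_mul, norm_expo, one_mul]

/-- The nonzero frequencies of modulus at most `N`. -/
def freqs (N : ℕ) : Finset ℤ := (Finset.Icc (-N : ℤ) N).erase 0

theorem mem_freqs {N : ℕ} {k : ℤ} : k ∈ freqs N ↔ k ≠ 0 ∧ -(N : ℤ) ≤ k ∧ k ≤ N := by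
  simp [freqs]

theorem sum_freqs {M : Type*} [AddCommMonoid M] (f : ℤ → M) (N : ℕ) :
    ∑ k ∈ freqs N, f k = ∑ j ∈ Finset.Icc 1 N, (f (j : ℤ) + f (-(j : ℤ))) := by
  induction N with
  | zero => simp [freqs]
  | succ N ih =>
    have h : freqs (N + 1) = insert ((N : ℤ) + 1) (insert (-((N : ℤ) + 1)) (freqs N)) := by
      ext k; simp only [mem_freqs, Finset.mem_insert]; push_cast; omega
    rw [h, Finset.sum_insert, Finset.sum_insert, ih, Finset.sum_Icc_succ_top (by omega)]
    · push_cast; rw [← add_assoc, add_comm]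
    · simp only [mem_freqs]; omega
    · simp only [Finset.mem_insert, mem_freqs]; omega

/-- The sequence `m` extended to the nonzero integers with Hermitian symmetry. -/
def hermMul (m : ℕ → ℂ) (k : ℤ) : ℂ :=
  if 0 < k then m k.toNat else starRingEnd ℂ (m (-k).toNat)

theorem hermMul_natCast (m : ℕ → ℂ) {j : ℕ} (hj : 1 ≤ j) : hermMul m (j : ℤ) = m j := by
  rw [hermMul, if_pos (by omega)]; simp

theorem hermMul_neg (m : ℕ → ℂ) (j : ℕ) :
    hermMul m (-(j : ℤ)) = starRingEnd ℂ (m j) := by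
  rw [hermMul, if_neg (by omega)]; simp

/-- `m` and its total variation over the positive integers are bounded by `M`. -/
structure BVBound (m : ℕ → ℂ) (M : ℝ) : Prop where
  bound : ∀ j, 1 ≤ j → ‖m j‖ ≤ M
  variation : ∀ N, ∑ j ∈ Finset.Icc 1 N, ‖m (j + 1) - m j‖ ≤ M

theorem abel_sum (m x : ℕ → ℂ) (N : ℕ) :
    ∑ k ∈ Finset.Icc 1 N, m k * x k = m 1 * ∑ k ∈ Finset.Icc 1 N, x k +
      ∑ j ∈ Finset.Icc 1 N, (m (j + 1) - m j) * ∑ k ∈ Finset.Icc 1 N with j < k, x k := by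
  have h : ∀ k ∈ Finset.Icc 1 N,
      ∑ j ∈ Finset.Icc 1 N, (if j < k then (m (j + 1) - m j) * x k else 0) = (m k - m 1) * x k := by
    intro k hk
    have hk := Finset.mem_Icc.1 hk
    rw [← Finset.sum_filter, ← Finset.sum_mul]
    congr 1
    have : Finset.filter (· < k) (Finset.Icc 1 N) = Finset.Ico 1 k := by
      ext j; simp only [Finset.mem_filter, Finset.mem_Icc, Finset.mem_Ico]; omega
    rw [this, Finset.sum_Ico_sub _ hk.1]
  simp only [Finset.mul_sum, Finset.sum_filter, mul_ite, mul_zero]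
  rw [Finset.sum_comm, Finset.sum_congr rfl h, ← Finset.sum_add_distrib]
  exact Finset.sum_congr rfl fun k _ => by ring

theorem exists_circNorm_multiplier_le {p : ℝ} (hp : 1 < p) : ∃ K : ℝ, 0 < K ∧
    ∀ (N : ℕ) (c : ℤ → ℂ) (m : ℕ → ℂ) (M : ℝ), BVBound m M →
      circNorm p (fun θ => ∑ k ∈ freqs N, hermMul m k * c k * expo k θ) ≤
        K * M * circNorm p (fun θ => ∑ k ∈ freqs N, c k * expo k θ) := by
  obtain ⟨C, hC, h⟩ := exists_circNorm_tail_le hp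
  have pos : ∀ (N : ℕ) (c : ℤ → ℂ) (m : ℕ → ℂ) (M : ℝ), BVBound m M →
      circNorm p (fun θ => ∑ j ∈ Finset.Icc 1 N, m j * (c j * expo j θ)) ≤
        2 * C * M * circNorm p (fun θ => ∑ k ∈ freqs N, c k * expo k θ) := by
    intro N c m M hm
    have cont : ∀ s : Finset ℕ, Continuous (fun θ => ∑ k ∈ s, c k * expo k θ) := fun s => by
      fun_prop
    have tail : ∀ j : ℕ, circNorm p (fun θ => ∑ k ∈ Finset.Icc 1 N with j < k, c k * expo k θ) ≤
        C * circNorm p (fun θ => ∑ k ∈ freqs N, c k * expo k θ) := fun j => by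
      refine (circNorm_congr fun θ => ?_).trans_le (h (freqs N) c j)
      rw [Finset.sum_filter, Finset.sum_filter, sum_freqs]
      congr 1
      refine Finset.sum_congr rfl fun k _ => ?_
      rw [if_neg (show ¬ (j : ℤ) < -(k : ℤ) by omega), add_zero]
      simp only [Nat.cast_lt]
    have tail0 := tail 0
    rw [Finset.filter_true_of_mem fun k hk => by have := (Finset.mem_Icc.1 hk).1; omega] at tail0
    have e : (fun θ => ∑ j ∈ Finset.Icc 1 N, m j * (c j * expo j θ)) =
        m 1 • (fun θ => ∑ k ∈ Finset.Icc 1 N, c k * expo k θ) +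
        ∑ j ∈ Finset.Icc 1 N, (m (j + 1) - m j) •
          (fun θ => ∑ k ∈ Finset.Icc 1 N with j < k, c k * expo k θ) := by
      ext θ
      simp only [Pi.add_apply, Pi.smul_apply, Finset.sum_apply, smul_eq_mul]
      exact abel_sum m (fun k => c k * expo k θ) N
    have c2 : Continuous (∑ j ∈ Finset.Icc 1 N, (m (j + 1) - m j) •
          (fun θ => ∑ k ∈ Finset.Icc 1 N with j < k, c k * expo k θ)) := by
      have : (∑ j ∈ Finset.Icc 1 N, (m (j + 1) - m j) •
          (fun θ => ∑ k ∈ Finset.Icc 1 N with j < k, c k * expo k θ)) =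
          fun θ => ∑ j ∈ Finset.Icc 1 N, (m (j + 1) - m j) *
            ∑ k ∈ Finset.Icc 1 N with j < k, c k * expo k θ := by ext θ; simp
      rw [this]
      fun_prop
    set T := C * circNorm p (fun θ => ∑ k ∈ freqs N, c k * expo k θ) with hT
    have T0 : 0 ≤ T := mul_nonneg hC.le circNorm_nonneg
    rw [e]
    refine (circNorm_add_le hp ((cont _).const_smul _) c2).trans ?_
    have h1 := circNorm_sum_le hp (Finset.Icc 1 N) (fun j => (m (j + 1) - m j) •
          (fun θ => ∑ k ∈ Finset.Icc 1 N with j < k, c k * expo k θ))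
          (fun j => (cont _).const_smul _)
    have h2 : ∑ j ∈ Finset.Icc 1 N, circNorm p ((m (j + 1) - m j) •
          (fun θ => ∑ k ∈ Finset.Icc 1 N with j < k, c k * expo k θ)) ≤ M * T := by
      refine le_trans ?_ (mul_le_mul_of_nonneg_right (hm.variation N) T0)
      rw [Finset.sum_mul]
      refine Finset.sum_le_sum fun j _ => ?_
      rw [circNorm_smul]
      exact mul_le_mul_of_nonneg_left (tail j) (norm_nonneg _)
    have h3 : circNorm p (m 1 • (fun θ => ∑ k ∈ Finset.Icc 1 N, c k * expo k θ)) ≤ M * T := by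
      rw [circNorm_smul]
      exact mul_le_mul (hm.bound 1 le_rfl) tail0 circNorm_nonneg
        ((norm_nonneg _).trans (hm.bound 1 le_rfl))
    rw [show 2 * C * M * circNorm p (fun θ => ∑ k ∈ freqs N, c k * expo k θ) = M * T + M * T by
      rw [hT]; ring]
    exact add_le_add h3 (h1.trans h2)
  refine ⟨4 * C, by positivity, fun N c m M hm => ?_⟩
  have h1 := pos N c m M hm
  have h2 := pos N (fun k => starRingEnd ℂ (c (-k))) m M hm
  have e1 : circNorm p (fun θ => ∑ k ∈ freqs N, starRingEnd ℂ (c (-k)) * expo k θ) =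
      circNorm p (fun θ => ∑ k ∈ freqs N, c k * expo k θ) := circNorm_congr fun θ => by
    rw [← RCLike.norm_conj (∑ k ∈ freqs N, c k * expo k θ), map_sum, sum_freqs, sum_freqs]
    congr 1
    refine Finset.sum_congr rfl fun j _ => ?_
    simp only [map_mul, conj_expo, neg_neg, add_comm]
  have e2 : circNorm p (fun θ => ∑ j ∈ Finset.Icc 1 N, m j * (starRingEnd ℂ (c (-j)) * expo j θ)) =
      circNorm p (fun θ => ∑ j ∈ Finset.Icc 1 N,
        starRingEnd ℂ (m j) * (c (-j) * expo (-j) θ)) := circNorm_congr fun θ => by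
    rw [← RCLike.norm_conj, map_sum]
    simp only [map_mul, conj_expo, Complex.conj_conj]
  rw [e1, e2] at h2
  have e3 : (fun θ => ∑ k ∈ freqs N, hermMul m k * c k * expo k θ) =
      (fun θ => ∑ j ∈ Finset.Icc 1 N, m j * (c j * expo j θ)) + (fun θ => ∑ j ∈ Finset.Icc 1 N,
        starRingEnd ℂ (m j) * (c (-j) * expo (-j) θ)) := by
    ext θ
    rw [sum_freqs, Finset.sum_add_distrib, Pi.add_apply]
    congr 1 <;> refine Finset.sum_congr rfl fun j hj => ?_
    · rw [hermMul_natCast m (Finset.mem_Icc.1 hj).1, mul_assoc]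
    · rw [hermMul_neg, mul_assoc]
  rw [e3]
  refine (circNorm_add_le hp (by fun_prop) (by fun_prop)).trans ?_
  linarith

namespace BVBound

theorem const (c : ℂ) : BVBound (fun _ => c) ‖c‖ :=
  ⟨fun _ _ => le_rfl, fun N => by simp⟩

theorem nonneg {m : ℕ → ℂ} {M : ℝ} (h : BVBound m M) : 0 ≤ M :=
  (norm_nonneg _).trans (h.bound 1 le_rfl)

theorem mul {m m' : ℕ → ℂ} {M M' : ℝ} (h : BVBound m M) (h' : BVBound m' M') :
    BVBound (fun j => m j * m' j) (2 * M * M') := by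
  have := h.nonneg
  have := h'.nonneg
  refine ⟨fun j hj => ?_, fun N => ?_⟩
  · rw [norm_mul]
    have := mul_le_mul (h.bound j hj) (h'.bound j hj) (norm_nonneg _) h.nonneg
    nlinarith [mul_nonneg h.nonneg h'.nonneg]
  · have h1 : ∀ j ∈ Finset.Icc 1 N, ‖m (j + 1) * m' (j + 1) - m j * m' j‖ ≤
        M * ‖m' (j + 1) - m' j‖ + ‖m (j + 1) - m j‖ * M' := fun j hj => by
      have hj := (Finset.mem_Icc.1 hj).1
      rw [show m (j + 1) * m' (j + 1) - m j * m' j =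
        m (j + 1) * (m' (j + 1) - m' j) + (m (j + 1) - m j) * m' j by ring]
      refine (norm_add_le _ _).trans ?_
      rw [norm_mul, norm_mul]
      exact add_le_add (mul_le_mul_of_nonneg_right (h.bound _ (by omega)) (norm_nonneg _))
        (mul_le_mul_of_nonneg_left (h'.bound _ hj) (norm_nonneg _))
    refine (Finset.sum_le_sum h1).trans ?_
    rw [Finset.sum_add_distrib, ← Finset.mul_sum, ← Finset.sum_mul]
    have h2 := mul_le_mul_of_nonneg_left (h'.variation N) h.nonneg
    have h3 := mul_le_mul_of_nonneg_right (h.variation N) h'.nonneg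
    linarith

/-- A monotone real sequence with values in `[0, M]`. -/
theorem of_monotone {m : ℕ → ℝ} {M : ℝ} (h0 : ∀ j, 1 ≤ j → 0 ≤ m j) (hM : ∀ j, 1 ≤ j → m j ≤ M)
    (hmono : ∀ j, 1 ≤ j → m j ≤ m (j + 1)) : BVBound (fun j => (m j : ℂ)) M := by
  refine ⟨fun j hj => ?_, fun N => ?_⟩
  · rw [Complex.norm_real, Real.norm_of_nonneg (h0 j hj)]; exact hM j hj
  · have : ∀ j ∈ Finset.Icc 1 N, ‖(m (j + 1) : ℂ) - m j‖ = m (j + 1) - m j := fun j hj => by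
      rw [← Complex.ofReal_sub, Complex.norm_real,
        Real.norm_of_nonneg (sub_nonneg.2 (hmono j (Finset.mem_Icc.1 hj).1))]
    rw [Finset.sum_congr rfl this, ← Finset.Ico_add_one_right_eq_Icc,
      Finset.sum_Ico_sub _ (by omega)]
    have := h0 1 le_rfl
    have := hM (N + 1) (by omega)
    linarith

/-- An antitone real sequence with values in `[0, M]`. -/
theorem of_antitone {m : ℕ → ℝ} {M : ℝ} (h0 : ∀ j, 1 ≤ j → 0 ≤ m j) (hM : ∀ j, 1 ≤ j → m j ≤ M)
    (hanti : ∀ j, 1 ≤ j → m (j + 1) ≤ m j) : BVBound (fun j => (m j : ℂ)) M := by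
  refine ⟨fun j hj => ?_, fun N => ?_⟩
  · rw [Complex.norm_real, Real.norm_of_nonneg (h0 j hj)]; exact hM j hj
  · have : ∀ j ∈ Finset.Icc 1 N, ‖(m (j + 1) : ℂ) - m j‖ = -(m (j + 1) - m j) := fun j hj => by
      rw [← Complex.ofReal_sub, Complex.norm_real,
        Real.norm_of_nonpos (sub_nonpos.2 (hanti j (Finset.mem_Icc.1 hj).1))]
    rw [Finset.sum_congr rfl this, Finset.sum_neg_distrib, ← Finset.Ico_add_one_right_eq_Icc,
      Finset.sum_Ico_sub _ (by omega)]
    have := h0 (N + 1) (by omega)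
    have := hM 1 le_rfl
    linarith

end BVBound

/-- The coefficients of the fractional difference operator. -/
def diffCoeff (α : ℝ) (ν : ℕ) : ℝ := (-1 : ℝ) ^ ν * fracBinom α ν

theorem diffCoeff_zero (α : ℝ) : diffCoeff α 0 = 1 := by simp [diffCoeff, fracBinom]

theorem abs_diffCoeff (α : ℝ) (ν : ℕ) : |diffCoeff α ν| = |fracBinom α ν| := by
  simp [diffCoeff, abs_mul]

theorem summable_abs_diffCoeff {α : ℝ} (hα : 0 < α) : Summable fun ν => |diffCoeff α ν| := by
  obtain ⟨n, hn⟩ := exists_nat_ge α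
  rw [← summable_nat_add_iff n]
  have step : ∀ ν, α * |diffCoeff α (ν + n)| =
      ((ν + n : ℕ) : ℝ) * |diffCoeff α (ν + n)| -
        ((ν + 1 + n : ℕ) : ℝ) * |diffCoeff α (ν + 1 + n)| := fun ν => by
    have h1 : |fracBinom α (ν + 1 + n)| * ((ν + 1 + n : ℕ) : ℝ) =
        |fracBinom α (ν + n)| * ((ν + n : ℕ) - α) := by
      rw [show ν + 1 + n = (ν + n) + 1 by ring, fracBinom, abs_div, abs_mul,
        abs_of_nonpos (show α - ((ν + n : ℕ) : ℝ) ≤ 0 by push_cast; have := Nat.cast_nonneg (α := ℝ) ν; linarith),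
        abs_of_pos (show 0 < ((ν + n : ℕ) : ℝ) + 1 by positivity)]
      have : ((ν + n : ℕ) : ℝ) + 1 ≠ 0 := by positivity
      push_cast at this ⊢
      field_simp
      ring
    rw [abs_diffCoeff, abs_diffCoeff]
    linarith
  refine summable_of_sum_range_le (c := α⁻¹ * (n * |diffCoeff α n|)) (fun _ => abs_nonneg _)
    fun N => ?_
  rw [← mul_le_mul_iff_right₀ hα, ← mul_assoc, mul_inv_cancel₀ hα.ne', one_mul, Finset.mul_sum]
  simp only [step]
  rw [Finset.sum_range_sub' (fun ν => ((ν + n : ℕ) : ℝ) * |diffCoeff α (ν + n)|)]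
  simp only [zero_add]
  have : 0 ≤ ((N + n : ℕ) : ℝ) * |diffCoeff α (N + n)| := by positivity
  linarith

theorem summable_diffCoeff_mul {α : ℝ} (hα : 0 < α) {u : ℕ → ℂ} (hu : ∀ ν, ‖u ν‖ ≤ 1) :
    Summable fun ν => (diffCoeff α ν : ℂ) * u ν := by
  refine Summable.of_norm_bounded (summable_abs_diffCoeff hα) fun ν => ?_
  rw [norm_mul, Complex.norm_real, Real.norm_eq_abs]
  exact mul_le_of_le_one_right (abs_nonneg _) (hu ν)

theorem choose_eq_fracBinom (α : ℝ) (ν : ℕ) : Ring.choose (α : ℂ) ν = (fracBinom α ν : ℂ) := by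
  induction ν with
  | zero => simp [fracBinom]
  | succ ν ih =>
    rw [Ring.choose_eq_smul] at ih ⊢
    rw [descPochhammer_succ_right, Polynomial.smeval_mul, fracBinom]
    push_cast
    rw [← ih, Nat.factorial_succ]
    have : (ν.factorial : ℂ) ≠ 0 := by exact_mod_cast ν.factorial_ne_zero
    have : (ν : ℂ) + 1 ≠ 0 := by exact_mod_cast ν.succ_ne_zero
    simp [Polynomial.smeval_natCast]
    field_simp

theorem hasSum_diffCoeff_of_norm_lt_one (α : ℝ) {w : ℂ} (hw : ‖w‖ < 1) :
    HasSum (fun ν => (diffCoeff α ν : ℂ) * w ^ ν) ((1 - w) ^ (α : ℂ)) := by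
  have h := (Complex.one_add_cpow_hasFPowerSeriesOnBall_zero (a := α)).hasSum (y := -w) (by
    simpa [enorm_eq_nnnorm, ← NNReal.coe_lt_coe] using hw)
  simp only [binomialSeries_apply, choose_eq_fracBinom] at h
  have e : ∀ ν : ℕ, (fracBinom α ν : ℂ) • (List.ofFn fun _ : Fin ν => -w).prod =
      (diffCoeff α ν : ℂ) * w ^ ν := fun ν => by
    rw [List.ofFn_const, List.prod_replicate, neg_pow, diffCoeff, smul_eq_mul]
    push_cast; ring
  simpa only [e, zero_add, sub_eq_add_neg] using h

theorem tsum_diffCoeff_of_norm_le_one {α : ℝ} (hα : 0 < α) {w : ℂ} (hw : ‖w‖ ≤ 1) :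
    ∑' ν, (diffCoeff α ν : ℂ) * w ^ ν = (1 - w) ^ (α : ℂ) := by
  have bound : ∀ ν : ℕ, ∀ r ∈ Set.Icc (0:ℝ) 1, ‖(diffCoeff α ν : ℂ) * (r * w) ^ ν‖ ≤ |diffCoeff α ν| :=
    fun ν r hr => by
      rw [norm_mul, Complex.norm_real, Real.norm_eq_abs, norm_pow, norm_mul, Complex.norm_real,
        Real.norm_of_nonneg hr.1]
      refine mul_le_of_le_one_right (abs_nonneg _) (pow_le_one₀ (by have := hr.1; positivity) ?_)
      exact mul_le_one₀ hr.2 (norm_nonneg _) hw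
  have c1 : ContinuousOn (fun r : ℝ => ∑' ν, (diffCoeff α ν : ℂ) * (r * w) ^ ν) (Set.Icc 0 1) :=
    continuousOn_tsum (fun ν => by fun_prop) (summable_abs_diffCoeff hα) bound
  have c2 : ContinuousOn (fun r : ℝ => (1 - r * w) ^ (α : ℂ)) (Set.Icc 0 1) := fun r hr => by
    have h1 : ContinuousAt (fun r : ℝ => 1 - r * w) r := by fun_prop
    have h2 : ContinuousAt (fun z : ℂ => z ^ (α : ℂ)) (1 - r * w) := by
      by_cases h : 1 - r * w = 0
      · rw [h]
        exact Complex.continuousAt_cpow_const_of_re_pos (Or.inl le_rfl) (by simpa using hα)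
      · refine continuousAt_cpow_const ?_
        have hn : ‖(r : ℂ) * w‖ ≤ 1 := by
          rw [norm_mul, Complex.norm_real, Real.norm_of_nonneg hr.1]
          exact mul_le_one₀ hr.2 (norm_nonneg _) hw
        rw [Complex.mem_slitPlane_iff]
        by_contra! hc
        have hre := (Complex.re_le_norm ((r : ℂ) * w)).trans hn
        apply h
        apply Complex.ext
        · have := hc.1; simp only [Complex.sub_re, Complex.one_re] at this
          simp only [Complex.sub_re, Complex.one_re, Complex.zero_re]; linarith
        · exact hc.2
    exact (ContinuousAt.comp (f := fun r : ℝ => 1 - r * w) h2 h1).continuousWithinAt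
  have heq : Set.EqOn (fun r : ℝ => ∑' ν, (diffCoeff α ν : ℂ) * (r * w) ^ ν)
      (fun r : ℝ => (1 - r * w) ^ (α : ℂ)) (Set.Ico 0 1) := fun r hr => by
    refine (hasSum_diffCoeff_of_norm_lt_one α ?_).tsum_eq
    rw [norm_mul, Complex.norm_real, Real.norm_of_nonneg hr.1]
    exact (mul_le_of_le_one_right hr.1 hw).trans_lt hr.2
  have := heq.of_subset_closure c1 c2 Set.Ico_subset_Icc_self
    (by rw [closure_Ico zero_ne_one]) (Set.right_mem_Icc.2 zero_le_one)
  simpa using this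

/-- The Fourier multiplier of the fractional difference of order `α` with step `h`. -/
def diffMul (α h : ℝ) (k : ℤ) : ℂ :=
  ∑' ν : ℕ, (diffCoeff α ν : ℂ) * Complex.exp (k * ((α - ν) * h) * Complex.I)

theorem norm_exp_mul_I_eq_one {z : ℂ} {x : ℝ} (h : z = x) : ‖Complex.exp (z * Complex.I)‖ = 1 := by
  rw [h, Complex.norm_exp_ofReal_mul_I]

theorem diffMul_neg (α h : ℝ) (k : ℤ) : diffMul α h (-k) = starRingEnd ℂ (diffMul α h k) := by
  rw [diffMul, diffMul, Complex.conj_tsum]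
  refine tsum_congr fun ν => ?_
  rw [map_mul, Complex.conj_ofReal, ← Complex.exp_conj]
  simp

theorem diffMul_neg_step (α h : ℝ) (k : ℤ) : diffMul α (-h) k = diffMul α h (-k) := by
  rw [diffMul, diffMul]
  refine tsum_congr fun ν => ?_
  congr 2
  push_cast; ring

theorem diffMul_eq {α : ℝ} (hα : 0 < α) {h : ℝ} {k : ℤ} (h0 : 0 ≤ k * h) (hπ : k * h ≤ π) :
    diffMul α h k = ((2 * Real.sin (k * h / 2)) ^ α : ℝ) * Complex.exp (α * π / 2 * Complex.I) *
      Complex.exp (k * (α * h / 2) * Complex.I) := by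
  set θ : ℝ := k * h with hθ
  have e1 : diffMul α h k = Complex.exp (α * θ * Complex.I) *
      (1 - Complex.exp (-θ * Complex.I)) ^ (α : ℂ) := by
    rw [← tsum_diffCoeff_of_norm_le_one hα
      (norm_exp_mul_I_eq_one (x := -θ) (by push_cast; rfl)).le, ← tsum_mul_left, diffMul]
    refine tsum_congr fun ν => ?_
    rw [← Complex.exp_nat_mul, mul_left_comm (Complex.exp _), ← Complex.exp_add]
    congr 2
    rw [hθ]; push_cast; ring
  have hs : 1 - Complex.exp (-θ * Complex.I) =
      (2 * Real.sin (θ / 2) : ℝ) * Complex.exp (((π - θ) / 2 : ℝ) * Complex.I) := by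
    have h3 : Complex.exp (((π - θ) / 2 : ℝ) * Complex.I) =
        Complex.I * Complex.exp (-(θ / 2) * Complex.I) := by
      rw [show (((π - θ) / 2 : ℝ) : ℂ) * Complex.I = π / 2 * Complex.I + -(θ / 2) * Complex.I by
        push_cast; ring, Complex.exp_add, Complex.exp_pi_div_two_mul_I]
    have h4 : Complex.exp (-θ * Complex.I) =
        Complex.exp (-(θ / 2) * Complex.I) * Complex.exp (-(θ / 2) * Complex.I) := by
      rw [← Complex.exp_add]; congr 1; ring
    have h5 : Complex.exp (θ / 2 * Complex.I) * Complex.exp (-(θ / 2) * Complex.I) = 1 := by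
      rw [← Complex.exp_add, ← Complex.exp_zero]; congr 1; ring
    rw [h3, h4]
    push_cast
    rw [Complex.sin]
    linear_combination (-1 : ℂ) * h5 - (Complex.exp (-(θ / 2) * Complex.I) *
      Complex.exp (-(θ / 2) * Complex.I) - Complex.exp (-(θ / 2) * Complex.I) *
      Complex.exp (θ / 2 * Complex.I)) * Complex.I_mul_I
  rw [e1, hs]
  rcases eq_or_lt_of_le h0 with hθ0 | hθ0
  · rw [← hθ0]
    simp [Real.zero_rpow hα.ne', Complex.zero_cpow (Complex.ofReal_ne_zero.2 hα.ne')]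
  have spos : 0 < 2 * Real.sin (θ / 2) := by
    have := Real.sin_pos_of_pos_of_lt_pi (x := θ / 2) (by linarith) (by linarith)
    linarith
  have e2 : ((2 * Real.sin (θ / 2) : ℝ) : ℂ) * Complex.exp (((π - θ) / 2 : ℝ) * Complex.I) =
      Complex.exp (Real.log (2 * Real.sin (θ / 2)) + ((π - θ) / 2 : ℝ) * Complex.I) := by
    rw [Complex.exp_add, ← Complex.ofReal_exp, Real.exp_log spos]
  rw [Complex.cpow_def_of_ne_zero (mul_ne_zero (Complex.ofReal_ne_zero.2 spos.ne')
    (Complex.exp_ne_zero _)), e2, Complex.log_exp (by simp; linarith) (by simp; linarith),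
    Real.rpow_def_of_pos spos, Complex.ofReal_exp, ← Complex.exp_add, ← Complex.exp_add,
    ← Complex.exp_add]
  congr 1
  have hθ' : (k : ℂ) * h = θ := by rw [hθ]; push_cast; rfl
  push_cast
  linear_combination (-(α / 2) * Complex.I) * hθ'

theorem hermMul_congr {m m' : ℕ → ℂ} {k : ℤ} (h : m k.natAbs = m' k.natAbs) :
    hermMul m k = hermMul m' k := by
  rw [hermMul, hermMul]
  split_ifs with hk
  · rw [show k.toNat = k.natAbs by omega, h]
  · rw [show (-k).toNat = k.natAbs by omega, h]

theorem hermMul_mul (m m' : ℕ → ℂ) (k : ℤ) :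
    hermMul (fun j => m j * m' j) k = hermMul m k * hermMul m' k := by
  simp only [hermMul]
  split_ifs <;> simp

theorem mul_sin_le_mul_sin {x y : ℝ} (hx : 0 ≤ x) (hxy : x ≤ y) (hy : y ≤ π) :
    x * Real.sin y ≤ y * Real.sin x := by
  rcases eq_or_lt_of_le (hx.trans hxy) with h | h
  · have : x = 0 := by linarith
    simp [← h, this]
  have := strictConcaveOn_sin_Icc.concaveOn.2 (⟨h.le, hy⟩ : y ∈ Set.Icc 0 π)
    (⟨le_rfl, pi_pos.le⟩ : (0 : ℝ) ∈ Set.Icc 0 π) (show 0 ≤ x / y by positivity)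
    (show 0 ≤ 1 - x / y by rw [sub_nonneg, div_le_one h]; exact hxy) (by ring)
  simp only [smul_eq_mul, mul_zero, add_zero, Real.sin_zero, div_mul_cancel₀ _ h.ne'] at this
  rw [div_mul_eq_mul_div, div_le_iff₀ h] at this
  linarith

/-- A family of vectors on which Marcinkiewicz multipliers and translations act boundedly. -/
structure FourierFamily {E : Type*} [NormedAddCommGroup E] [NormedSpace ℂ E] (v : ℤ → E) (N : ℕ)
    (K : ℝ) : Prop where
  bv : ∀ (c : ℤ → ℂ) (m : ℕ → ℂ) (M : ℝ), BVBound m M →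
    ‖∑ k ∈ freqs N, (hermMul m k * c k) • v k‖ ≤ K * M * ‖∑ k ∈ freqs N, c k • v k‖
  iso : ∀ (c : ℤ → ℂ) (s : ℝ),
    ‖∑ k ∈ freqs N, (Complex.exp (k * s * Complex.I) * c k) • v k‖ = ‖∑ k ∈ freqs N, c k • v k‖

/-- The sequence `1` for `j ≤ n`, `0` for `j > n`. -/
def lowSeq (n j : ℕ) : ℂ := if j ≤ n then 1 else 0

/-- The sequence `0` for `j ≤ n`, `1` for `j > n`. -/
def highSeq (n j : ℕ) : ℂ := if j ≤ n then 0 else 1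

/-- The multiplier sequence of the `β`-th derivative of the partial sum of order `n`. -/
def derivSeq (β : ℝ) (n j : ℕ) : ℂ :=
  if j ≤ n then ((j : ℝ) ^ β : ℝ) * Complex.exp (-(β * π / 2) * Complex.I) else 0

theorem BVBound.lowSeq (n : ℕ) : BVBound (lowSeq n) 1 := by
  have := BVBound.of_antitone (m := fun j => if j ≤ n then 1 else 0) (M := 1)
    (fun j _ => by split_ifs <;> norm_num)
    (fun j _ => by split_ifs <;> norm_num)
    (fun j _ => by
      by_cases h : j + 1 ≤ n
      · rw [if_pos h, if_pos (by omega)]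
      · rw [if_neg h]; split_ifs <;> norm_num)
  convert this using 2 with j
  rw [_root_.lowSeq]; split_ifs <;> simp

theorem BVBound.highSeq (n : ℕ) : BVBound (highSeq n) 1 := by
  have := BVBound.of_monotone (m := fun j => if j ≤ n then 0 else 1) (M := 1)
    (fun j _ => by split_ifs <;> norm_num)
    (fun j _ => by split_ifs <;> norm_num)
    (fun j _ => by
      by_cases h : j ≤ n
      · rw [if_pos h]; split_ifs <;> norm_num
      · rw [if_neg h, if_neg (by omega)])
  convert this using 2 with j
  rw [_root_.highSeq]; split_ifs <;> simp

/-- The moduli of the multiplier of the fractional difference. -/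
def diffAbs (α h : ℝ) (j : ℕ) : ℝ := (2 * Real.sin (j * |h| / 2)) ^ α

/-- The phase of the multiplier of the fractional difference. -/
def diffPhase (α h : ℝ) : ℂ := Complex.exp ((if 0 ≤ h then α * π / 2 else -(α * π / 2) : ℝ) * Complex.I)

theorem norm_diffPhase (α h : ℝ) : ‖diffPhase α h‖ = 1 := Complex.norm_exp_ofReal_mul_I _

theorem diffMul_eq_hermMul {α : ℝ} (hα : 0 < α) {h : ℝ} {k : ℤ} (hk : k ≠ 0)
    (hπ : k.natAbs * |h| ≤ π) :
    diffMul α h k = Complex.exp (k * (α * h / 2 : ℝ) * Complex.I) *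
      hermMul (fun j => diffAbs α h j * diffPhase α h) k := by
  have main : ∀ (h : ℝ) (j : ℕ), 1 ≤ j → 0 ≤ h → j * h ≤ π → diffMul α h j =
      Complex.exp (j * (α * h / 2 : ℝ) * Complex.I) * (diffAbs α h j * diffPhase α h) := by
    intro h j hj h0 hπ
    have := diffMul_eq hα (h := h) (k := j) (by push_cast; positivity) (by push_cast; exact hπ)
    rw [this, diffAbs, diffPhase, if_pos h0, abs_of_nonneg h0]
    push_cast; ring
  have mainneg : ∀ (h : ℝ) (j : ℕ), 1 ≤ j → 0 ≤ h → j * h ≤ π →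
      starRingEnd ℂ (diffMul α h j) =
      Complex.exp (-(j * (α * h / 2 : ℝ) * Complex.I)) *
        (diffAbs α h j * starRingEnd ℂ (diffPhase α h)) := by
    intro h j hj h0 hπ
    rw [main h j hj h0 hπ, map_mul, map_mul, ← Complex.exp_conj]
    simp [Complex.conj_ofNat]
  have ph : ∀ h : ℝ, h < 0 → diffPhase α h = starRingEnd ℂ (diffPhase α (-h)) := fun h hh => by
    rw [diffPhase, diffPhase, if_neg (by linarith), if_pos (by linarith), ← Complex.exp_conj]
    simp [Complex.conj_ofNat]
  have ab : ∀ (h : ℝ) (j : ℕ), diffAbs α (-h) j = diffAbs α h j := fun h j => by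
    rw [diffAbs, diffAbs, abs_neg]
  rcases le_or_gt 0 h with h0 | h0
  · rw [abs_of_nonneg h0] at hπ
    rcases lt_or_gt_of_ne hk with hk' | hk'
    · obtain ⟨j, rfl⟩ : ∃ j : ℕ, k = -(j : ℤ) := ⟨k.natAbs, by omega⟩
      rw [hermMul_neg, diffMul_neg, mainneg h j (by omega) h0 (by simpa using hπ), map_mul,
        Complex.conj_ofReal]
      push_cast; ring_nf
    · obtain ⟨j, rfl⟩ : ∃ j : ℕ, k = (j : ℤ) := ⟨k.natAbs, by omega⟩
      rw [hermMul_natCast _ (by omega), main h j (by omega) h0 (by simpa using hπ)]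
      push_cast; ring_nf
  · rw [abs_of_neg h0] at hπ
    have hh : diffMul α h k = diffMul α (-h) (-k) := by rw [← diffMul_neg_step, neg_neg]
    rw [hh]
    rcases lt_or_gt_of_ne hk with hk' | hk'
    · obtain ⟨j, rfl⟩ : ∃ j : ℕ, k = -(j : ℤ) := ⟨k.natAbs, by omega⟩
      rw [hermMul_neg, neg_neg, main (-h) j (by omega) (by linarith) (by simpa using hπ), map_mul,
        Complex.conj_ofReal, ph h h0, Complex.conj_conj, ab]
      push_cast; ring_nf
    · obtain ⟨j, rfl⟩ : ∃ j : ℕ, k = (j : ℤ) := ⟨k.natAbs, by omega⟩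
      rw [hermMul_natCast _ (by omega), diffMul_neg,
        mainneg (-h) j (by omega) (by linarith) (by simpa using hπ), ph h h0, ab]
      push_cast; ring_nf

namespace FourierFamily

variable {E : Type*} [NormedAddCommGroup E] [NormedSpace ℂ E] {v : ℤ → E} {N : ℕ} {K : ℝ}

theorem bv_le (H : FourierFamily v N K) {a b m : ℕ → ℂ} {M : ℝ} (hm : BVBound m M)
    (h : ∀ j, 1 ≤ j → a j = m j * b j) (c : ℤ → ℂ) :
    ‖∑ k ∈ freqs N, (hermMul a k * c k) • v k‖ ≤
      K * M * ‖∑ k ∈ freqs N, (hermMul b k * c k) • v k‖ := by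
  refine le_trans (le_of_eq ?_) (H.bv (fun k => hermMul b k * c k) m M hm)
  congr 1
  refine Finset.sum_congr rfl fun k hk => ?_
  rw [← mul_assoc, ← hermMul_mul]
  congr 2
  exact hermMul_congr (h _ (by have := (mem_freqs.1 hk).1; omega))

theorem norm_diffMul_eq (H : FourierFamily v N K) {α : ℝ} (hα : 0 < α) {h : ℝ} {a : ℕ → ℂ}
    (ha : ∀ j : ℕ, π < j * |h| → a j = 0) (c : ℤ → ℂ) :
    ‖∑ k ∈ freqs N, (diffMul α h k * (hermMul a k * c k)) • v k‖ =
      ‖∑ k ∈ freqs N, (hermMul (fun j => diffAbs α h j * diffPhase α h * a j) k * c k) • v k‖ := by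
  refine Eq.trans ?_ (H.iso _ (α * h / 2))
  congr 1
  refine Finset.sum_congr rfl fun k hk => ?_
  congr 1
  rw [hermMul_mul]
  rcases le_or_gt (k.natAbs * |h|) π with hle | hlt
  · rw [diffMul_eq_hermMul hα (mem_freqs.1 hk).1 hle]; ring
  · rw [hermMul_congr (m' := fun _ => 0) (ha _ hlt)]
    simp [hermMul]

/-- Bernstein type inequality for fractional differences. -/
theorem norm_diff_low_le (H : FourierFamily v N K) {α : ℝ} (hα : 0 < α) {n : ℕ} (hn : 1 ≤ n) {h : ℝ}
    (hh : |h| ≤ π / n) (c : ℤ → ℂ) :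
    ‖∑ k ∈ freqs N, (diffMul α h k * (hermMul (lowSeq n) k * c k)) • v k‖ ≤
      K * (2 * π ^ α) * ((n : ℝ) ^ (-α) * ‖∑ k ∈ freqs N, (hermMul (derivSeq α n) k * c k) • v k‖) := by
  have hn0 : (0:ℝ) < n := by exact_mod_cast hn
  have hnh : n * |h| ≤ π := by rw [le_div_iff₀ hn0] at hh; linarith
  rw [H.norm_diffMul_eq hα (fun j hj => by
    rw [lowSeq, if_neg]
    intro hjn
    have : (j : ℝ) * |h| ≤ n * |h| := by gcongr
    linarith)]
  set r : ℕ → ℝ := fun j => n * (2 * Real.sin ((min j n : ℕ) * |h| / 2)) / (min j n : ℕ) with hr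
  have mpos : ∀ j : ℕ, 1 ≤ j → (0:ℝ) < (min j n : ℕ) := fun j hj => by
    have : 0 < min j n := by omega
    exact_mod_cast this
  have mle : ∀ j : ℕ, (min j n : ℕ) * |h| ≤ π := fun j =>
    le_trans (mul_le_mul_of_nonneg_right (by exact_mod_cast min_le_right _ _) (abs_nonneg _)) hnh
  have spos : ∀ j : ℕ, 0 ≤ Real.sin ((min j n : ℕ) * |h| / 2) := fun j =>
    Real.sin_nonneg_of_nonneg_of_le_pi (by positivity) (by linarith [mle j, pi_pos])
  have r0 : ∀ j, 1 ≤ j → 0 ≤ r j := fun j hj => by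
    have := spos j
    simp only [hr]; positivity
  have rle : ∀ j, 1 ≤ j → r j ≤ π := fun j hj => by
    simp only [hr]
    rw [div_le_iff₀ (mpos j hj)]
    have h1 := Real.sin_le (x := (min j n : ℕ) * |h| / 2) (by positivity)
    calc n * (2 * Real.sin ((min j n : ℕ) * |h| / 2)) ≤ n * (2 * ((min j n : ℕ) * |h| / 2)) := by
          gcongr
      _ = (n * |h|) * (min j n : ℕ) := by ring
      _ ≤ _ := by gcongr
  have rle' : ∀ j, 1 ≤ j → r (j + 1) ≤ r j := fun j hj => by
    rcases le_or_gt n j with hj' | hj'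
    · simp only [hr, min_eq_right hj', min_eq_right (Nat.le_succ_of_le hj')]; exact le_rfl
    · have hj1 : (0:ℝ) < j := by exact_mod_cast hj
      have e2 : min (j + 1) n = j + 1 := min_eq_left hj'
      have e1 : min j n = j := min_eq_left hj'.le
      have hm := mle (j + 1)
      simp only [hr, e1, e2] at hm ⊢
      push_cast at hm ⊢
      rw [div_le_div_iff₀ (by positivity) hj1]
      rcases eq_or_lt_of_le (abs_nonneg h) with h0 | h0
      · simp [← h0]
      have := mul_sin_le_mul_sin (x := j * |h| / 2) (y := (j + 1) * |h| / 2) (by positivity)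
        (by gcongr; linarith) (by linarith [pi_pos])
      have h5 : |h| / 2 * (j * Real.sin ((j + 1) * |h| / 2)) ≤
        |h| / 2 * ((j + 1) * Real.sin (j * |h| / 2)) := by linarith
      have h6 := le_of_mul_le_mul_left h5 (by positivity)
      have := mul_le_mul_of_nonneg_left h6 (show (0:ℝ) ≤ 2 * n by positivity)
      linarith
  have hbv : BVBound (fun j => ((r j ^ α : ℝ) : ℂ)) (π ^ α) := BVBound.of_antitone
    (fun j hj => Real.rpow_nonneg (r0 j hj) _)
    (fun j hj => Real.rpow_le_rpow (r0 j hj) (rle j hj) hα.le)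
    (fun j hj => Real.rpow_le_rpow (r0 (j + 1) (by omega)) (rle' j hj) hα.le)
  have hbv2 := (BVBound.const (diffPhase α h * Complex.exp ((α * π / 2 : ℝ) * Complex.I))).mul hbv
  rw [norm_mul, norm_diffPhase, Complex.norm_exp_ofReal_mul_I, mul_one, mul_one] at hbv2
  have e : ∀ k, (hermMul (fun j => ((n : ℝ) ^ (-α) : ℝ) * derivSeq α n j) k * c k) • v k =
      (((n : ℝ) ^ (-α) : ℝ) : ℂ) • ((hermMul (derivSeq α n) k * c k) • v k) := fun k => by
    rw [hermMul_mul, smul_smul]; congr 1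
    rw [hermMul]; simp [mul_assoc]
  have key := H.bv_le (b := fun j => ((n : ℝ) ^ (-α) : ℝ) * derivSeq α n j)
    (a := fun j => diffAbs α h j * diffPhase α h * lowSeq n j) hbv2 (fun j hj => ?_) c
  · simp only [e] at key
    rw [← Finset.smul_sum, norm_smul, Complex.norm_real,
      Real.norm_of_nonneg (Real.rpow_nonneg hn0.le _)] at key
    exact key
  · rw [lowSeq, derivSeq]
    split_ifs with hjn
    · have hj0 : (0:ℝ) < j := by exact_mod_cast hj
      have e1 : min j n = j := min_eq_left hjn
      have hs := spos j
      rw [e1] at hs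
      have h1 : r j ^ α * ((n : ℝ) ^ (-α) * (j : ℝ) ^ α) = diffAbs α h j := by
        simp only [hr, e1, diffAbs]
        rw [Real.rpow_neg hn0.le, Real.div_rpow (by positivity) hj0.le,
          Real.mul_rpow hn0.le (by positivity)]
        have := (Real.rpow_pos_of_pos hn0 α).ne'
        have := (Real.rpow_pos_of_pos hj0 α).ne'
        field_simp
      have h2 : Complex.exp ((α * π / 2 : ℝ) * Complex.I) *
          Complex.exp (-(α * π / 2) * Complex.I) = 1 := by
        rw [← Complex.exp_add, ← Complex.exp_zero]; congr 1; push_cast; ring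
      rw [← h1]
      push_cast at h2 ⊢
      linear_combination (- ((r j ^ α : ℝ) : ℂ) * ((n : ℝ) ^ (-α) : ℝ) * ((j : ℝ) ^ α : ℝ) *
        diffPhase α h) * h2
    · simp

theorem norm_diffMul_le (H : FourierFamily v N K) {α : ℝ} (hα : 0 < α) (h : ℝ) (c : ℤ → ℂ) :
    ‖∑ k ∈ freqs N, (diffMul α h k * c k) • v k‖ ≤
      (∑' ν, |diffCoeff α ν|) * ‖∑ k ∈ freqs N, c k • v k‖ := by
  have scal : ∀ k : ℤ, HasSum (fun ν : ℕ =>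
      (diffCoeff α ν : ℂ) * Complex.exp (k * ((α - ν) * h) * Complex.I)) (diffMul α h k) := fun k =>
    (summable_diffCoeff_mul hα fun ν =>
      (norm_exp_mul_I_eq_one (x := k * ((α - ν) * h)) (by push_cast; ring)).le).hasSum
  have key : HasSum (fun ν : ℕ => ∑ k ∈ freqs N,
      ((diffCoeff α ν : ℂ) * Complex.exp (k * ((α - ν) * h) * Complex.I) * c k) • v k)
      (∑ k ∈ freqs N, (diffMul α h k * c k) • v k) :=
    hasSum_sum fun k _ => ((scal k).mul_right (c k)).smul_const (v k)
  rw [← key.tsum_eq]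
  refine tsum_of_norm_bounded ((summable_abs_diffCoeff hα).hasSum.mul_right _) fun ν => ?_
  have := H.iso c ((α - ν) * h)
  rw [← this, ← Real.norm_eq_abs, ← Complex.norm_real, ← norm_smul, Finset.smul_sum]
  refine le_of_eq (congrArg _ (Finset.sum_congr rfl fun k _ => ?_))
  rw [smul_smul]
  push_cast; ring_nf

theorem norm_le_of_eq_mul_diffAbs (H : FourierFamily v N K) (hK : 0 ≤ K) {α : ℝ} (hα : 0 < α) {h : ℝ}
    {a b m : ℕ → ℂ} {M M' : ℝ} (hm : BVBound m M) (hb : BVBound b M')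
    (hsupp : ∀ j : ℕ, π < j * |h| → b j = 0)
    (ha : ∀ j, 1 ≤ j → a j = m j * (diffAbs α h j * b j)) (c : ℤ → ℂ) :
    ‖∑ k ∈ freqs N, (hermMul a k * c k) • v k‖ ≤
      K * (2 * M) * (K * M') * ‖∑ k ∈ freqs N, (diffMul α h k * c k) • v k‖ := by
  have hp : diffPhase α h ≠ 0 := by
    rw [← norm_ne_zero_iff, norm_diffPhase]; exact one_ne_zero
  have h1 := (BVBound.const (diffPhase α h)⁻¹).mul hm
  rw [norm_inv, norm_diffPhase, inv_one, mul_one] at h1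
  have h2 := H.bv_le (a := a) (b := fun j => diffAbs α h j * diffPhase α h * b j) h1
    (fun j hj => by rw [ha j hj]; field_simp) c
  rw [← H.norm_diffMul_eq hα hsupp] at h2
  have h3 := H.bv (fun k => diffMul α h k * c k) b M' hb
  refine h2.trans ?_
  have := hm.nonneg
  rw [mul_assoc _ (K * M')]
  gcongr
  simpa only [mul_left_comm] using h3

theorem norm_derivSeq_le (H : FourierFamily v N K) (hK : 0 ≤ K) {α : ℝ} (hα : 0 < α) {n : ℕ}
    (hn : 1 ≤ n) (c : ℤ → ℂ) :
    (n : ℝ) ^ (-α) * ‖∑ k ∈ freqs N, (hermMul (derivSeq α n) k * c k) • v k‖ ≤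
      4 * K ^ 2 * ‖∑ k ∈ freqs N, (diffMul α (π / n) k * c k) • v k‖ := by
  have hn0 : (0:ℝ) < n := by exact_mod_cast hn
  have hh : |π / n| = π / n := abs_of_pos (by positivity)
  have mpos : ∀ j : ℕ, 1 ≤ j → (0:ℝ) < (min j n : ℕ) := fun j hj => by
    have : 0 < min j n := by omega
    exact_mod_cast this
  have mle : ∀ j : ℕ, (min j n : ℕ) * (π / n) ≤ π := fun j => by
    have : ((min j n : ℕ) : ℝ) ≤ n := by exact_mod_cast min_le_right _ _
    calc (min j n : ℕ) * (π / n) ≤ n * (π / n) := by gcongr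
      _ = π := by field_simp
  have sle : ∀ j : ℕ, ((min j n : ℕ) : ℝ) ≤ n * (2 * Real.sin ((min j n : ℕ) * (π / n) / 2)) :=
    fun j => by
      have h := Real.mul_le_sin (x := (min j n : ℕ) * (π / n) / 2) (by positivity)
        (by linarith [mle j])
      have e : 2 / π * ((min j n : ℕ) * (π / n) / 2) = (min j n : ℕ) / n := by
        field_simp
      rw [e, div_le_iff₀ hn0] at h
      have : (0:ℝ) ≤ (min j n : ℕ) := by positivity
      nlinarith
  set r : ℕ → ℝ := fun j => (min j n : ℕ) / (n * (2 * Real.sin ((min j n : ℕ) * (π / n) / 2))) with hr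
  have spos : ∀ j : ℕ, 1 ≤ j → 0 < n * (2 * Real.sin ((min j n : ℕ) * (π / n) / 2)) := fun j hj =>
    (mpos j hj).trans_le (sle j)
  have r0 : ∀ j, 1 ≤ j → 0 ≤ r j := fun j hj => by
    have := spos j hj
    simp only [hr]; positivity
  have rle : ∀ j, 1 ≤ j → r j ≤ 1 := fun j hj => by
    simp only [hr]
    rw [div_le_one (spos j hj)]; exact sle j
  have rle' : ∀ j, 1 ≤ j → r j ≤ r (j + 1) := fun j hj => by
    rcases le_or_gt n j with hj' | hj'
    · simp only [hr, min_eq_right hj', min_eq_right (Nat.le_succ_of_le hj')]; exact le_rfl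
    · have e2 : min (j + 1) n = j + 1 := min_eq_left hj'
      have e1 : min j n = j := min_eq_left hj'.le
      have hm := mle (j + 1)
      have s1 := spos j hj
      have s2 := spos (j + 1) (by omega)
      simp only [hr, e1, e2] at hm s1 s2 ⊢
      push_cast at hm s2 ⊢
      rw [div_le_div_iff₀ s1 s2]
      have hπn : 0 < π / n := by positivity
      have := mul_sin_le_mul_sin (x := j * (π / n) / 2) (y := (j + 1) * (π / n) / 2) (by positivity)
        (by gcongr; linarith) (by linarith [pi_pos])
      have h5 : π / n / 2 * (j * Real.sin ((j + 1) * (π / n) / 2)) ≤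
        π / n / 2 * ((j + 1) * Real.sin (j * (π / n) / 2)) := by linarith
      have h6 := le_of_mul_le_mul_left h5 (by positivity)
      have := mul_le_mul_of_nonneg_left h6 (show (0:ℝ) ≤ 2 * n by positivity)
      linarith
  have hbv : BVBound (fun j => ((r j ^ α : ℝ) : ℂ)) 1 := BVBound.of_monotone
    (fun j hj => Real.rpow_nonneg (r0 j hj) _)
    (fun j hj => Real.rpow_le_one (r0 j hj) (rle j hj) hα.le)
    (fun j hj => Real.rpow_le_rpow (r0 j hj) (rle' j hj) hα.le)
  have hbv2 := (BVBound.const (Complex.exp ((-(α * π / 2) : ℝ) * Complex.I))).mul hbv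
  rw [Complex.norm_exp_ofReal_mul_I, mul_one, mul_one] at hbv2
  have e : ∀ k, (hermMul (fun j => ((n : ℝ) ^ (-α) : ℝ) * derivSeq α n j) k * c k) • v k =
      (((n : ℝ) ^ (-α) : ℝ) : ℂ) • ((hermMul (derivSeq α n) k * c k) • v k) := fun k => by
    rw [hermMul_mul, smul_smul]; congr 1
    rw [hermMul]; simp [mul_assoc]
  have key := H.norm_le_of_eq_mul_diffAbs hK hα (h := π / n)
    (a := fun j => ((n : ℝ) ^ (-α) : ℝ) * derivSeq α n j) hbv2 (BVBound.lowSeq n)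
    (fun j hj => ?_) (fun j hj => ?_) c
  · simp only [e] at key
    rw [← Finset.smul_sum, norm_smul, Complex.norm_real,
      Real.norm_of_nonneg (Real.rpow_nonneg hn0.le _)] at key
    refine key.trans_eq (by ring)
  · rw [lowSeq, if_neg]
    intro hjn
    rw [hh, mul_div_assoc', lt_div_iff₀ hn0, mul_comm] at hj
    have : (j : ℝ) ≤ n := by exact_mod_cast hjn
    have := lt_of_mul_lt_mul_right hj pi_pos.le
    linarith
  · rw [lowSeq, derivSeq]
    split_ifs with hjn
    · have hj0 : (0:ℝ) < j := by exact_mod_cast hj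
      have e1 : min j n = j := min_eq_left hjn
      have hs := spos j hj
      rw [e1] at hs
      have hs' : 0 < 2 * Real.sin (j * (π / n) / 2) := pos_of_mul_pos_right hs hn0.le
      have h1 : r j ^ α * diffAbs α (π / n) j = (n : ℝ) ^ (-α) * (j : ℝ) ^ α := by
        simp only [hr, e1, diffAbs, hh]
        rw [Real.rpow_neg hn0.le, Real.div_rpow hj0.le hs.le,
          Real.mul_rpow hn0.le hs'.le]
        have := (Real.rpow_pos_of_pos hn0 α).ne'
        have h2 := (Real.rpow_pos_of_pos hs' α).ne'
        generalize (2 * Real.sin (j * (π / n) / 2)) ^ α = s at h2 ⊢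
        field_simp
      rw [← mul_assoc, ← Complex.ofReal_mul, ← h1]
      push_cast
      ring
    · simp

theorem norm_mid_le (H : FourierFamily v N K) (hK : 0 ≤ K) {α : ℝ} (hα : 0 < α) {n B : ℕ}
    (hn : 1 ≤ n) (hB : 1 ≤ B) (c : ℤ → ℂ) :
    ‖∑ k ∈ freqs N, (hermMul (fun j => highSeq n j * lowSeq (B * n) j) k * c k) • v k‖ ≤
      4 * (B : ℝ) ^ α * K ^ 2 * ‖∑ k ∈ freqs N, (diffMul α (π / (B * n)) k * c k) • v k‖ := by
  have hn0 : (0:ℝ) < n := by exact_mod_cast hn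
  have hB0 : (0:ℝ) < B := by exact_mod_cast hB
  have hBn : n ≤ B * n := Nat.le_mul_of_pos_left _ hB
  set h : ℝ := π / (B * n) with hdef
  have h0 : 0 < h := by positivity
  have hh : |h| = h := abs_of_pos h0
  have hBh : B * n * h = π := by rw [hdef]; field_simp
  set t : ℕ → ℕ := fun j => max n (min j (B * n)) with ht
  have t1 : ∀ j, (n : ℝ) ≤ t j := fun j => by exact_mod_cast le_max_left _ _
  have t2 : ∀ j, (t j : ℝ) ≤ B * n := fun j => by
    exact_mod_cast max_le hBn (min_le_right _ _)
  have tm : ∀ j, (t j : ℝ) ≤ t (j + 1) := fun j => by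
    have : t j ≤ t (j + 1) := by simp only [ht]; omega
    exact_mod_cast this
  have ang : ∀ j, t j * h / 2 ≤ π / 2 := fun j => by
    have : t j * h ≤ B * n * h := mul_le_mul_of_nonneg_right (t2 j) h0.le
    linarith
  have slow : ∀ j, (B : ℝ)⁻¹ ≤ 2 * Real.sin (t j * h / 2) := fun j => by
    have h1 := Real.mul_le_sin (x := t j * h / 2) (by positivity) (ang j)
    have h2 : 2 / π * (n * h / 2) ≤ 2 / π * (t j * h / 2) := by have := t1 j; gcongr
    have h3 : 2 / π * (n * h / 2) = (B : ℝ)⁻¹ := by rw [hdef]; field_simp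
    have : 0 < (B : ℝ)⁻¹ := by positivity
    linarith
  have spos : ∀ j, 0 < 2 * Real.sin (t j * h / 2) := fun j =>
    lt_of_lt_of_le (by positivity) (slow j)
  have smono : ∀ j, 2 * Real.sin (t j * h / 2) ≤ 2 * Real.sin (t (j + 1) * h / 2) := fun j => by
    have := Real.sin_le_sin_of_le_of_le_pi_div_two (x := t j * h / 2) (y := t (j + 1) * h / 2)
      (by have : 0 ≤ t j * h / 2 := by positivity
          linarith [pi_pos]) (ang _) (by have := tm j; gcongr)
    linarith
  have hbv : BVBound (fun j => (((2 * Real.sin (t j * h / 2)) ^ (-α) : ℝ) : ℂ)) ((B : ℝ) ^ α) :=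
    BVBound.of_antitone
      (fun j _ => Real.rpow_nonneg (spos j).le _)
      (fun j _ => by
        refine (Real.rpow_le_rpow_of_nonpos (by positivity) (slow j) (by linarith)).trans_eq ?_
        rw [Real.inv_rpow hB0.le, Real.rpow_neg hB0.le, inv_inv])
      (fun j _ => Real.rpow_le_rpow_of_nonpos (spos j) (smono j) (by linarith))
  have key := H.norm_le_of_eq_mul_diffAbs hK hα (h := h)
    (a := fun j => highSeq n j * lowSeq (B * n) j) hbv
    ((BVBound.highSeq n).mul (BVBound.lowSeq (B * n)))
    (fun j hj => ?_) (fun j hj => ?_) c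
  · refine key.trans_eq (by ring)
  · rw [lowSeq, if_neg, mul_zero]
    intro hjn
    have : (j : ℝ) ≤ B * n := by exact_mod_cast hjn
    have : j * h ≤ B * n * h := mul_le_mul_of_nonneg_right this h0.le
    rw [hh] at hj
    linarith
  · rw [lowSeq, highSeq]
    split_ifs with h1 h2
    · simp
    · simp
    · have e : t j = j := by simp only [ht]; omega
      have hs := spos j
      rw [e] at hs ⊢
      rw [← mul_assoc, ← Complex.ofReal_mul, diffAbs, hh, ← Real.rpow_add hs]
      simp
    · simp

end FourierFamily

/-- The multiplier of the fractional difference, translated so that its expansion has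
constant leading term. -/
def shiftedMul (α : ℝ) (k : ℤ) (h : ℝ) : ℂ :=
  ∑' ν : ℕ, (diffCoeff α ν : ℂ) * Complex.exp (-(k * ν * Complex.I) * h)

theorem norm_exp_shift (k : ℤ) (ν : ℕ) (h : ℝ) : ‖Complex.exp (-(k * ν * Complex.I) * h)‖ = 1 := by
  rw [← norm_exp_mul_I_eq_one (z := -(k * ν * h)) (x := -(k * ν * h)) (by push_cast; ring)]
  congr 2; ring

theorem diffMul_eq_shiftedMul (α h : ℝ) (k : ℤ) :
    diffMul α h k = Complex.exp (k * (α * h : ℝ) * Complex.I) * shiftedMul α k h := by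
  rw [diffMul, shiftedMul, ← tsum_mul_left]
  refine tsum_congr fun ν => ?_
  rw [mul_left_comm (Complex.exp _), ← Complex.exp_add]
  congr 2
  push_cast; ring

theorem continuous_shiftedMul {α : ℝ} (hα : 0 < α) (k : ℤ) : Continuous (shiftedMul α k) := by
  refine continuous_tsum (fun ν => by fun_prop) (summable_abs_diffCoeff hα) fun ν h => ?_
  rw [norm_mul, norm_exp_shift, mul_one, Complex.norm_real, Real.norm_eq_abs]

theorem hasSum_integral_shiftedMul {α : ℝ} (hα : 0 < α) (k : ℤ) (δ : ℝ) :
    HasSum (fun ν : ℕ => ∫ h in (0:ℝ)..δ, (diffCoeff α ν : ℂ) * Complex.exp (-(k * ν * Complex.I) * h))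
      (∫ h in (0:ℝ)..δ, shiftedMul α k h) := by
  refine intervalIntegral.hasSum_integral_of_dominated_convergence
    (fun ν _ => |diffCoeff α ν|) (fun ν => ?_) (fun ν => ?_) ?_ ?_ ?_
  · exact Continuous.aestronglyMeasurable (by fun_prop)
  · refine Filter.Eventually.of_forall fun h _ => ?_
    rw [norm_mul, norm_exp_shift, mul_one, Complex.norm_real, Real.norm_eq_abs]
  · exact Filter.Eventually.of_forall fun _ _ => summable_abs_diffCoeff hα
  · exact intervalIntegrable_const
  · exact Filter.Eventually.of_forall fun h _ =>
      (summable_diffCoeff_mul hα fun ν => (norm_exp_shift k ν h).le).hasSum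

theorem integral_diffCoeff_mul_exp {α : ℝ} {k : ℤ} (hk : k ≠ 0) {ν : ℕ} (hν : ν ≠ 0) (δ : ℝ) :
    ∫ h in (0:ℝ)..δ, (diffCoeff α ν : ℂ) * Complex.exp (-(k * ν * Complex.I) * h) =
      (diffCoeff α ν / ν : ℂ) * ((1 - Complex.exp (k * (-(ν * δ) : ℝ) * Complex.I)) *
        (1 / (k * Complex.I))) := by
  have hk' : (k : ℂ) ≠ 0 := by exact_mod_cast hk
  have hν' : (ν : ℂ) ≠ 0 := by exact_mod_cast hν
  rw [intervalIntegral.integral_const_mul,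
    integral_exp_mul_complex (neg_ne_zero.2 (mul_ne_zero (mul_ne_zero hk' hν') Complex.I_ne_zero))]
  have e : Complex.exp (-(k * ν * Complex.I) * δ) =
      Complex.exp (k * (-(ν * δ) : ℝ) * Complex.I) := by
    congr 1; push_cast; ring
  rw [e]
  have := Complex.I_ne_zero
  field_simp
  simp
  ring

namespace FourierFamily

variable {E : Type*} [NormedAddCommGroup E] [NormedSpace ℂ E] {v : ℤ → E} {N : ℕ} {K : ℝ}

/-- Integration of a sum with frequencies beyond `L` gains a factor of order `1 / L`. -/
theorem norm_primitive_le (H : FourierFamily v N K) {L : ℕ} (hL : 1 ≤ L) (c : ℤ → ℂ) :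
    ‖∑ k ∈ freqs N, (1 / (k * Complex.I) * (hermMul (highSeq L) k * c k)) • v k‖ ≤
      K * (2 / L) * ‖∑ k ∈ freqs N, (hermMul (highSeq L) k * c k) • v k‖ := by
  have hL0 : (0:ℝ) < L := by exact_mod_cast hL
  have hb : BVBound (fun j => ((1 / (max j L : ℕ) : ℝ) : ℂ)) (1 / L) := BVBound.of_antitone
    (fun j _ => by positivity)
    (fun j _ => one_div_le_one_div_of_le hL0 (by exact_mod_cast le_max_right _ _))
    (fun j _ => by
      have : 0 < max j L := by omega
      have h1 : (0:ℝ) < (max j L : ℕ) := by exact_mod_cast this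
      exact one_div_le_one_div_of_le h1 (by
        have : max j L ≤ max (j + 1) L := by omega
        exact_mod_cast this))
  have h2 := (BVBound.const (-Complex.I)).mul hb
  rw [norm_neg, Complex.norm_I, mul_one, mul_one_div] at h2
  refine le_trans (le_of_eq ?_) (H.bv (fun k => hermMul (highSeq L) k * c k) _ _ h2)
  congr 1
  refine Finset.sum_congr rfl fun k hk => ?_
  congr 1
  by_cases hkL : k.natAbs ≤ L
  · rw [hermMul_congr (m' := fun _ => 0) (show highSeq L k.natAbs = 0 from if_pos hkL)]
    simp [hermMul]
  · congr 1
    have hk0 := (mem_freqs.1 hk).1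
    rcases lt_or_gt_of_ne hk0 with hk' | hk'
    · obtain ⟨j, rfl⟩ : ∃ j : ℕ, k = -(j : ℤ) := ⟨k.natAbs, by omega⟩
      have hj : (j : ℂ) ≠ 0 := by exact_mod_cast (show j ≠ 0 by omega)
      rw [hermMul_neg, max_eq_left (by omega)]
      simp
    · obtain ⟨j, rfl⟩ : ∃ j : ℕ, k = (j : ℤ) := ⟨k.natAbs, by omega⟩
      rw [hermMul_natCast _ (by omega), max_eq_left (by omega)]
      simp

theorem norm_high_le [CompleteSpace E] (H : FourierFamily v N K) (hK : 0 ≤ K) {α : ℝ} (hα : 0 < α)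
    {n B : ℕ} (hn : 1 ≤ n) (hB : 1 ≤ B) (hBK : 4 * (∑' ν, |diffCoeff α ν|) * K ≤ B)
    {W : ℝ} {c : ℤ → ℂ}
    (hW : ∀ h ∈ Set.Icc 0 (π / n), ‖∑ k ∈ freqs N, (diffMul α h k * c k) • v k‖ ≤ W) :
    ‖∑ k ∈ freqs N, (hermMul (highSeq (B * n)) k * c k) • v k‖ ≤ 2 * K * W := by
  set A := ∑' ν, |diffCoeff α ν| with hA
  have hn0 : (0:ℝ) < n := by exact_mod_cast hn
  have hB0 : (0:ℝ) < B := by exact_mod_cast hB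
  have hL : 1 ≤ B * n := Nat.mul_pos hB hn
  set δ : ℝ := π / n with hδ
  have hδ0 : 0 < δ := by positivity
  set c' : ℤ → ℂ := fun k => hermMul (highSeq (B * n)) k * c k with hc'
  set w := ∑ k ∈ freqs N, c' k • v k with hw
  have hJ := H.norm_primitive_le hL c
  set J := ∑ k ∈ freqs N, (1 / (k * Complex.I) * c' k) • v k with hJdef
  have hJ' : ‖J‖ ≤ K * (2 / (B * n : ℕ)) * ‖w‖ := hJ
  have hshift : ∀ h ∈ Set.Icc 0 δ, ‖∑ k ∈ freqs N, (shiftedMul α k h * c' k) • v k‖ ≤ K * W := by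
    intro h hh
    rw [← H.iso _ (α * h)]
    have h1 := H.bv (fun k => diffMul α h k * c k) _ _ (BVBound.highSeq (B * n))
    rw [mul_one] at h1
    refine le_trans (le_of_eq ?_) (h1.trans (mul_le_mul_of_nonneg_left (hW h hh) hK))
    refine congrArg _ (Finset.sum_congr rfl fun k _ => ?_)
    rw [← mul_assoc, ← diffMul_eq_shiftedMul, hc', mul_left_comm]
  have hintegral : ‖∑ k ∈ freqs N, ((∫ h in (0:ℝ)..δ, shiftedMul α k h) * c' k) • v k‖ ≤ K * W * δ := by
    have e : ∑ k ∈ freqs N, ((∫ h in (0:ℝ)..δ, shiftedMul α k h) * c' k) • v k =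
        ∫ h in (0:ℝ)..δ, ∑ k ∈ freqs N, (shiftedMul α k h * c' k) • v k := by
      have hc := fun k => continuous_shiftedMul hα k
      rw [intervalIntegral.integral_finsetSum fun k _ =>
        (Continuous.intervalIntegrable (by have := hc k; fun_prop) _ _)]
      refine Finset.sum_congr rfl fun k _ => ?_
      rw [intervalIntegral.integral_smul_const, intervalIntegral.integral_mul_const]
    rw [e]
    refine (intervalIntegral.norm_integral_le_of_norm_le_const (C := K * W) fun h hh => ?_).trans_eq ?_
    · rw [Set.uIoc_of_le hδ0.le] at hh
      exact hshift h ⟨hh.1.le, hh.2⟩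
    · rw [sub_zero, abs_of_pos hδ0]
  have hsum : HasSum (fun ν : ℕ => ∑ k ∈ freqs N, ((∫ h in (0:ℝ)..δ,
      (diffCoeff α ν : ℂ) * Complex.exp (-(k * ν * Complex.I) * h)) * c' k) • v k)
      (∑ k ∈ freqs N, ((∫ h in (0:ℝ)..δ, shiftedMul α k h) * c' k) • v k) :=
    hasSum_sum fun k _ => ((hasSum_integral_shiftedMul hα k δ).mul_right (c' k)).smul_const (v k)
  have h0 : ∑ k ∈ freqs N, ((∫ h in (0:ℝ)..δ,
      (diffCoeff α 0 : ℂ) * Complex.exp (-(k * (0 : ℕ) * Complex.I) * h)) * c' k) • v k =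
      (δ : ℂ) • w := by
    rw [hw, Finset.smul_sum]
    refine Finset.sum_congr rfl fun k _ => ?_
    simp [diffCoeff_zero, smul_smul]
  have hsum' := hasSum_ite_sub_hasSum hsum 0
  rw [h0] at hsum'
  have hrest : ‖(∑ k ∈ freqs N, ((∫ h in (0:ℝ)..δ, shiftedMul α k h) * c' k) • v k) - (δ : ℂ) • w‖ ≤
      A * (2 * ‖J‖) := by
    rw [← hsum'.tsum_eq]
    refine tsum_of_norm_bounded ((summable_abs_diffCoeff hα).hasSum.mul_right _) fun ν => ?_
    split_ifs with hν
    · simp; positivity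
    have e : ∑ k ∈ freqs N, ((∫ h in (0:ℝ)..δ,
        (diffCoeff α ν : ℂ) * Complex.exp (-(k * ν * Complex.I) * h)) * c' k) • v k =
        (diffCoeff α ν / ν : ℂ) • (J - ∑ k ∈ freqs N,
          (Complex.exp (k * (-(ν * δ) : ℝ) * Complex.I) * (1 / (k * Complex.I) * c' k)) • v k) := by
      rw [hJdef, ← Finset.sum_sub_distrib, Finset.smul_sum]
      refine Finset.sum_congr rfl fun k hk => ?_
      rw [integral_diffCoeff_mul_exp (mem_freqs.1 hk).1 hν, ← sub_smul, smul_smul]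
      congr 1
      ring
    rw [e, norm_smul]
    have h1 : ‖(diffCoeff α ν / ν : ℂ)‖ ≤ |diffCoeff α ν| := by
      rw [norm_div, Complex.norm_real, Real.norm_eq_abs, Complex.norm_natCast]
      exact div_le_self (abs_nonneg _) (by exact_mod_cast Nat.one_le_iff_ne_zero.2 hν)
    have h2 := norm_sub_le J (∑ k ∈ freqs N,
          (Complex.exp (k * (-(ν * δ) : ℝ) * Complex.I) * (1 / (k * Complex.I) * c' k)) • v k)
    rw [H.iso, ← hJdef, ← two_mul] at h2
    exact mul_le_mul h1 h2 (norm_nonneg _) (abs_nonneg _)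
  have hδw : δ * ‖w‖ ≤ K * W * δ + A * (2 * ‖J‖) := by
    have h1 : ‖(δ : ℂ) • w‖ = δ * ‖w‖ := by
      rw [norm_smul, Complex.norm_real, Real.norm_of_nonneg hδ0.le]
    rw [← h1]
    have := norm_sub_le (∑ k ∈ freqs N, ((∫ h in (0:ℝ)..δ, shiftedMul α k h) * c' k) • v k)
      ((∑ k ∈ freqs N, ((∫ h in (0:ℝ)..δ, shiftedMul α k h) * c' k) • v k) - (δ : ℂ) • w)
    rw [sub_sub_cancel] at this
    linarith
  have hA0 : 0 ≤ A := tsum_nonneg fun _ => abs_nonneg _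
  have h1 : A * (2 * ‖J‖) ≤ ‖w‖ / n := by
    calc A * (2 * ‖J‖) ≤ A * (2 * (K * (2 / (B * n : ℕ)) * ‖w‖)) := by gcongr
      _ = 4 * A * K / B * (‖w‖ / n) := by push_cast; field_simp; ring
      _ ≤ 1 * (‖w‖ / n) := by
        gcongr
        rw [div_le_one hB0]; exact hBK
      _ = _ := one_mul _
  have h2 : π * ‖w‖ ≤ K * W * π + ‖w‖ := by
    have h3 : δ * ‖w‖ ≤ K * W * δ + ‖w‖ / n := by linarith
    have h4 := mul_le_mul_of_nonneg_left h3 hn0.le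
    have e1 : n * (δ * ‖w‖) = π * ‖w‖ := by rw [hδ]; field_simp
    have e2 : n * (K * W * δ + ‖w‖ / n) = K * W * π + ‖w‖ := by rw [hδ]; field_simp
    rw [e1, e2] at h4
    exact h4
  have hπ := pi_gt_three
  have := norm_nonneg w
  have hKW : 0 ≤ K * W := by nlinarith
  nlinarith

/-- Jackson type inequality for fractional differences. -/
theorem norm_tail_le [CompleteSpace E] (H : FourierFamily v N K) (hK : 0 ≤ K) {α : ℝ} (hα : 0 < α)
    {n B : ℕ} (hn : 1 ≤ n) (hB : 1 ≤ B) (hBK : 4 * (∑' ν, |diffCoeff α ν|) * K ≤ B)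
    {W : ℝ} {c : ℤ → ℂ}
    (hW : ∀ h ∈ Set.Icc 0 (π / n), ‖∑ k ∈ freqs N, (diffMul α h k * c k) • v k‖ ≤ W) :
    ‖∑ k ∈ freqs N, (hermMul (highSeq n) k * c k) • v k‖ ≤
      (4 * (B : ℝ) ^ α * K ^ 2 + 2 * K) * W := by
  have hn0 : (0:ℝ) < n := by exact_mod_cast hn
  have hB1 : (1:ℝ) ≤ B := by exact_mod_cast hB
  have h1 := H.norm_high_le hK hα hn hB hBK hW
  have h2 := H.norm_mid_le hK hα hn hB c
  have h3 := hW (π / (B * n)) ⟨by positivity, div_le_div_of_nonneg_left pi_pos.le hn0 (by nlinarith)⟩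
  have hle : n ≤ B * n := Nat.le_mul_of_pos_left _ hB
  have e : ∑ k ∈ freqs N, (hermMul (highSeq n) k * c k) • v k =
      ∑ k ∈ freqs N, (hermMul (fun j => highSeq n j * lowSeq (B * n) j) k * c k) • v k +
      ∑ k ∈ freqs N, (hermMul (highSeq (B * n)) k * c k) • v k := by
    rw [← Finset.sum_add_distrib]
    refine Finset.sum_congr rfl fun k _ => ?_
    rw [← add_smul, ← add_mul]
    congr 2
    simp only [hermMul, highSeq, lowSeq]
    split_ifs <;> first | omega | simp
  rw [e]
  refine (norm_add_le _ _).trans ?_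
  rw [add_mul]
  refine add_le_add (h2.trans ?_) h1
  gcongr

end FourierFamily

/-- Lebesgue measure on the period interval. -/
abbrev circMeasure : Measure ℝ := volume.restrict (Set.Ioc 0 (2 * π))

/-- Lebesgue measure on the period square. -/
abbrev sqMeasure : Measure (ℝ × ℝ) := circMeasure.prod circMeasure

theorem memLp_sq_of_continuous {F : ℝ × ℝ → ℂ} (hF : Continuous F) (q : ℝ≥0∞) :
    MemLp F q sqMeasure := by
  obtain ⟨C, hC⟩ := (isCompact_Icc (a := (0:ℝ)) (b := 2 * π)).prod
    (isCompact_Icc (a := (0:ℝ)) (b := 2 * π)) |>.exists_bound_of_continuousOn hF.continuousOn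
  refine MemLp.of_bound hF.aestronglyMeasurable C ?_
  rw [sqMeasure, Measure.prod_restrict]
  refine ae_restrict_of_forall_mem (measurableSet_Ioc.prod measurableSet_Ioc) fun z hz => ?_
  exact hC z ⟨⟨hz.1.1.le, hz.1.2⟩, ⟨hz.2.1.le, hz.2.2⟩⟩

theorem eLpNorm_le_of_circNorm_le {p : ℝ} (hp : 1 < p) {F G : ℝ × ℝ → ℂ} (hF : Continuous F)
    (hG : Continuous G) {M : ℝ} (hM : 0 ≤ M)
    (h : ∀ y, circNorm p (fun x => F (x, y)) ≤ M * circNorm p (fun x => G (x, y))) :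
    eLpNorm F (ENNReal.ofReal p) sqMeasure ≤
      ENNReal.ofReal M * eLpNorm G (ENNReal.ofReal p) sqMeasure := by
  have hp0 : 0 < p := by linarith
  have hP0 : ENNReal.ofReal p ≠ 0 := by simpa using hp0
  have e : ∀ {X : Type} [MeasurableSpace X] (μ : Measure X) (F : X → ℂ),
      eLpNorm F (ENNReal.ofReal p) μ ^ p = ∫⁻ z, ‖F z‖ₑ ^ p ∂μ := fun μ F => by
    rw [eLpNorm_eq_lintegral_rpow_enorm_toReal hP0 ENNReal.ofReal_ne_top,
      ENNReal.toReal_ofReal hp0.le, ← ENNReal.rpow_mul, one_div, inv_mul_cancel₀ hp0.ne',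
      ENNReal.rpow_one]
  have h1 : ∀ y, eLpNorm (fun x => F (x, y)) (ENNReal.ofReal p) circMeasure ≤
      ENNReal.ofReal M * eLpNorm (fun x => G (x, y)) (ENNReal.ofReal p) circMeasure := fun y => by
    have h2 := (memLp_circle_of_continuous (f := fun x => F (x, y)) (by fun_prop)
      (ENNReal.ofReal p)).eLpNorm_ne_top
    have h3 := (memLp_circle_of_continuous (f := fun x => G (x, y)) (by fun_prop)
      (ENNReal.ofReal p)).eLpNorm_ne_top
    rw [← ENNReal.ofReal_toReal h2, ← ENNReal.ofReal_toReal h3, ← ENNReal.ofReal_mul hM]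
    exact ENNReal.ofReal_le_ofReal (h y)
  rw [← ENNReal.rpow_le_rpow_iff hp0, ENNReal.mul_rpow_of_nonneg _ _ hp0.le, e, e,
    lintegral_prod_symm _ (by fun_prop), lintegral_prod_symm _ (by fun_prop),
    ← lintegral_const_mul' _ _ (by finiteness)]
  refine lintegral_mono fun y => ?_
  have h4 := ENNReal.rpow_le_rpow (h1 y) hp0.le
  rwa [ENNReal.mul_rpow_of_nonneg _ _ hp0.le, e, e] at h4

theorem circNorm_comp_add {p : ℝ} (hp : 1 < p) {f : ℝ → ℂ} (hf : Continuous f)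
    (hper : Function.Periodic f (2 * π)) (s : ℝ) : circNorm p (fun x => f (x + s)) = circNorm p f := by
  have hp0 : 0 < p := by linarith
  have h : circNorm p (fun x => f (x + s)) ^ p = circNorm p f ^ p := by
    rw [circNorm_rpow hp (by fun_prop), circNorm_rpow hp hf,
      intervalIntegral.integral_comp_add_right (fun x => ‖f x‖ ^ p)]
    have := (Function.Periodic.comp hper fun z => ‖z‖ ^ p).intervalIntegral_add_eq (0 + s) 0
    simpa [add_comm, add_left_comm] using this
  have := congrArg (· ^ (1 / p)) h
  simpa [← Real.rpow_mul circNorm_nonneg, hp0.ne'] using this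

/-- The trigonometric polynomial with coefficients `c k l`, `1 ≤ |k|, |l| ≤ N`. -/
def trigPoly (N : ℕ) (c : ℤ → ℤ → ℂ) (z : ℝ × ℝ) : ℂ :=
  ∑ k ∈ freqs N, ∑ l ∈ freqs N, c k l * (expo k z.1 * expo l z.2)

@[fun_prop]
theorem continuous_trigPoly (N : ℕ) (c : ℤ → ℤ → ℂ) : Continuous (trigPoly N c) := by
  unfold trigPoly; fun_prop

/-- The `L_p` norm of a trigonometric polynomial. -/
def trigNorm (p : ℝ) (N : ℕ) (c : ℤ → ℤ → ℂ) : ℝ :=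
  (eLpNorm (trigPoly N c) (ENNReal.ofReal p) sqMeasure).toReal

theorem trigNorm_swap (p : ℝ) (N : ℕ) (c : ℤ → ℤ → ℂ) :
    trigNorm p N (fun k l => c l k) = trigNorm p N c := by
  have e : trigPoly N (fun k l => c l k) = trigPoly N c ∘ Prod.swap := by
    ext z
    simp only [trigPoly, Function.comp, Prod.fst_swap, Prod.snd_swap]
    rw [Finset.sum_comm]
    exact Finset.sum_congr rfl fun k _ => Finset.sum_congr rfl fun l _ => by ring
  rw [trigNorm, trigNorm, e, eLpNorm_comp_measurePreserving
    (continuous_trigPoly N c).aestronglyMeasurable Measure.measurePreserving_swap]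

theorem trigPoly_add (N : ℕ) (c c' : ℤ → ℤ → ℂ) :
    trigPoly N (fun k l => c k l + c' k l) = trigPoly N c + trigPoly N c' := by
  ext z
  simp [trigPoly, add_mul, Finset.sum_add_distrib]

theorem trigNorm_add_le {p : ℝ} (hp : 1 < p) (N : ℕ) (c c' : ℤ → ℤ → ℂ) :
    trigNorm p N (fun k l => c k l + c' k l) ≤ trigNorm p N c + trigNorm p N c' := by
  have h := memLp_sq_of_continuous (continuous_trigPoly N c) (ENNReal.ofReal p)
  have h' := memLp_sq_of_continuous (continuous_trigPoly N c') (ENNReal.ofReal p)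
  rw [trigNorm, trigNorm, trigNorm, ← ENNReal.toReal_add h.2.ne h'.2.ne, trigPoly_add]
  exact ENNReal.toReal_mono (ENNReal.add_ne_top.2 ⟨h.2.ne, h'.2.ne⟩)
    (eLpNorm_add_le h.1 h'.1 (by simpa using hp.le))

/-- The Lp vector of a slice `e^{ikx} Σ_l d_{kl} e^{ily}`. -/
def sliceLp (p : ℝ) (N : ℕ) (d : ℤ → ℤ → ℂ) (k : ℤ) : Lp ℂ (ENNReal.ofReal p) sqMeasure :=
  (memLp_sq_of_continuous (F := fun z => ∑ l ∈ freqs N, d k l * (expo k z.1 * expo l z.2))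
    (by fun_prop) (ENNReal.ofReal p)).toLp _

theorem norm_sum_sliceLp (p : ℝ) (N : ℕ) (d : ℤ → ℤ → ℂ) (c : ℤ → ℂ) :
    ‖∑ k ∈ freqs N, c k • sliceLp p N d k‖ = trigNorm p N (fun k l => c k * d k l) := by
  have e : ∑ k ∈ freqs N, c k • sliceLp p N d k =
      (memLp_sq_of_continuous (continuous_trigPoly N fun k l => c k * d k l)
        (ENNReal.ofReal p)).toLp _ := by
    apply Lp.ext
    refine (Lp.coeFn_finsetSum _ _).trans ?_
    refine Filter.EventuallyEq.trans ?_ (MemLp.coeFn_toLp _).symm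
    have h1 : ∀ᵐ z ∂sqMeasure, ∀ k ∈ freqs N, (c k • sliceLp p N d k : Lp ℂ _ _) z =
        c k * ∑ l ∈ freqs N, d k l * (expo k z.1 * expo l z.2) := by
      rw [Filter.eventually_all_finset]
      intro k _
      filter_upwards [Lp.coeFn_smul (c k) (sliceLp p N d k), MemLp.coeFn_toLp
        (memLp_sq_of_continuous (F := fun z => ∑ l ∈ freqs N, d k l * (expo k z.1 * expo l z.2))
          (by fun_prop) (ENNReal.ofReal p))] with z h1 h2
      rw [h1, Pi.smul_apply, sliceLp, h2, smul_eq_mul]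
    filter_upwards [h1] with z hz
    rw [Finset.sum_apply, Finset.sum_congr rfl hz, trigPoly]
    exact Finset.sum_congr rfl fun k _ => by
      rw [Finset.mul_sum]; exact Finset.sum_congr rfl fun l _ => by ring
  rw [e, Lp.norm_toLp, trigNorm]

theorem exists_fourierFamily {p : ℝ} (hp : 1 < p) [Fact (1 ≤ ENNReal.ofReal p)] :
    ∃ K : ℝ, 0 < K ∧ ∀ N d, FourierFamily (sliceLp p N d) N K := by
  obtain ⟨K, hK, h⟩ := exists_circNorm_multiplier_le hp
  have slice : ∀ N (d : ℤ → ℤ → ℂ) (c : ℤ → ℂ) (y : ℝ),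
      (fun x => trigPoly N (fun k l => c k * d k l) (x, y)) =
        fun x => ∑ k ∈ freqs N, c k * (∑ l ∈ freqs N, d k l * expo l y) * expo k x := by
    intro N d c y
    ext x
    refine Finset.sum_congr rfl fun k _ => ?_
    rw [Finset.mul_sum, Finset.sum_mul]
    exact Finset.sum_congr rfl fun l _ => by ring
  have mono : ∀ N (d : ℤ → ℤ → ℂ) (c c' : ℤ → ℂ) (M : ℝ), 0 ≤ M →
      (∀ C : ℤ → ℂ, circNorm p (fun x => ∑ k ∈ freqs N, c k * C k * expo k x) ≤
        M * circNorm p (fun x => ∑ k ∈ freqs N, c' k * C k * expo k x)) →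
      ‖∑ k ∈ freqs N, c k • sliceLp p N d k‖ ≤ M * ‖∑ k ∈ freqs N, c' k • sliceLp p N d k‖ := by
    intro N d c c' M hM hC
    rw [norm_sum_sliceLp, norm_sum_sliceLp, trigNorm, trigNorm]
    have := eLpNorm_le_of_circNorm_le hp (continuous_trigPoly N fun k l => c k * d k l)
      (continuous_trigPoly N fun k l => c' k * d k l) hM fun y => by
        rw [slice, slice]; exact hC _
    have h2 := (memLp_sq_of_continuous (continuous_trigPoly N fun k l => c' k * d k l)
      (ENNReal.ofReal p)).2.ne
    rw [← ENNReal.toReal_ofReal hM, ← ENNReal.toReal_mul]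
    exact ENNReal.toReal_mono (ENNReal.mul_ne_top ENNReal.ofReal_ne_top h2) this
  refine ⟨K, hK, fun N d => ⟨fun c m M hm => ?_, fun c s => ?_⟩⟩
  · refine mono N d _ _ _ (mul_nonneg hK.le hm.nonneg) fun C => ?_
    simpa only [mul_assoc] using h N (fun k => c k * C k) m M hm
  · have key : ∀ C : ℤ → ℂ, circNorm p (fun x => ∑ k ∈ freqs N,
        Complex.exp (k * s * Complex.I) * c k * C k * expo k x) =
        circNorm p (fun x => ∑ k ∈ freqs N, c k * C k * expo k x) := fun C => by
      rw [← circNorm_comp_add hp (f := fun x => ∑ k ∈ freqs N, c k * C k * expo k x) (by fun_prop)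
        (fun x => Finset.sum_congr rfl fun k _ => by rw [expo_periodic k x]) s]
      congr 1
      ext x
      refine Finset.sum_congr rfl fun k _ => ?_
      rw [expo_arg_add, expo.eq_1 k s]; ring
    refine le_antisymm ?_ ?_
    · simpa using mono N d (fun k => Complex.exp (k * s * Complex.I) * c k) c 1 zero_le_one
        fun C => by rw [key, one_mul]
    · simpa using mono N d c (fun k => Complex.exp (k * s * Complex.I) * c k) 1 zero_le_one
        fun C => by rw [key, one_mul]

/-- The realization quantity of a trigonometric polynomial. -/
def trigRealization (p α₁ α₂ : ℝ) (n₁ n₂ N : ℕ) (c : ℤ → ℤ → ℂ) : ℝ :=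
  (n₁ : ℝ) ^ (-α₁) * (n₂ : ℝ) ^ (-α₂) *
      trigNorm p N (fun k l => hermMul (derivSeq α₁ n₁) k * (hermMul (derivSeq α₂ n₂) l * c k l))
    + (n₁ : ℝ) ^ (-α₁) *
      trigNorm p N (fun k l => hermMul (derivSeq α₁ n₁) k * (hermMul (highSeq n₂) l * c k l))
    + (n₂ : ℝ) ^ (-α₂) *
      trigNorm p N (fun k l => hermMul (highSeq n₁) k * (hermMul (derivSeq α₂ n₂) l * c k l))
    + trigNorm p N (fun k l => hermMul (highSeq n₁) k * (hermMul (highSeq n₂) l * c k l))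

theorem exists_trigNorm_estimates {p : ℝ} (hp : 1 < p) {α : ℝ} (hα : 0 < α) :
    ∃ C : ℝ, 0 < C ∧ ∀ (n N : ℕ) (c : ℤ → ℤ → ℂ), 1 ≤ n →
      (∀ h, |h| ≤ π / n → trigNorm p N (fun k l => diffMul α h k * (hermMul (lowSeq n) k * c k l)) ≤
        C * ((n : ℝ) ^ (-α) * trigNorm p N (fun k l => hermMul (derivSeq α n) k * c k l))) ∧
      (∀ h, trigNorm p N (fun k l => diffMul α h k * c k l) ≤ C * trigNorm p N c) ∧
      ((n : ℝ) ^ (-α) * trigNorm p N (fun k l => hermMul (derivSeq α n) k * c k l) ≤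
        C * trigNorm p N (fun k l => diffMul α (π / n) k * c k l)) ∧
      (∀ W, (∀ h, |h| ≤ π / n → trigNorm p N (fun k l => diffMul α h k * c k l) ≤ W) →
        trigNorm p N (fun k l => hermMul (highSeq n) k * c k l) ≤ C * W) := by
  have : Fact (1 ≤ ENNReal.ofReal p) := ⟨by simpa using hp.le⟩
  obtain ⟨K, hK, H⟩ := exists_fourierFamily hp
  set A := ∑' ν, |diffCoeff α ν| with hA
  have hA0 : 0 ≤ A := tsum_nonneg fun _ => abs_nonneg _
  obtain ⟨B, hB⟩ := exists_nat_ge (max 1 (4 * A * K))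
  have hB1 : 1 ≤ B := by exact_mod_cast (le_max_left _ _).trans hB
  have hBK := (le_max_right _ _).trans hB
  have C1 : 0 ≤ K * (2 * π ^ α) := by positivity
  have C3 : 0 < 4 * K ^ 2 := by positivity
  have C4 : 0 ≤ 4 * (B : ℝ) ^ α * K ^ 2 + 2 * K := by positivity
  refine ⟨K * (2 * π ^ α) + A + 4 * K ^ 2 + (4 * (B : ℝ) ^ α * K ^ 2 + 2 * K), by linarith,
    fun n N c hn => ?_⟩
  have N0 : ∀ c, 0 ≤ trigNorm p N c := fun c => ENNReal.toReal_nonneg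
  have n0 : 0 ≤ (n : ℝ) ^ (-α) := by positivity
  have e : ∀ g : ℤ → ℂ, ‖∑ k ∈ freqs N, (g k * 1) • sliceLp p N c k‖ =
      trigNorm p N (fun k l => g k * c k l) := fun g => by
    simp only [mul_one]; exact norm_sum_sliceLp p N c g
  refine ⟨fun h hh => ?_, fun h => ?_, ?_, fun W hW => ?_⟩
  · have := (H N c).norm_diff_low_le hα hn hh (fun _ => 1)
    rw [e, norm_sum_sliceLp] at this
    refine (le_of_eq (congrArg (trigNorm p N) (by ext; ring))).trans <|
      this.trans (mul_le_mul_of_nonneg_right (by linarith) (mul_nonneg n0 (N0 _)))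
  · have := (H N c).norm_diffMul_le hα h (fun _ => 1)
    have e1 := e (fun _ => 1)
    simp only [one_mul, mul_one] at e1 this
    rw [norm_sum_sliceLp, e1] at this
    refine this.trans (mul_le_mul_of_nonneg_right (by linarith) (N0 _))
  · have := (H N c).norm_derivSeq_le hK.le hα hn (fun _ => 1)
    rw [e, e] at this
    refine this.trans (mul_le_mul_of_nonneg_right (by linarith) (N0 _))
  · have h0 : 0 ≤ W := (N0 _).trans (hW 0 (by rw [abs_zero]; positivity))
    have := (H N c).norm_tail_le hK.le hα hn hB1 hBK (c := fun _ => 1) (W := W) fun h hh => by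
      rw [e]; exact hW h (by rw [abs_of_nonneg hh.1]; exact hh.2)
    rw [e] at this
    refine this.trans (mul_le_mul_of_nonneg_right (by linarith) h0)

theorem hermMul_lowSeq_add_highSeq (n : ℕ) (k : ℤ) :
    hermMul (lowSeq n) k + hermMul (highSeq n) k = 1 := by
  simp only [hermMul, highSeq, lowSeq]
  split_ifs <;> simp

theorem exists_trig_realization {p : ℝ} (hp : 1 < p) {α₁ α₂ : ℝ} (hα₁ : 0 < α₁) (hα₂ : 0 < α₂) :
    ∃ C : ℝ, 0 < C ∧ ∀ (n₁ n₂ N : ℕ) (c : ℤ → ℤ → ℂ), 1 ≤ n₁ → 1 ≤ n₂ →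
      (∀ h₁ h₂, |h₁| ≤ π / n₁ → |h₂| ≤ π / n₂ →
        trigNorm p N (fun k l => diffMul α₁ h₁ k * (diffMul α₂ h₂ l * c k l)) ≤
          C * trigRealization p α₁ α₂ n₁ n₂ N c) ∧
      ∀ W, (∀ h₁ h₂, |h₁| ≤ π / n₁ → |h₂| ≤ π / n₂ →
        trigNorm p N (fun k l => diffMul α₁ h₁ k * (diffMul α₂ h₂ l * c k l)) ≤ W) →
          trigRealization p α₁ α₂ n₁ n₂ N c ≤ C * W := by
  obtain ⟨C₁, hC₁, E₁⟩ := exists_trigNorm_estimates hp hα₁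
  obtain ⟨C₂, hC₂, E₂⟩ := exists_trigNorm_estimates hp hα₂
  have hC : 0 < C₁ * C₂ := by positivity
  refine ⟨4 * (C₁ * C₂), by positivity, fun n₁ n₂ N c hn₁ hn₂ => ?_⟩
  have N0 : ∀ c, 0 ≤ trigNorm p N c := fun c => ENNReal.toReal_nonneg
  have n₁0 : 0 ≤ (n₁ : ℝ) ^ (-α₁) := by positivity
  have n₂0 : 0 ≤ (n₂ : ℝ) ^ (-α₂) := by positivity
  have F₁ := fun c => E₁ n₁ N c hn₁
  have F₂ : ∀ c : ℤ → ℤ → ℂ,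
      (∀ h, |h| ≤ π / n₂ →
        trigNorm p N (fun k l => diffMul α₂ h l * (hermMul (lowSeq n₂) l * c k l)) ≤
        C₂ * ((n₂ : ℝ) ^ (-α₂) * trigNorm p N (fun k l => hermMul (derivSeq α₂ n₂) l * c k l))) ∧
      (∀ h, trigNorm p N (fun k l => diffMul α₂ h l * c k l) ≤ C₂ * trigNorm p N c) ∧
      ((n₂ : ℝ) ^ (-α₂) * trigNorm p N (fun k l => hermMul (derivSeq α₂ n₂) l * c k l) ≤
        C₂ * trigNorm p N (fun k l => diffMul α₂ (π / n₂) l * c k l)) ∧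
      (∀ W, (∀ h, |h| ≤ π / n₂ → trigNorm p N (fun k l => diffMul α₂ h l * c k l) ≤ W) →
        trigNorm p N (fun k l => hermMul (highSeq n₂) l * c k l) ≤ C₂ * W) := fun c => by
    have h := E₂ n₂ N (fun k l => c l k) hn₂
    have s := fun c => trigNorm_swap p N c
    refine ⟨fun t ht => ?_, fun t => ?_, ?_, fun W hW => ?_⟩
    · rw [← s, ← s (fun k l => hermMul (derivSeq α₂ n₂) l * c k l)]; exact h.1 t ht
    · rw [← s, ← s c]; exact h.2.1 t
    · rw [← s, ← s (fun k l => diffMul α₂ (π / n₂) l * c k l)]; exact h.2.2.1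
    · rw [← s]; exact h.2.2.2 W fun t ht => by
        rw [s (fun k l => diffMul α₂ t l * c k l)]; exact hW t ht
  have S₁ := fun c => (F₁ c).2.2.2
  have S₂ := fun c => (F₂ c).2.2.2
  set a₁ := (n₁ : ℝ) ^ (-α₁)
  set a₂ := (n₂ : ℝ) ^ (-α₂)
  set H₁ := hermMul (highSeq n₁)
  set d₁ := hermMul (derivSeq α₁ n₁)
  set H₂ := hermMul (highSeq n₂)
  set d₂ := hermMul (derivSeq α₂ n₂)
  constructor
  · intro h₁ h₂ hh₁ hh₂
    have P₁ := fun c => (F₁ c).1 h₁ hh₁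
    have P₂ := fun c => (F₂ c).1 h₂ hh₂
    have Q₁ := fun c => (F₁ c).2.1 h₁
    have Q₂ := fun c => (F₂ c).2.1 h₂
    set D₁ := diffMul α₁ h₁
    set D₂ := diffMul α₂ h₂
    set L₁ := hermMul (lowSeq n₁)
    set L₂ := hermMul (lowSeq n₂)
    have t1 : trigNorm p N (fun k l => D₁ k * (L₁ k * (D₂ l * (L₂ l * c k l)))) ≤
        C₁ * C₂ * (a₁ * a₂ * trigNorm p N (fun k l => d₁ k * (d₂ l * c k l))) := by
      have w := P₂ fun k l => d₁ k * c k l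
      rw [show (fun k l => D₂ l * (L₂ l * (d₁ k * c k l))) =
          fun k l => d₁ k * (D₂ l * (L₂ l * c k l)) by ext; ring,
        show (fun k l => d₂ l * (d₁ k * c k l)) = fun k l => d₁ k * (d₂ l * c k l) by ext; ring] at w
      refine (P₁ _).trans ?_
      calc _ ≤ C₁ * (a₁ * (C₂ * (a₂ * trigNorm p N (fun k l => d₁ k * (d₂ l * c k l))))) := by gcongr
        _ = _ := by ring
    have t2 : trigNorm p N (fun k l => D₁ k * (L₁ k * (D₂ l * (H₂ l * c k l)))) ≤
        C₁ * C₂ * (a₁ * trigNorm p N (fun k l => d₁ k * (H₂ l * c k l))) := by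
      have w := Q₂ fun k l => d₁ k * (H₂ l * c k l)
      rw [show (fun k l => D₂ l * (d₁ k * (H₂ l * c k l))) =
          fun k l => d₁ k * (D₂ l * (H₂ l * c k l)) by ext; ring] at w
      refine (P₁ _).trans ?_
      calc _ ≤ C₁ * (a₁ * (C₂ * trigNorm p N (fun k l => d₁ k * (H₂ l * c k l)))) := by gcongr
        _ = _ := by ring
    have t3 : trigNorm p N (fun k l => D₁ k * (H₁ k * (D₂ l * (L₂ l * c k l)))) ≤
        C₁ * C₂ * (a₂ * trigNorm p N (fun k l => H₁ k * (d₂ l * c k l))) := by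
      have w := P₂ fun k l => H₁ k * c k l
      rw [show (fun k l => D₂ l * (L₂ l * (H₁ k * c k l))) =
          fun k l => H₁ k * (D₂ l * (L₂ l * c k l)) by ext; ring,
        show (fun k l => d₂ l * (H₁ k * c k l)) = fun k l => H₁ k * (d₂ l * c k l) by ext; ring] at w
      refine (Q₁ _).trans ?_
      calc _ ≤ C₁ * (C₂ * (a₂ * trigNorm p N (fun k l => H₁ k * (d₂ l * c k l)))) := by gcongr
        _ = _ := by ring
    have t4 : trigNorm p N (fun k l => D₁ k * (H₁ k * (D₂ l * (H₂ l * c k l)))) ≤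
        C₁ * C₂ * trigNorm p N (fun k l => H₁ k * (H₂ l * c k l)) := by
      have w := Q₂ fun k l => H₁ k * (H₂ l * c k l)
      rw [show (fun k l => D₂ l * (H₁ k * (H₂ l * c k l))) =
          fun k l => H₁ k * (D₂ l * (H₂ l * c k l)) by ext; ring] at w
      refine (Q₁ _).trans ?_
      rw [mul_assoc]
      gcongr
    have e : (fun k l => D₁ k * (D₂ l * c k l)) = fun k l =>
        (D₁ k * (L₁ k * (D₂ l * (L₂ l * c k l))) + D₁ k * (L₁ k * (D₂ l * (H₂ l * c k l)))) +
        (D₁ k * (H₁ k * (D₂ l * (L₂ l * c k l))) + D₁ k * (H₁ k * (D₂ l * (H₂ l * c k l)))) := by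
      ext k l
      have e1 : L₁ k + H₁ k = 1 := hermMul_lowSeq_add_highSeq n₁ k
      have e2 : L₂ l + H₂ l = 1 := hermMul_lowSeq_add_highSeq n₂ l
      calc _ = D₁ k * ((L₁ k + H₁ k) * (D₂ l * ((L₂ l + H₂ l) * c k l))) := by
            rw [e1, e2, one_mul, one_mul]
        _ = _ := by ring
    rw [e]
    refine (trigNorm_add_le hp _ _ _).trans ?_
    refine (add_le_add (trigNorm_add_le hp _ _ _) (trigNorm_add_le hp _ _ _)).trans ?_
    refine (add_le_add (add_le_add t1 t2) (add_le_add t3 t4)).trans ?_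
    have hR : 0 ≤ trigRealization p α₁ α₂ n₁ n₂ N c :=
      add_nonneg (add_nonneg (add_nonneg (mul_nonneg (mul_nonneg n₁0 n₂0) (N0 _))
        (mul_nonneg n₁0 (N0 _))) (mul_nonneg n₂0 (N0 _))) (N0 _)
    refine le_trans (le_of_eq ?_)
      (mul_le_mul_of_nonneg_right (show C₁ * C₂ ≤ 4 * (C₁ * C₂) by linarith) hR)
    simp only [trigRealization, a₁, a₂, d₁, d₂, H₁, H₂]
    ring
  · intro W hW
    have h0 : ∀ n : ℕ, |π / (n : ℝ)| ≤ π / n := fun n => (abs_of_nonneg (by positivity)).le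
    have R₁ := fun c => (F₁ c).2.2.1
    have R₂ := fun c => (F₂ c).2.2.1
    have hT := hW _ _ (h0 n₁) (h0 n₂)
    have hT₁ := fun h hh => hW _ h (h0 n₁) hh
    have hT₂ := fun h hh => hW h _ hh (h0 n₂)
    set T₁ := diffMul α₁ (π / n₁)
    set T₂ := diffMul α₂ (π / n₂)
    have s1 : a₁ * a₂ * trigNorm p N (fun k l => d₁ k * (d₂ l * c k l)) ≤ C₁ * C₂ * W := by
      have u := R₁ fun k l => d₂ l * c k l
      have w := R₂ fun k l => T₁ k * c k l
      rw [show (fun k l => d₂ l * (T₁ k * c k l)) = fun k l => T₁ k * (d₂ l * c k l) by ext; ring,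
        show (fun k l => T₂ l * (T₁ k * c k l)) = fun k l => T₁ k * (T₂ l * c k l) by ext; ring] at w
      calc _ = a₂ * (a₁ * trigNorm p N (fun k l => d₁ k * (d₂ l * c k l))) := by ring
        _ ≤ a₂ * (C₁ * trigNorm p N (fun k l => T₁ k * (d₂ l * c k l))) := by gcongr
        _ = C₁ * (a₂ * trigNorm p N (fun k l => T₁ k * (d₂ l * c k l))) := by ring
        _ ≤ C₁ * (C₂ * W) := mul_le_mul_of_nonneg_left (w.trans (by gcongr)) hC₁.le
        _ = _ := by ring
    have s2 : a₁ * trigNorm p N (fun k l => d₁ k * (H₂ l * c k l)) ≤ C₁ * C₂ * W := by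
      have w := S₂ (fun k l => T₁ k * c k l) W fun h hh =>
        (congrArg (trigNorm p N) (by ext; ring)).trans_le (hT₁ h hh)
      rw [show (fun k l => H₂ l * (T₁ k * c k l)) = fun k l => T₁ k * (H₂ l * c k l) by ext; ring] at w
      refine (R₁ _).trans ?_
      rw [mul_assoc]
      gcongr
    have s3 : a₂ * trigNorm p N (fun k l => H₁ k * (d₂ l * c k l)) ≤ C₁ * C₂ * W := by
      have u := R₂ fun k l => H₁ k * c k l
      have w := S₁ (fun k l => T₂ l * c k l) W hT₂
      rw [show (fun k l => d₂ l * (H₁ k * c k l)) = fun k l => H₁ k * (d₂ l * c k l) by ext; ring,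
        show (fun k l => T₂ l * (H₁ k * c k l)) = fun k l => H₁ k * (T₂ l * c k l) by ext; ring] at u
      refine u.trans ?_
      rw [mul_comm C₁, mul_assoc]
      gcongr
    have s4 : trigNorm p N (fun k l => H₁ k * (H₂ l * c k l)) ≤ C₁ * C₂ * W := by
      rw [mul_assoc]
      refine S₁ (fun k l => H₂ l * c k l) (C₂ * W) fun h hh => ?_
      have w := S₂ (fun k l => diffMul α₁ h k * c k l) W fun h' hh' =>
        (congrArg (trigNorm p N) (by ext; ring)).trans_le (hW h h' hh hh')
      exact (congrArg (trigNorm p N) (by ext; ring)).trans_le w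
    simp only [trigRealization]
    linarith

/-- Jointly measurable functions, `2π`-periodic in both variables, with finite `L_p` norm. -/
structure PeriodicLp (p : ℝ) (f : ℝ → ℝ → ℝ) : Prop where
  meas : Measurable (Function.uncurry f)
  periodic_x : ∀ y, Function.Periodic (fun x => f x y) (2 * π)
  periodic_y : ∀ x, Function.Periodic (f x) (2 * π)
  norm_ne_top : Lp2Norm p f ≠ ⊤

theorem Lp2Norm_rpow {p : ℝ} (hp : 1 < p) {f : ℝ → ℝ → ℝ} (hf : Measurable (Function.uncurry f)) :
    Lp2Norm p f ^ p = ∫⁻ z, ‖f z.1 z.2‖ₑ ^ p ∂sqMeasure := by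
  have hp0 : 0 < p := by linarith
  have hm : Measurable fun z : ℝ × ℝ => f z.1 z.2 := hf
  rw [Lp2Norm, ← ENNReal.rpow_mul, one_div, inv_mul_cancel₀ hp0.ne', ENNReal.rpow_one,
    lintegral_prod _ (by fun_prop)]
  refine lintegral_congr fun x => lintegral_congr fun y => ?_
  rw [Real.enorm_eq_ofReal_abs, ENNReal.ofReal_rpow_of_nonneg (abs_nonneg _) hp0.le]

theorem Lp2Norm_eq_eLpNorm {p : ℝ} (hp : 1 < p) {f : ℝ → ℝ → ℝ}
    (hf : Measurable (Function.uncurry f)) :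
    Lp2Norm p f = eLpNorm (Function.uncurry f) (ENNReal.ofReal p) sqMeasure := by
  have hp0 : 0 < p := by linarith
  rw [eLpNorm_eq_lintegral_rpow_enorm_toReal (by simpa using hp0) ENNReal.ofReal_ne_top,
    ENNReal.toReal_ofReal hp0.le]
  change _ = (∫⁻ z : ℝ × ℝ, ‖f z.1 z.2‖ₑ ^ p ∂sqMeasure) ^ (1 / p)
  rw [← Lp2Norm_rpow hp hf, ← ENNReal.rpow_mul, mul_one_div_cancel hp0.ne', ENNReal.rpow_one]

/-- The function with its two variables interchanged. -/
def swapVar (f : ℝ → ℝ → ℝ) : ℝ → ℝ → ℝ := fun x y => f y x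

theorem measurable_swapVar {f : ℝ → ℝ → ℝ} (hf : Measurable (Function.uncurry f)) :
    Measurable (Function.uncurry (swapVar f)) := hf.comp measurable_swap

theorem Lp2Norm_swapVar {p : ℝ} {f : ℝ → ℝ → ℝ}
    (hf : Measurable (Function.uncurry f)) : Lp2Norm p (swapVar f) = Lp2Norm p f := by
  have hm : Measurable fun z : ℝ × ℝ => ENNReal.ofReal (|f z.1 z.2| ^ p) :=
    ((hf.norm : Measurable fun z : ℝ × ℝ => |f z.1 z.2|).pow_const p).ennreal_ofReal
  rw [Lp2Norm, Lp2Norm]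
  congr 1
  exact lintegral_lintegral_swap (hm.comp measurable_swap).aemeasurable

theorem Lp2Norm_add_le {p : ℝ} (hp : 1 < p) {f g : ℝ → ℝ → ℝ}
    (hf : Measurable (Function.uncurry f)) (hg : Measurable (Function.uncurry g)) :
    Lp2Norm p (fun x y => f x y + g x y) ≤ Lp2Norm p f + Lp2Norm p g := by
  rw [Lp2Norm_eq_eLpNorm hp hf, Lp2Norm_eq_eLpNorm hp hg,
    Lp2Norm_eq_eLpNorm hp (f := fun x y => f x y + g x y) (hf.add hg)]
  exact eLpNorm_add_le hf.aestronglyMeasurable hg.aestronglyMeasurable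
    (by simpa using ENNReal.ofReal_le_ofReal hp.le)

theorem Lp2Norm_sub_le {p : ℝ} (hp : 1 < p) {f g : ℝ → ℝ → ℝ}
    (hf : Measurable (Function.uncurry f)) (hg : Measurable (Function.uncurry g)) :
    Lp2Norm p (fun x y => f x y - g x y) ≤ Lp2Norm p f + Lp2Norm p g := by
  rw [Lp2Norm_eq_eLpNorm hp hf, Lp2Norm_eq_eLpNorm hp hg,
    Lp2Norm_eq_eLpNorm hp (f := fun x y => f x y - g x y) (hf.sub hg)]
  exact eLpNorm_sub_le hf.aestronglyMeasurable hg.aestronglyMeasurable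
    (by simpa using ENNReal.ofReal_le_ofReal hp.le)

theorem Lp2Norm_sub_comm {p : ℝ} (f g : ℝ → ℝ → ℝ) :
    Lp2Norm p (fun x y => f x y - g x y) = Lp2Norm p (fun x y => g x y - f x y) := by
  simp only [Lp2Norm, abs_sub_comm]

theorem Lp2Norm_congr_ae {p : ℝ} (hp : 1 < p) {f g : ℝ → ℝ → ℝ}
    (hf : Measurable (Function.uncurry f)) (hg : Measurable (Function.uncurry g))
    (h : ∀ᵐ z ∂sqMeasure, f z.1 z.2 = g z.1 z.2) : Lp2Norm p f = Lp2Norm p g := by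
  rw [Lp2Norm_eq_eLpNorm hp hf, Lp2Norm_eq_eLpNorm hp hg]
  exact eLpNorm_congr_ae h

theorem PeriodicLp.swap {p : ℝ} {f : ℝ → ℝ → ℝ} (hf : PeriodicLp p f) :
    PeriodicLp p (swapVar f) :=
  ⟨measurable_swapVar hf.meas, hf.periodic_y, hf.periodic_x,
    (Lp2Norm_swapVar hf.meas).trans_ne hf.norm_ne_top⟩

theorem PeriodicLp.sub {p : ℝ} (hp : 1 < p) {f g : ℝ → ℝ → ℝ} (hf : PeriodicLp p f)
    (hg : PeriodicLp p g) : PeriodicLp p (fun x y => f x y - g x y) :=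
  ⟨hf.meas.sub hg.meas, fun y => (hf.periodic_x y).sub (hg.periodic_x y),
    fun x => (hf.periodic_y x).sub (hg.periodic_y x),
    ((Lp2Norm_sub_le hp hf.meas hg.meas).trans_lt
      (ENNReal.add_lt_top.2 ⟨hf.norm_ne_top.lt_top, hg.norm_ne_top.lt_top⟩)).ne⟩

theorem lintegral_circMeasure_comp_add {u : ℝ → ℝ≥0∞} (hu : Function.Periodic u (2 * π)) (t : ℝ) :
    ∫⁻ x, u (x + t) ∂circMeasure = ∫⁻ x, u x ∂circMeasure := by
  have h1 : ∫⁻ x in Set.Ioc 0 (2 * π), u (x + t) =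
      ∫⁻ x in Set.Ioc t (t + 2 * π), u x := by
    rw [← (measurePreserving_add_right volume t).setLIntegral_comp_preimage_emb
      (measurableEmbedding_addRight t) u (Set.Ioc t (t + 2 * π))]
    simp
  rw [circMeasure, h1]
  have hper : ∀ (g : AddSubgroup.zmultiples (2 * π)) (x : ℝ), u (g +ᵥ x) = u x := by
    rintro ⟨g, n, rfl⟩ x
    change u (n • (2 * π) + x) = u x
    rw [add_comm]; exact hu.zsmul n x
  have := (isAddFundamentalDomain_Ioc two_pi_pos t).setLIntegral_eq
    (isAddFundamentalDomain_Ioc two_pi_pos 0) u hper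
  simpa using this

/-- Superposition of translates in the first variable with weight `w` and shifts `s`. -/
def convOp {Ω : Type} [MeasurableSpace Ω] (ρ : Measure Ω) (w s : Ω → ℝ) (f : ℝ → ℝ → ℝ) :
    ℝ → ℝ → ℝ :=
  fun x y => ∫ ω, w ω * f (x + s ω) y ∂ρ

theorem lintegral_mul_rpow_le {Ω : Type} [MeasurableSpace Ω] {ρ : Measure Ω} {p : ℝ}
    (hp : 1 < p) {a u : Ω → ℝ≥0∞} (ha : Measurable a)
    (hu : Measurable u) :
    (∫⁻ ω, a ω * u ω ∂ρ) ^ p ≤ (∫⁻ ω, a ω ∂ρ) ^ (p - 1) * ∫⁻ ω, a ω * u ω ^ p ∂ρ := by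
  have hp0 : 0 < p := by linarith
  have h1 : 0 ≤ 1 - 1 / p := by rw [sub_nonneg, div_le_one hp0]; exact hp.le
  have h := ENNReal.lintegral_mul_norm_pow_le (μ := ρ) (ha.mul (hu.pow_const p)).aemeasurable
    ha.aemeasurable (p := 1 / p) (q := 1 - 1 / p) (by positivity) h1 (by ring)
  have e : ∀ ω, (a ω * u ω ^ p) ^ (1 / p) * a ω ^ (1 - 1 / p) = a ω * u ω := fun ω => by
    rw [ENNReal.mul_rpow_of_nonneg _ _ (by positivity), ← ENNReal.rpow_mul, mul_one_div_cancel hp0.ne',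
      ENNReal.rpow_one, mul_right_comm, ← ENNReal.rpow_add_of_nonneg _ _ (by positivity) h1,
      add_sub_cancel, ENNReal.rpow_one]
  simp only [Pi.mul_apply, e] at h
  refine (ENNReal.rpow_le_rpow h hp0.le).trans (le_of_eq ?_)
  rw [ENNReal.mul_rpow_of_nonneg _ _ hp0.le, ← ENNReal.rpow_mul, ← ENNReal.rpow_mul, sub_mul,
    one_div_mul_cancel hp0.ne', ENNReal.rpow_one, one_mul, mul_comm]

section convOp

variable {Ω : Type} [MeasurableSpace Ω] {ρ : Measure Ω} [SFinite ρ] {w s : Ω → ℝ} {p : ℝ}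
  {f g : ℝ → ℝ → ℝ}

theorem measurable_convOp (hw : Measurable w) (hs : Measurable s)
    (hf : Measurable (Function.uncurry f)) :
    Measurable (Function.uncurry (convOp ρ w s f)) := by
  have hF : Measurable fun q : (ℝ × ℝ) × Ω => f (q.1.1 + s q.2) q.1.2 :=
    hf.comp (f := fun q : (ℝ × ℝ) × Ω => (q.1.1 + s q.2, q.1.2)) (by fun_prop)
  have : Measurable fun q : (ℝ × ℝ) × Ω => w q.2 * f (q.1.1 + s q.2) q.1.2 :=
    (hw.comp measurable_snd).mul hF
  exact (this.stronglyMeasurable.integral_prod_right (ν := ρ)).measurable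

theorem lintegral_convOp_majorant_le (hp : 1 < p) (hw : Measurable w) (hs : Measurable s)
    (hf : PeriodicLp p f) :
    ∫⁻ z, (∫⁻ ω, ‖w ω‖ₑ * ‖f (z.1 + s ω) z.2‖ₑ ∂ρ) ^ p ∂sqMeasure ≤
      ((∫⁻ ω, ‖w ω‖ₑ ∂ρ) * Lp2Norm p f) ^ p := by
  have hp0 : 0 < p := by linarith
  have hf' : Measurable fun q : (ℝ × ℝ) × Ω => f (q.1.1 + s q.2) q.1.2 :=
    hf.meas.comp (f := fun q : (ℝ × ℝ) × Ω => (q.1.1 + s q.2, q.1.2)) (by fun_prop)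
  have hfz : ∀ z : ℝ × ℝ, Measurable fun ω => f (z.1 + s ω) z.2 := fun z =>
    hf'.comp (f := fun ω => (z, ω)) (by fun_prop)
  have hm : Measurable fun q : (ℝ × ℝ) × Ω => ‖w q.2‖ₑ * ‖f (q.1.1 + s q.2) q.1.2‖ₑ ^ p :=
    (hw.comp measurable_snd).enorm.mul (hf'.enorm.pow_const p)
  have h0 : Measurable fun z : ℝ × ℝ => ‖f z.1 z.2‖ₑ ^ p := by
    have : Measurable fun z : ℝ × ℝ => f z.1 z.2 := hf.meas
    fun_prop
  have hshift : ∀ t, ∫⁻ z : ℝ × ℝ, ‖f (z.1 + t) z.2‖ₑ ^ p ∂sqMeasure = Lp2Norm p f ^ p := fun t => by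
    have ht : Measurable fun z : ℝ × ℝ => ‖f (z.1 + t) z.2‖ₑ ^ p :=
      h0.comp (f := fun z : ℝ × ℝ => (z.1 + t, z.2)) (by fun_prop)
    rw [Lp2Norm_rpow hp hf.meas, lintegral_prod_symm _ h0.aemeasurable,
      lintegral_prod_symm _ ht.aemeasurable]
    refine lintegral_congr fun y => ?_
    exact lintegral_circMeasure_comp_add (u := fun x => ‖f x y‖ₑ ^ p)
      ((hf.periodic_x y).comp fun r => ‖r‖ₑ ^ p) t
  calc _ ≤ ∫⁻ z, (∫⁻ ω, ‖w ω‖ₑ ∂ρ) ^ (p - 1) *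
        ∫⁻ ω, ‖w ω‖ₑ * ‖f (z.1 + s ω) z.2‖ₑ ^ p ∂ρ ∂sqMeasure :=
        lintegral_mono fun z => lintegral_mul_rpow_le hp hw.enorm (hfz z).enorm
    _ = (∫⁻ ω, ‖w ω‖ₑ ∂ρ) ^ (p - 1) *
        ∫⁻ ω, ‖w ω‖ₑ * Lp2Norm p f ^ p ∂ρ := by
        rw [lintegral_const_mul _ hm.lintegral_prod_right', lintegral_lintegral_swap hm.aemeasurable]
        congr 1
        refine lintegral_congr fun ω => ?_
        rw [← hshift (s ω)]
        refine lintegral_const_mul (‖w ω‖ₑ) (f := fun z : ℝ × ℝ => ‖f (z.1 + s ω) z.2‖ₑ ^ p) ?_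
        exact h0.comp (f := fun z : ℝ × ℝ => (z.1 + s ω, z.2)) (by fun_prop)
    _ = _ := by
        rw [lintegral_mul_const _ hw.enorm, ← mul_assoc, ENNReal.mul_rpow_of_nonneg _ _ hp0.le]
        congr 1
        nth_rewrite 2 [← ENNReal.rpow_one (∫⁻ ω, ‖w ω‖ₑ ∂ρ)]
        rw [← ENNReal.rpow_add_of_nonneg _ _ (by linarith) zero_le_one, sub_add_cancel]

theorem ae_integrable_convOp (hp : 1 < p) (hw : Integrable w ρ) (hwm : Measurable w)
    (hs : Measurable s) (hf : PeriodicLp p f) :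
    ∀ᵐ z ∂sqMeasure, Integrable (fun ω => w ω * f (z.1 + s ω) z.2) ρ := by
  have hp0 : 0 < p := by linarith
  have hf' : Measurable fun q : (ℝ × ℝ) × Ω => f (q.1.1 + s q.2) q.1.2 :=
    hf.meas.comp (f := fun q : (ℝ × ℝ) × Ω => (q.1.1 + s q.2, q.1.2)) (by fun_prop)
  have hm : Measurable fun q : (ℝ × ℝ) × Ω => ‖w q.2‖ₑ * ‖f (q.1.1 + s q.2) q.1.2‖ₑ :=
    (hwm.comp measurable_snd).enorm.mul hf'.enorm
  have h := ae_lt_top (hm.lintegral_prod_right' (ν := ρ) |>.pow_const p)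
    ((lintegral_convOp_majorant_le (ρ := ρ) hp hwm hs hf).trans_lt
      (ENNReal.rpow_lt_top_of_nonneg hp0.le (ENNReal.mul_ne_top hw.2.ne hf.norm_ne_top))).ne
  filter_upwards [h] with z hz
  refine ⟨((hwm.mul (hf'.comp (f := fun ω => (z, ω)) (by fun_prop)))).aestronglyMeasurable, ?_⟩
  have := (ENNReal.rpow_lt_top_iff_of_pos hp0).1 hz
  simpa only [HasFiniteIntegral, enorm_mul] using this

theorem Lp2Norm_convOp_le (hp : 1 < p) (hwm : Measurable w)
    (hs : Measurable s) (hf : PeriodicLp p f) :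
    Lp2Norm p (convOp ρ w s f) ≤ (∫⁻ ω, ‖w ω‖ₑ ∂ρ) * Lp2Norm p f := by
  have hp0 : 0 < p := by linarith
  rw [← ENNReal.rpow_le_rpow_iff hp0, Lp2Norm_rpow hp (measurable_convOp hwm hs hf.meas)]
  refine le_trans (lintegral_mono fun z => ?_) (lintegral_convOp_majorant_le (ρ := ρ) hp hwm hs hf)
  refine ENNReal.rpow_le_rpow ?_ hp0.le
  refine (enorm_integral_le_lintegral_enorm _).trans (le_of_eq ?_)
  simp only [enorm_mul]

theorem PeriodicLp.convOp (hp : 1 < p) (hw : Integrable w ρ) (hwm : Measurable w)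
    (hs : Measurable s) (hf : PeriodicLp p f) : PeriodicLp p (convOp ρ w s f) where
  meas := measurable_convOp hwm hs hf.meas
  periodic_x y x := by
    refine integral_congr_ae (ae_of_all _ fun ω => ?_)
    have := hf.periodic_x y (x + s ω)
    dsimp only at this ⊢
    rw [add_right_comm, this]
  periodic_y x y := by
    refine integral_congr_ae (ae_of_all _ fun ω => ?_)
    dsimp only
    rw [hf.periodic_y]
  norm_ne_top := ((Lp2Norm_convOp_le hp hwm hs hf).trans_lt
    (ENNReal.mul_lt_top hw.2 hf.norm_ne_top.lt_top)).ne

theorem Lp2Norm_convOp_sub_le (hp : 1 < p) (hw : Integrable w ρ) (hwm : Measurable w)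
    (hs : Measurable s) (hf : PeriodicLp p f) (hg : PeriodicLp p g) :
    Lp2Norm p (fun x y => convOp ρ w s f x y - convOp ρ w s g x y) ≤
      (∫⁻ ω, ‖w ω‖ₑ ∂ρ) * Lp2Norm p (fun x y => f x y - g x y) := by
  have hfg := hf.sub hp hg
  refine le_trans (le_of_eq ?_) (Lp2Norm_convOp_le (ρ := ρ) hp hwm hs hfg)
  refine Lp2Norm_congr_ae hp ((hf.convOp hp hw hwm hs).sub hp (hg.convOp hp hw hwm hs)).meas
    (measurable_convOp hwm hs hfg.meas) ?_
  filter_upwards [ae_integrable_convOp hp hw hwm hs hf, ae_integrable_convOp hp hw hwm hs hg]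
    with z h1 h2
  simp only [_root_.convOp]
  rw [← integral_sub h1 h2]
  refine integral_congr_ae (ae_of_all _ fun ω => ?_)
  simp only [mul_sub]

end convOp

/-- `T` maps periodic `L_p` functions to periodic `L_p` functions and is `C`-Lipschitz. -/
structure LipOp (p : ℝ) (T : (ℝ → ℝ → ℝ) → ℝ → ℝ → ℝ) (C : ℝ≥0∞) : Prop where
  periodicLp : ∀ {f}, PeriodicLp p f → PeriodicLp p (T f)
  lip : ∀ {f g}, PeriodicLp p f → PeriodicLp p g →
    Lp2Norm p (fun x y => T f x y - T g x y) ≤ C * Lp2Norm p (fun x y => f x y - g x y)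

namespace LipOp

variable {p : ℝ} {T S : (ℝ → ℝ → ℝ) → ℝ → ℝ → ℝ} {C D : ℝ≥0∞}

theorem id : LipOp p (fun f => f) 1 := ⟨fun hf => hf, fun _ _ => by rw [one_mul]⟩

theorem comp (hT : LipOp p T C) (hS : LipOp p S D) : LipOp p (fun f => T (S f)) (C * D) where
  periodicLp hf := hT.periodicLp (hS.periodicLp hf)
  lip hf hg := (hT.lip (hS.periodicLp hf) (hS.periodicLp hg)).trans <| by
    rw [mul_assoc]; gcongr; exact hS.lip hf hg

theorem sub (hp : 1 < p) (hT : LipOp p T C) (hS : LipOp p S D) :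
    LipOp p (fun f x y => T f x y - S f x y) (C + D) where
  periodicLp hf := (hT.periodicLp hf).sub hp (hS.periodicLp hf)
  lip {f g} hf hg := by
    have h1 := (hT.periodicLp hf).sub hp (hT.periodicLp hg)
    have h2 := (hS.periodicLp hf).sub hp (hS.periodicLp hg)
    have e : (fun x y => T f x y - S f x y - (T g x y - S g x y)) =
        fun x y => (T f x y - T g x y) - (S f x y - S g x y) := by ext; ring
    rw [e, add_mul]
    exact (Lp2Norm_sub_le hp h1.meas h2.meas).trans (add_le_add (hT.lip hf hg) (hS.lip hf hg))

theorem swap (hp : 1 < p) (hT : LipOp p T C) :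
    LipOp p (fun f => swapVar (T (swapVar f))) C where
  periodicLp hf := (hT.periodicLp hf.swap).swap
  lip {f g} hf hg := by
    have h := hT.lip hf.swap hg.swap
    rw [← Lp2Norm_swapVar ((hT.periodicLp hf.swap).sub hp (hT.periodicLp hg.swap)).meas,
      ← Lp2Norm_swapVar (hf.swap.sub hp hg.swap).meas] at h
    exact h

theorem Lp2Norm_le (hp : 1 < p) (hT : LipOp p T C) {f g : ℝ → ℝ → ℝ} (hf : PeriodicLp p f)
    (hg : PeriodicLp p g) :
    Lp2Norm p (T f) ≤ Lp2Norm p (T g) + C * Lp2Norm p (fun x y => f x y - g x y) := by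
  have e : T f = fun x y => T g x y + (T f x y - T g x y) := by ext; ring
  rw [e]
  exact (Lp2Norm_add_le hp (hT.periodicLp hg).meas
    ((hT.periodicLp hf).sub hp (hT.periodicLp hg)).meas).trans (add_le_add_right (hT.lip hf hg) _)

end LipOp

theorem lipOp_convOp {p : ℝ} (hp : 1 < p) {Ω : Type} [MeasurableSpace Ω] {ρ : Measure Ω} [SFinite ρ]
    {w s : Ω → ℝ} (hw : Integrable w ρ) (hwm : Measurable w) (hs : Measurable s) :
    LipOp p (convOp ρ w s) (∫⁻ ω, ‖w ω‖ₑ ∂ρ) :=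
  ⟨fun hf => hf.convOp hp hw hwm hs, fun hf hg => Lp2Norm_convOp_sub_le hp hw hwm hs hf hg⟩

theorem integral_count_nat (u : ℕ → ℝ) : ∫ ν, u ν ∂Measure.count = ∑' ν, u ν := by
  by_cases h : Summable fun ν => ‖u ν‖
  · have := integral_countable (μ := Measure.count) (f := u) (integrable_count_iff.2 h)
    simpa using this
  · rw [integral_undef (fun h' => h (integrable_count_iff.1 h')), tsum_eq_zero_of_not_summable]
    rwa [← summable_norm_iff]

theorem integrable_diffCoeff {α : ℝ} (hα : 0 < α) : Integrable (diffCoeff α) Measure.count :=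
  integrable_count_iff.2 (summable_abs_diffCoeff hα)

theorem diffX_eq_convOp (α h : ℝ) :
    diffX α h = convOp Measure.count (diffCoeff α) (fun ν => (α - ν) * h) := by
  ext f x y
  rw [convOp, integral_count_nat]
  rfl

theorem lipOp_diffX {p : ℝ} (hp : 1 < p) {α : ℝ} (hα : 0 < α) (h : ℝ) :
    LipOp p (diffX α h) (∫⁻ ν, ‖diffCoeff α ν‖ₑ ∂Measure.count) := by
  rw [diffX_eq_convOp]
  exact lipOp_convOp hp (integrable_diffCoeff hα) (by fun_prop) (by fun_prop)

theorem lipOp_diffY {p : ℝ} (hp : 1 < p) {α : ℝ} (hα : 0 < α) (h : ℝ) :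
    LipOp p (diffY α h) (∫⁻ ν, ‖diffCoeff α ν‖ₑ ∂Measure.count) :=
  (lipOp_diffX hp hα h).swap hp

@[fun_prop]
theorem continuous_fracDirichlet (α : ℝ) (n : ℕ) : Continuous (fracDirichlet α n) := by
  unfold fracDirichlet; fun_prop

theorem integrable_circMeasure_of_continuous {u : ℝ → ℝ} (hu : Continuous u) :
    Integrable u circMeasure :=
  (hu.integrableOn_Icc (a := 0) (b := 2 * π)).mono_set Set.Ioc_subset_Icc_self

theorem sX_eq_convOp (α : ℝ) (n : ℕ) :
    sX α n = convOp circMeasure (fun t => 1 / π * fracDirichlet α n t) (fun t => t) := by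
  ext f x y
  rw [convOp, sX, intervalIntegral.integral_of_le two_pi_pos.le, ← integral_const_mul]
  exact integral_congr_ae (ae_of_all _ fun t => by ring)

theorem exists_lipOp_sX {p : ℝ} (hp : 1 < p) (α : ℝ) (n : ℕ) : ∃ C ≠ ⊤, LipOp p (sX α n) C := by
  have hc : Continuous fun t => 1 / π * fracDirichlet α n t := by fun_prop
  rw [sX_eq_convOp]
  exact ⟨_, (integrable_circMeasure_of_continuous hc).2.ne, lipOp_convOp hp
    (integrable_circMeasure_of_continuous hc) hc.measurable measurable_id⟩

theorem exists_lipOp_sY {p : ℝ} (hp : 1 < p) (α : ℝ) (n : ℕ) : ∃ C ≠ ⊤, LipOp p (sY α n) C := by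
  obtain ⟨C, hC, h⟩ := exists_lipOp_sX hp α n
  exact ⟨C, hC, h.swap hp⟩

theorem sXY_eq (α₁ α₂ : ℝ) (n₁ n₂ : ℕ) (f : ℝ → ℝ → ℝ) :
    sXY α₁ α₂ n₁ n₂ f = sX α₁ n₁ (sY α₂ n₂ f) := by
  ext x y
  rw [sXY, sX, show 1 / π ^ 2 = 1 / π * (1 / π) by ring, mul_assoc,
    ← intervalIntegral.integral_const_mul]
  congr 1
  refine intervalIntegral.integral_congr fun t _ => ?_
  rw [sY, mul_assoc, ← intervalIntegral.integral_mul_const]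
  congr 1
  exact intervalIntegral.integral_congr fun u _ => by ring

/-- The mean value in the first variable. -/
def meanX : (ℝ → ℝ → ℝ) → ℝ → ℝ → ℝ := convOp circMeasure (fun _ => 1 / (2 * π)) (fun t => t)

theorem exists_lipOp_meanX {p : ℝ} (hp : 1 < p) : ∃ C ≠ ⊤, LipOp p meanX C :=
  ⟨_, (integrable_circMeasure_of_continuous continuous_const).2.ne, lipOp_convOp hp
    (integrable_circMeasure_of_continuous continuous_const) measurable_const measurable_id⟩

/-- The exponential sum with frequencies in `S` and coefficients `c`. -/
def expSum (S : Finset (ℤ × ℤ)) (c : ℤ × ℤ → ℂ) (z : ℝ × ℝ) : ℂ :=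
  ∑ q ∈ S, c q * (expo q.1 z.1 * expo q.2 z.2)

@[fun_prop]
theorem continuous_expSum (S : Finset (ℤ × ℤ)) (c : ℤ × ℤ → ℂ) : Continuous (expSum S c) := by
  unfold expSum; fun_prop

/-- The real function `g` is the exponential sum with frequencies in `S` and coefficients `c`. -/
def IsExpSum (S : Finset (ℤ × ℤ)) (c : ℤ × ℤ → ℂ) (g : ℝ → ℝ → ℝ) : Prop :=
  ∀ x y, (g x y : ℂ) = expSum S c (x, y)

namespace IsExpSum

variable {S : Finset (ℤ × ℤ)} {c d : ℤ × ℤ → ℂ} {g h : ℝ → ℝ → ℝ}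

theorem congr (hg : IsExpSum S c g) (hcd : ∀ q ∈ S, c q = d q) : IsExpSum S d g := fun x y =>
  (hg x y).trans (Finset.sum_congr rfl fun q hq => by rw [hcd q hq])

theorem sub (hg : IsExpSum S c g) (hh : IsExpSum S d h) :
    IsExpSum S (fun q => c q - d q) (fun x y => g x y - h x y) := fun x y => by
  push_cast
  rw [hg, hh, expSum, expSum, expSum, ← Finset.sum_sub_distrib]
  exact Finset.sum_congr rfl fun q _ => by ring

theorem swap (hg : IsExpSum S c g) :
    IsExpSum (S.map (Equiv.prodComm ℤ ℤ).toEmbedding) (fun q => c q.swap) (swapVar g) :=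
  fun x y => by
    rw [swapVar, hg, expSum, expSum, Finset.sum_map]
    exact Finset.sum_congr rfl fun q _ => by simp [mul_comm]

theorem swap' (hg : IsExpSum (S.map (Equiv.prodComm ℤ ℤ).toEmbedding) c g) :
    IsExpSum S (fun q => c q.swap) (swapVar g) :=
  fun x y => by
    rw [swapVar, hg, expSum, expSum, Finset.sum_map]
    exact Finset.sum_congr rfl fun q _ => by simp [mul_comm]

theorem eq_re (hg : IsExpSum S c g) : Function.uncurry g = fun z => (expSum S c z).re := by
  ext z
  rw [← hg z.1 z.2]; rfl

theorem eLpNorm_eq (hg : IsExpSum S c g) (q : ℝ≥0∞) :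
    eLpNorm (Function.uncurry g) q sqMeasure = eLpNorm (expSum S c) q sqMeasure :=
  eLpNorm_congr_norm_ae <| ae_of_all _ fun z => by
    rw [← hg z.1 z.2, Complex.norm_real]; rfl

theorem measurable (hg : IsExpSum S c g) : Measurable (Function.uncurry g) := by
  rw [hg.eq_re]; fun_prop

theorem Lp2Norm_eq {p : ℝ} (hp : 1 < p) (hg : IsExpSum S c g) :
    Lp2Norm p g = eLpNorm (expSum S c) (ENNReal.ofReal p) sqMeasure := by
  rw [Lp2Norm_eq_eLpNorm hp hg.measurable, hg.eLpNorm_eq]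

theorem periodicLp {p : ℝ} (hp : 1 < p) (hg : IsExpSum S c g) : PeriodicLp p g where
  meas := hg.measurable
  periodic_x y x := by
    apply Complex.ofReal_injective
    simp only [hg x y, hg (x + 2 * π) y, expSum, expo_periodic _ x]
  periodic_y x y := by
    apply Complex.ofReal_injective
    simp only [hg x y, hg x (y + 2 * π), expSum, expo_periodic _ y]
  norm_ne_top := by
    rw [hg.Lp2Norm_eq hp]
    exact (memLp_sq_of_continuous (continuous_expSum S c) _).eLpNorm_ne_top

theorem convOp {Ω : Type} [MeasurableSpace Ω] {ρ : Measure Ω} {w s : Ω → ℝ} (hw : Integrable w ρ)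
    (hs : Measurable s) {m : ℤ → ℂ}
    (hm : ∀ q ∈ S, ∫ ω, (w ω : ℂ) * expo q.1 (s ω) ∂ρ = m q.1) (hg : IsExpSum S c g) :
    IsExpSum S (fun q => m q.1 * c q) (convOp ρ w s g) := fun x y => by
  have hi : ∀ k, Integrable (fun ω => (w ω : ℂ) * expo k (s ω)) ρ := fun k =>
    hw.ofReal.mul_bdd (c := 1) ((continuous_expo k).measurable.comp hs).aestronglyMeasurable
      (ae_of_all _ fun ω => (norm_expo _ _).le)
  rw [_root_.convOp, ← integral_complex_ofReal]
  have e : ∀ ω, ((w ω * g (x + s ω) y : ℝ) : ℂ) =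
      ∑ q ∈ S, c q * (expo q.1 x * expo q.2 y) * ((w ω : ℂ) * expo q.1 (s ω)) := fun ω => by
    push_cast
    rw [hg, expSum, Finset.mul_sum]
    exact Finset.sum_congr rfl fun q _ => by simp only [expo_arg_add]; ring
  simp only [e]
  rw [integral_finsetSum _ fun q _ => (hi q.1).const_mul _, expSum]
  refine Finset.sum_congr rfl fun q hq => ?_
  rw [integral_const_mul, hm q hq]
  ring

theorem diffX {α : ℝ} (hα : 0 < α) (t : ℝ) (hg : IsExpSum S c g) :
    IsExpSum S (fun q => diffMul α t q.1 * c q) (diffX α t g) := by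
  rw [diffX_eq_convOp]
  refine hg.convOp (integrable_diffCoeff hα) (by fun_prop) fun q _ => ?_
  have hi : Integrable (fun ν : ℕ => (diffCoeff α ν : ℂ) * expo q.1 ((α - ν) * t)) Measure.count :=
    integrable_count_iff.2 (summable_diffCoeff_mul hα fun ν => (norm_expo _ _).le).norm
  rw [integral_countable hi, diffMul]
  refine tsum_congr fun ν => ?_
  simp [expo]

theorem diffY {α : ℝ} (hα : 0 < α) (t : ℝ) (hg : IsExpSum S c g) :
    IsExpSum S (fun q => diffMul α t q.2 * c q) (diffY α t g) :=
  (hg.swap.diffX hα t).swap'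

end IsExpSum

theorem integral_expo (k : ℤ) : ∫ t in (0:ℝ)..(2 * π), expo k t = if k = 0 then 2 * (π : ℂ) else 0 := by
  split_ifs with hk
  · simp [hk, expo_zero]
  · have hc : (k : ℂ) * Complex.I ≠ 0 := by simp [hk]
    have e : ∀ t : ℝ, expo k t = Complex.exp ((k : ℂ) * Complex.I * t) := fun t => by
      rw [expo]; congr 1; ring
    simp only [e]
    rw [integral_exp_mul_complex hc, ← e, ← e]
    have := expo_periodic k 0
    rw [zero_add] at this
    rw [this, sub_self, zero_div]

theorem integral_cos_mul_expo {j : ℕ} (hj : 1 ≤ j) {k : ℤ} (φ : ℝ) :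
    ∫ t in (0:ℝ)..(2 * π), ((Real.cos (j * t + φ) : ℝ) : ℂ) * expo k t =
      if k = j then π * Complex.exp (-φ * Complex.I) else
        if k = -j then π * Complex.exp (φ * Complex.I) else 0 := by
  have e : ∀ t : ℝ, ((Real.cos (j * t + φ) : ℝ) : ℂ) * expo k t =
      Complex.exp (φ * Complex.I) / 2 * expo (k + j) t +
        Complex.exp (-φ * Complex.I) / 2 * expo (k - j) t := fun t => by
    rw [sub_eq_add_neg, expo_add, expo_add, Complex.ofReal_cos, Complex.cos]
    have h1 : Complex.exp (((j * t + φ : ℝ) : ℂ) * Complex.I) =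
        Complex.exp (φ * Complex.I) * expo j t := by
      rw [expo, ← Complex.exp_add]; congr 1; push_cast; ring
    have h2 : Complex.exp (-((j * t + φ : ℝ) : ℂ) * Complex.I) =
        Complex.exp (-φ * Complex.I) * expo (-j) t := by
      rw [expo, ← Complex.exp_add]; congr 1; push_cast; ring
    rw [h1, h2]; ring
  simp only [e]
  rw [intervalIntegral.integral_add (by apply Continuous.intervalIntegrable; fun_prop)
    (by apply Continuous.intervalIntegrable; fun_prop), intervalIntegral.integral_const_mul,
    intervalIntegral.integral_const_mul, integral_expo, integral_expo]
  by_cases h1 : k = j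
  · rw [if_pos h1, if_neg (by omega), if_pos (by omega)]; ring
  · by_cases h2 : k = -j
    · rw [if_neg h1, if_pos h2, if_pos (by omega), if_neg (by omega)]; ring
    · rw [if_neg h1, if_neg h2, if_neg (by omega), if_neg (by omega)]; ring

theorem integral_fracDirichlet_mul_expo (β : ℝ) (n : ℕ) {k : ℤ} (hk : k ≠ 0) :
    ∫ t, ((1 / π * fracDirichlet β n t : ℝ) : ℂ) * expo k t ∂circMeasure =
      hermMul (derivSeq β n) k := by
  have hπ : (π : ℂ) ≠ 0 := by exact_mod_cast pi_ne_zero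
  have e : ∀ t : ℝ, ((1 / π * fracDirichlet β n t : ℝ) : ℂ) * expo k t =
      ∑ j ∈ Finset.Icc 1 n, 1 / (π : ℂ) * ((j : ℝ) ^ β : ℝ) *
        (((Real.cos (j * t + β * π / 2) : ℝ) : ℂ) * expo k t) := fun t => by
    rw [fracDirichlet]
    push_cast
    rw [Finset.mul_sum, Finset.sum_mul]
    exact Finset.sum_congr rfl fun j _ => by ring
  simp only [e]
  rw [← intervalIntegral.integral_of_le two_pi_pos.le, intervalIntegral.integral_finsetSum
    fun j _ => by apply Continuous.intervalIntegrable; fun_prop]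
  simp only [intervalIntegral.integral_const_mul]
  rw [Finset.sum_congr rfl fun j hj => by
    rw [integral_cos_mul_expo (Finset.mem_Icc.1 hj).1]]
  rcases lt_or_gt_of_ne hk with h | h
  · obtain ⟨j, rfl⟩ : ∃ j : ℕ, k = -(j : ℤ) := ⟨k.natAbs, by omega⟩
    rw [hermMul_neg, derivSeq]
    by_cases hj : j ≤ n
    · rw [if_pos hj, Finset.sum_eq_single_of_mem j (Finset.mem_Icc.2 ⟨by omega, hj⟩),
        if_neg (by omega), if_pos rfl]
      · rw [map_mul, Complex.conj_ofReal, ← Complex.exp_conj]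
        have e1 : starRingEnd ℂ (-(β * π / 2) * Complex.I) = ((β * π / 2 : ℝ) : ℂ) * Complex.I := by
          simp [Complex.conj_ofNat]
        rw [e1]
        field_simp
      · intro i _ hij
        rw [if_neg (by omega), if_neg (by omega), mul_zero]
    · rw [if_neg hj, map_zero]
      refine Finset.sum_eq_zero fun i hi => ?_
      have := Finset.mem_Icc.1 hi
      rw [if_neg (by omega), if_neg (by omega), mul_zero]
  · obtain ⟨j, rfl⟩ : ∃ j : ℕ, k = (j : ℤ) := ⟨k.natAbs, by omega⟩
    rw [hermMul_natCast _ (by omega), derivSeq]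
    by_cases hj : j ≤ n
    · rw [if_pos hj, Finset.sum_eq_single_of_mem j (Finset.mem_Icc.2 ⟨by omega, hj⟩), if_pos rfl]
      · push_cast
        field_simp
      · intro i _ hij
        rw [if_neg (by omega), if_neg (by omega), mul_zero]
    · rw [if_neg hj]
      refine Finset.sum_eq_zero fun i hi => ?_
      have := Finset.mem_Icc.1 hi
      rw [if_neg (by omega), if_neg (by omega), mul_zero]

namespace IsExpSum

variable {S : Finset (ℤ × ℤ)} {c d : ℤ × ℤ → ℂ} {g h : ℝ → ℝ → ℝ}

theorem sX (β : ℝ) (n : ℕ) (hS : ∀ q ∈ S, q.1 ≠ 0) (hg : IsExpSum S c g) :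
    IsExpSum S (fun q => hermMul (derivSeq β n) q.1 * c q) (sX β n g) := by
  rw [sX_eq_convOp]
  exact hg.convOp (integrable_circMeasure_of_continuous (by fun_prop)) measurable_id fun q hq =>
    integral_fracDirichlet_mul_expo β n (hS q hq)

theorem sY (β : ℝ) (n : ℕ) (hS : ∀ q ∈ S, q.2 ≠ 0) (hg : IsExpSum S c g) :
    IsExpSum S (fun q => hermMul (derivSeq β n) q.2 * c q) (sY β n g) :=
  (hg.swap.sX β n (by simpa using fun a b h => hS (b, a) h)).swap'

theorem meanX (hg : IsExpSum S c g) :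
    IsExpSum S (fun q => (if q.1 = 0 then 1 else 0) * c q) (meanX g) := by
  refine hg.convOp (m := fun k => if k = 0 then 1 else 0)
    (integrable_circMeasure_of_continuous continuous_const) measurable_id fun q _ => ?_
  simp only [id]
  rw [integral_const_mul, ← intervalIntegral.integral_of_le two_pi_pos.le, integral_expo]
  have hπ : (π : ℂ) ≠ 0 := by exact_mod_cast pi_ne_zero
  split_ifs
  · push_cast; field_simp
  · simp

end IsExpSum

theorem IsExpSum.extend {S T : Finset (ℤ × ℤ)} {c : ℤ × ℤ → ℂ} {g : ℝ → ℝ → ℝ}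
    (hg : IsExpSum S c g) (h : ∀ q ∈ S, q ∉ T → c q = 0) :
    IsExpSum T (fun q => if q ∈ S then c q else 0) g := fun x y => by
  rw [hg, expSum, expSum]
  simp only [ite_mul, zero_mul]
  rw [Finset.sum_ite_mem, Finset.inter_comm]
  refine (Finset.sum_subset Finset.inter_subset_left fun q hq hq' => ?_).symm
  rw [h q hq fun hT => hq' (Finset.mem_inter.2 ⟨hq, hT⟩), zero_mul]

theorem exists_isExpSum_re (S : Finset (ℤ × ℤ)) (c : ℤ × ℤ → ℂ) :
    ∃ T d, IsExpSum T d (fun x y => (expSum S c (x, y)).re) := by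
  set T := S ∪ S.map (Equiv.neg (ℤ × ℤ)).toEmbedding with hT
  have hmem : ∀ q, -q ∈ T ↔ q ∈ T := fun q => by
    simp only [hT, Finset.mem_union, Finset.mem_map_equiv, Equiv.neg_symm, Equiv.neg_apply, neg_neg,
      or_comm]
  set c' : ℤ × ℤ → ℂ := fun q => if q ∈ S then c q else 0
  have h1 : ∀ z, expSum S c z = expSum T c' z := fun z => by
    rw [expSum, expSum]
    simp only [c', ite_mul, zero_mul]
    rw [Finset.sum_ite_mem, Finset.inter_eq_right.2 Finset.subset_union_left]
  refine ⟨T, fun q => (c' q + starRingEnd ℂ (c' (-q))) / 2, fun x y => ?_⟩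
  have h2 : starRingEnd ℂ (expSum T c' (x, y)) =
      ∑ q ∈ T, starRingEnd ℂ (c' (-q)) * (expo q.1 x * expo q.2 y) := by
    rw [expSum, map_sum]
    refine Finset.sum_equiv (Equiv.neg _) (fun q => (hmem q).symm) fun q _ => ?_
    simp [conj_expo]
  rw [Complex.re_eq_add_conj, h1, h2, expSum, expSum, ← Finset.sum_add_distrib, Finset.sum_div]
  exact Finset.sum_congr rfl fun q _ => by ring

/-- The projection of the plane onto the torus. -/
def toTorus (z : ℝ × ℝ) : UnitAddTorus (Fin 2) :=
  ![((z.1 / (2 * π) : ℝ) : UnitAddCircle), ((z.2 / (2 * π) : ℝ) : UnitAddCircle)]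

theorem continuous_toTorus : Continuous toTorus := by
  refine continuous_pi fun i => ?_
  fin_cases i
  · exact (AddCircle.continuous_mk' 1).comp (by fun_prop)
  · exact (AddCircle.continuous_mk' 1).comp (by fun_prop)

theorem fourier_div_two_pi (k : ℤ) (x : ℝ) :
    fourier k ((x / (2 * π) : ℝ) : UnitAddCircle) = expo k x := by
  have hπ : (π : ℂ) ≠ 0 := by exact_mod_cast pi_ne_zero
  rw [fourier_coe_apply, expo]
  congr 1
  push_cast
  field_simp

theorem exists_expSum_of_mem_span {u : C(UnitAddTorus (Fin 2), ℂ)}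
    (hu : u ∈ Submodule.span ℂ (Set.range (UnitAddTorus.mFourier (d := Fin 2)))) :
    ∃ S c, ∀ z, u (toTorus z) = expSum S c z := by
  obtain ⟨b, rfl⟩ := Finsupp.mem_span_range_iff_exists_finsupp.1 hu
  refine ⟨b.support.map (finTwoArrowEquiv ℤ).toEmbedding, fun q => b ![q.1, q.2], fun z => ?_⟩
  rw [expSum, Finset.sum_map, Finsupp.sum, ContinuousMap.sum_apply]
  refine Finset.sum_congr rfl fun n _ => ?_
  have e : ![n 0, n 1] = n := by ext i; fin_cases i <;> rfl
  have h : UnitAddTorus.mFourier n (toTorus z) = expo (n 0) z.1 * expo (n 1) z.2 := by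
    rw [← fourier_div_two_pi, ← fourier_div_two_pi]
    exact Fin.prod_univ_two fun i => fourier (n i) (toTorus z i)
  rw [ContinuousMap.smul_apply, h]
  simp [e]

/-- A representative in the line of a point of the circle. -/
def circleRep (θ : UnitAddCircle) : ℝ := 2 * π * (AddCircle.measurableEquivIoc (1:ℝ) 0 θ : ℝ)

theorem measurable_circleRep : Measurable circleRep := by
  unfold circleRep
  exact (measurable_subtype_coe.comp (MeasurableEquiv.measurable _)).const_mul _

theorem exists_circleRep_eq (x : ℝ) :
    ∃ n : ℤ, circleRep ((x / (2 * π) : ℝ) : UnitAddCircle) = x + n • (2 * π) := by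
  have h : ((AddCircle.equivIoc (1:ℝ) 0 ((x / (2 * π) : ℝ) : UnitAddCircle) : ℝ) : UnitAddCircle) =
      ((x / (2 * π) : ℝ) : UnitAddCircle) := AddCircle.coe_equivIoc
  rw [← sub_eq_zero, ← AddCircle.coe_sub] at h
  obtain ⟨n, hn⟩ := (AddCircle.coe_eq_zero_iff (1:ℝ)).1 h
  refine ⟨n, ?_⟩
  change 2 * π * (AddCircle.equivIoc (1:ℝ) 0 ((x / (2 * π) : ℝ) : UnitAddCircle) : ℝ) = _
  rw [sub_eq_iff_eq_add.1 hn.symm]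
  simp only [zsmul_eq_mul]
  field_simp
  ring

theorem exists_isExpSum_near_of_periodicLp {p : ℝ} (hp : 1 < p) {f : ℝ → ℝ → ℝ}
    (hf : PeriodicLp p f) {ε : ℝ≥0∞} (hε : ε ≠ 0) :
    ∃ S c g, IsExpSum S c g ∧ Lp2Norm p (fun x y => f x y - g x y) ≤ ε := by
  have hP : 1 ≤ ENNReal.ofReal p := by simpa using ENNReal.ofReal_le_ofReal hp.le
  have hΦ : Measurable toTorus := continuous_toTorus.measurable
  set μ : Measure (UnitAddTorus (Fin 2)) := sqMeasure.map toTorus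
  set F : UnitAddTorus (Fin 2) → ℂ := fun θ => (f (circleRep (θ 0)) (circleRep (θ 1)) : ℂ)
  have hFm : Measurable F := by
    refine Complex.measurable_ofReal.comp (hf.meas.comp
      (f := fun θ : UnitAddTorus (Fin 2) => (circleRep (θ 0), circleRep (θ 1))) ?_)
    exact (measurable_circleRep.comp (measurable_pi_apply 0)).prodMk
      (measurable_circleRep.comp (measurable_pi_apply 1))
  have hFΦ : ∀ z, F (toTorus z) = f z.1 z.2 := fun z => by
    obtain ⟨m, hm⟩ := exists_circleRep_eq z.1
    obtain ⟨n, hn⟩ := exists_circleRep_eq z.2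
    have h1 := (hf.periodic_x (z.2 + n • (2 * π))).zsmul m z.1
    have h2 := (hf.periodic_y z.1).zsmul n z.2
    simp only [F, toTorus, Matrix.cons_val_zero, Matrix.cons_val_one, hm, hn]
    rw [show f (z.1 + m • (2 * π)) (z.2 + n • (2 * π)) = f z.1 (z.2 + n • (2 * π)) from h1, h2]
  have hFp : MemLp F (ENNReal.ofReal p) μ := by
    rw [memLp_map_measure_iff hFm.aestronglyMeasurable hΦ.aemeasurable]
    refine ⟨(hFm.comp hΦ).aestronglyMeasurable, ?_⟩
    have : eLpNorm (F ∘ toTorus) (ENNReal.ofReal p) sqMeasure = Lp2Norm p f := by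
      rw [Lp2Norm_eq_eLpNorm hp hf.meas]
      refine eLpNorm_congr_norm_ae (ae_of_all _ fun z => ?_)
      rw [Function.comp, hFΦ, Complex.norm_real]; rfl
    rw [this]
    exact hf.norm_ne_top.lt_top
  have hε2 : ε / 2 ≠ 0 := by simpa using hε
  obtain ⟨G, hG, -⟩ := hFp.exists_boundedContinuous_eLpNorm_sub_le ENNReal.ofReal_ne_top hε2
  obtain ⟨δ, hδ, hδε⟩ : ∃ δ : ℝ, 0 < δ ∧
      μ Set.univ ^ (ENNReal.ofReal p).toReal⁻¹ * ENNReal.ofReal δ ≤ ε / 2 := by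
    have hA : μ Set.univ ^ (ENNReal.ofReal p).toReal⁻¹ ≠ ⊤ :=
      ENNReal.rpow_ne_top_of_nonneg (by positivity) (measure_ne_top _ _)
    obtain ⟨δ, hδ, h⟩ := ENNReal.exists_nnreal_pos_mul_lt hA hε2
    exact ⟨δ, by exact_mod_cast hδ, by rw [ENNReal.ofReal_coe_nnreal, mul_comm]; exact h.le⟩
  have hmem : G.toContinuousMap ∈ closure
      (Submodule.span ℂ (Set.range (UnitAddTorus.mFourier (d := Fin 2))) : Set _) := by
    rw [← Submodule.topologicalClosure_coe, UnitAddTorus.span_mFourier_closure_eq_top]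
    trivial
  obtain ⟨u, hu, hGu⟩ := Metric.mem_closure_iff.1 hmem δ hδ
  obtain ⟨S, c, hSc⟩ := exists_expSum_of_mem_span hu
  obtain ⟨T, d, hTd⟩ := exists_isExpSum_re S c
  refine ⟨T, d, _, hTd, ?_⟩
  rw [Lp2Norm_eq_eLpNorm hp (hf.sub hp (hTd.periodicLp hp)).meas]
  have h1 : eLpNorm (⇑G - ⇑u) (ENNReal.ofReal p) μ ≤ ε / 2 :=
    (eLpNorm_le_of_ae_bound (ae_of_all _ fun θ => by
      rw [Pi.sub_apply, ← dist_eq_norm]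
      exact (ContinuousMap.dist_apply_le_dist (f := G.toContinuousMap) (g := u) θ).trans hGu.le)).trans hδε
  have h2 : eLpNorm (F - ⇑u) (ENNReal.ofReal p) μ ≤ ε := by
    rw [← sub_add_sub_cancel F G u, ← ENNReal.add_halves ε]
    exact (eLpNorm_add_le (hFm.sub G.continuous.measurable).aestronglyMeasurable
      (G.continuous.sub u.continuous).aestronglyMeasurable hP).trans (add_le_add hG h1)
  rw [eLpNorm_map_measure (hFm.sub u.continuous.measurable).aestronglyMeasurable
    hΦ.aemeasurable] at h2
  refine le_trans (eLpNorm_mono fun z => ?_) h2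
  rw [Function.comp, Pi.sub_apply, hFΦ, hSc]
  refine le_trans (le_of_eq ?_) (Complex.abs_re_le_norm _)
  rw [Complex.sub_re, Complex.ofReal_re]; rfl

theorem MemLp0.periodicLp {p : ℝ} {f : ℝ → ℝ → ℝ} (hf : MemLp0 p f) : PeriodicLp p f :=
  ⟨hf.meas, hf.periodic_x, hf.periodic_y, hf.norm_ne_top⟩

/-- The function with its mean value in the first variable removed. -/
def removeMeanX (f : ℝ → ℝ → ℝ) : ℝ → ℝ → ℝ := fun x y => f x y - meanX f x y

theorem meanX_eq_zero {f : ℝ → ℝ → ℝ} {y : ℝ} (hf : Function.Periodic (fun x => f x y) (2 * π))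
    (h : ∫ x in (0:ℝ)..(2 * π), f x y = 0) (x : ℝ) : meanX f x y = 0 := by
  rw [meanX, convOp, integral_const_mul, ← intervalIntegral.integral_of_le two_pi_pos.le]
  have h1 := hf.intervalIntegral_add_eq x 0
  rw [zero_add, h] at h1
  rw [intervalIntegral.integral_comp_add_left (fun t => f t y), add_zero, h1, mul_zero]

theorem exists_Lp2Norm_sub_removeMeanX_le {p : ℝ} (hp : 1 < p) : ∃ C ≠ ⊤, ∀ f g : ℝ → ℝ → ℝ,
    PeriodicLp p f → (∀ᵐ y ∂volume, ∫ x in (0:ℝ)..(2 * π), f x y = 0) → PeriodicLp p g →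
      PeriodicLp p (removeMeanX g) ∧
      Lp2Norm p (fun x y => f x y - removeMeanX g x y) ≤ C * Lp2Norm p (fun x y => f x y - g x y) := by
  obtain ⟨C, hC, hM⟩ := exists_lipOp_meanX hp
  have hR : LipOp p removeMeanX (1 + C) := LipOp.id.sub hp hM
  refine ⟨1 + C, by finiteness, fun f g hf h0 hg => ⟨hR.periodicLp hg, ?_⟩⟩
  refine le_trans (le_of_eq ?_) (hR.lip hf hg)
  refine Lp2Norm_congr_ae hp (hf.sub hp (hR.periodicLp hg)).meas
    ((hR.periodicLp hf).sub hp (hR.periodicLp hg)).meas ?_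
  filter_upwards [Measure.quasiMeasurePreserving_snd.ae (ae_restrict_of_ae h0)] with z hz
  rw [removeMeanX, removeMeanX, meanX_eq_zero (hf.periodic_x z.2) hz, sub_zero]

theorem exists_isExpSum_freqs_near {p : ℝ} (hp : 1 < p) {f : ℝ → ℝ → ℝ} (hf : MemLp0 p f)
    {ε : ℝ≥0∞} (hε : ε ≠ 0) :
    ∃ N c g, IsExpSum (freqs N ×ˢ freqs N) c g ∧ Lp2Norm p (fun x y => f x y - g x y) ≤ ε := by
  obtain ⟨C, hC, hR⟩ := exists_Lp2Norm_sub_removeMeanX_le hp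
  have hCC : C * C ≠ ⊤ := ENNReal.mul_ne_top hC hC
  obtain ⟨δ, hδ, hδε⟩ := ENNReal.exists_nnreal_pos_mul_lt hCC hε
  obtain ⟨S, c, g, hg, hfg⟩ := exists_isExpSum_near_of_periodicLp hp hf.periodicLp
    (ε := δ) (by exact_mod_cast hδ.ne')
  have hfp := hf.periodicLp
  obtain ⟨h1, h2⟩ := hR f g hfp hf.mean_x (hg.periodicLp hp)
  obtain ⟨h3, h4⟩ := hR (swapVar f) (swapVar (removeMeanX g)) hfp.swap hf.mean_y h1.swap
  have e1 := hg.sub hg.meanX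
  have e2 := e1.swap.sub e1.swap.meanX
  have e3 := e2.swap'
  obtain ⟨N, hN⟩ : ∃ N : ℕ, ∀ q ∈ S, q.1.natAbs ≤ N ∧ q.2.natAbs ≤ N :=
    ⟨S.sup fun q => max q.1.natAbs q.2.natAbs, fun q hq => by
      have := Finset.le_sup (f := fun q : ℤ × ℤ => max q.1.natAbs q.2.natAbs) hq
      exact max_le_iff.1 this⟩
  refine ⟨N, _, _, e3.extend fun q hq hqN => ?_, ?_⟩
  · have := hN q hq
    simp only [Finset.mem_product, mem_freqs] at hqN
    by_cases hq1 : q.1 = 0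
    · simp [hq1]
    · have hq2 : q.2 = 0 := by by_contra hq2; exact hqN ⟨by omega, by omega⟩
      simp [hq2]
  · have h5 := (Lp2Norm_swapVar (hfp.swap.sub hp h3).meas).trans_le h4
    refine le_trans h5 ?_
    have h6 := (Lp2Norm_swapVar (hfp.sub hp h1).meas).trans_le h2
    calc _ ≤ C * (C * Lp2Norm p (fun x y => f x y - g x y)) := by gcongr; exact h6
      _ ≤ C * (C * δ) := by gcongr
      _ = δ * (C * C) := by ring
      _ ≤ ε := hδε.le

theorem trigNorm_eq_toReal (p : ℝ) (N : ℕ) (c : ℤ × ℤ → ℂ) :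
    trigNorm p N (fun k l => c (k, l)) =
      (eLpNorm (expSum (freqs N ×ˢ freqs N) c) (ENNReal.ofReal p) sqMeasure).toReal := by
  rw [trigNorm]
  congr 2
  ext z
  rw [expSum, Finset.sum_product]
  rfl

theorem IsExpSum.Lp2Norm_eq_trigNorm {p : ℝ} (hp : 1 < p) {N : ℕ} {c : ℤ × ℤ → ℂ} {g : ℝ → ℝ → ℝ}
    (hg : IsExpSum (freqs N ×ˢ freqs N) c g) :
    Lp2Norm p g = ENNReal.ofReal (trigNorm p N fun k l => c (k, l)) := by
  rw [trigNorm_eq_toReal, ← hg.Lp2Norm_eq hp, ENNReal.ofReal_toReal (hg.periodicLp hp).norm_ne_top]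

theorem one_sub_hermMul_derivSeq_zero (n : ℕ) {k : ℤ} :
    1 - hermMul (derivSeq 0 n) k = hermMul (highSeq n) k := by
  have h := hermMul_lowSeq_add_highSeq n k
  have e : lowSeq n = derivSeq 0 n := by
    ext j; simp [lowSeq, derivSeq]
  rw [← h, e, add_sub_cancel_left]

theorem IsExpSum.Lp2Norm_diff {p α₁ α₂ : ℝ} (hp : 1 < p) (hα₁ : 0 < α₁) (hα₂ : 0 < α₂) {N : ℕ}
    {c : ℤ × ℤ → ℂ} {g : ℝ → ℝ → ℝ} (hg : IsExpSum (freqs N ×ˢ freqs N) c g) (h₁ h₂ : ℝ) :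
    Lp2Norm p (_root_.diffX α₁ h₁ (_root_.diffY α₂ h₂ g)) = ENNReal.ofReal
      (trigNorm p N fun k l => diffMul α₁ h₁ k * (diffMul α₂ h₂ l * c (k, l))) :=
  ((hg.diffY hα₂ h₂).diffX hα₁ h₁).Lp2Norm_eq_trigNorm hp

theorem IsExpSum.realizationRHS_eq {p : ℝ} (hp : 1 < p) (α₁ α₂ : ℝ) (n₁ n₂ : ℕ) {N : ℕ}
    {c : ℤ × ℤ → ℂ} {g : ℝ → ℝ → ℝ} (hg : IsExpSum (freqs N ×ˢ freqs N) c g) :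
    realizationRHS p α₁ α₂ n₁ n₂ g =
      ENNReal.ofReal (trigRealization p α₁ α₂ n₁ n₂ N fun k l => c (k, l)) := by
  have hS : ∀ q ∈ freqs N ×ˢ freqs N, q.1 ≠ 0 ∧ q.2 ≠ 0 := fun q hq => by
    rw [Finset.mem_product, mem_freqs, mem_freqs] at hq
    exact ⟨hq.1.1, hq.2.1⟩
  have hX := fun q hq => (hS q hq).1
  have hY := fun q hq => (hS q hq).2
  have t1 := ((hg.sY α₂ n₂ hY).sX α₁ n₁ hX).Lp2Norm_eq_trigNorm hp
  have t2 := ((hg.sub (hg.sY 0 n₂ hY)).sX α₁ n₁ hX).congr (d := fun q =>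
    hermMul (derivSeq α₁ n₁) q.1 * (hermMul (highSeq n₂) q.2 * c q)) (fun q _ => by
      rw [← one_sub_hermMul_derivSeq_zero]; ring)
  have t3 := ((hg.sub (hg.sX 0 n₁ hX)).sY α₂ n₂ hY).congr (d := fun q =>
    hermMul (highSeq n₁) q.1 * (hermMul (derivSeq α₂ n₂) q.2 * c q)) (fun q _ => by
      rw [← one_sub_hermMul_derivSeq_zero]; ring)
  have t4 := ((hg.sub (hg.sX 0 n₁ hX)).sub
    ((hg.sY 0 n₂ hY).sub ((hg.sY 0 n₂ hY).sX 0 n₁ hX))).congr (d := fun q =>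
    hermMul (highSeq n₁) q.1 * (hermMul (highSeq n₂) q.2 * c q)) (fun q _ => by
      rw [← one_sub_hermMul_derivSeq_zero, ← one_sub_hermMul_derivSeq_zero]; ring)
  have e4 : (fun x y => g x y - _root_.sX 0 n₁ g x y - _root_.sY 0 n₂ g x y +
      _root_.sX 0 n₁ (_root_.sY 0 n₂ g) x y) = fun x y => g x y - _root_.sX 0 n₁ g x y -
      (_root_.sY 0 n₂ g x y - _root_.sX 0 n₁ (_root_.sY 0 n₂ g) x y) := by ext; ring
  have N0 : ∀ c, 0 ≤ trigNorm p N c := fun _ => ENNReal.toReal_nonneg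
  have h₁ : 0 ≤ (n₁ : ℝ) ^ (-α₁) := by positivity
  have h₂ : 0 ≤ (n₂ : ℝ) ^ (-α₂) := by positivity
  have p1 := fun c => mul_nonneg (mul_nonneg h₁ h₂) (N0 c)
  have p2 := fun c => mul_nonneg h₁ (N0 c)
  have p3 := fun c => mul_nonneg h₂ (N0 c)
  rw [realizationRHS, sXY_eq, sXY_eq, e4, t1, t2.Lp2Norm_eq_trigNorm hp,
    t3.Lp2Norm_eq_trigNorm hp, t4.Lp2Norm_eq_trigNorm hp, ← ENNReal.ofReal_mul (mul_nonneg h₁ h₂),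
    ← ENNReal.ofReal_mul h₁, ← ENNReal.ofReal_mul h₂, ← ENNReal.ofReal_add (p1 _) (p2 _),
    ← ENNReal.ofReal_add (add_nonneg (p1 _) (p2 _)) (p3 _),
    ← ENNReal.ofReal_add (add_nonneg (add_nonneg (p1 _) (p2 _)) (p3 _)) (N0 _)]
  rfl

theorem exists_realizationRHS_le {p : ℝ} (hp : 1 < p) (α₁ α₂ : ℝ) (n₁ n₂ : ℕ) :
    ∃ C ≠ ⊤, ∀ f g, PeriodicLp p f → PeriodicLp p g → realizationRHS p α₁ α₂ n₁ n₂ f ≤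
      realizationRHS p α₁ α₂ n₁ n₂ g + C * Lp2Norm p (fun x y => f x y - g x y) := by
  obtain ⟨A, hA, X⟩ := exists_lipOp_sX hp α₁ n₁
  obtain ⟨B, hB, Y⟩ := exists_lipOp_sY hp α₂ n₂
  obtain ⟨A', hA', X₀⟩ := exists_lipOp_sX hp 0 n₁
  obtain ⟨B', hB', Y₀⟩ := exists_lipOp_sY hp 0 n₂
  have T1 := X.comp Y
  have T2 := X.comp (LipOp.id.sub hp Y₀)
  have T3 := Y.comp (LipOp.id.sub hp X₀)
  have T4 := (LipOp.id.sub hp X₀).sub hp (Y₀.sub hp (X₀.comp Y₀))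
  set a := ENNReal.ofReal ((n₁ : ℝ) ^ (-α₁) * (n₂ : ℝ) ^ (-α₂))
  set b := ENNReal.ofReal ((n₁ : ℝ) ^ (-α₁))
  set d := ENNReal.ofReal ((n₂ : ℝ) ^ (-α₂))
  refine ⟨a * (A * B) + b * (A * (1 + B')) + d * (B * (1 + A')) + (1 + A' + (B' + A' * B')),
    by finiteness, fun f g hf hg => ?_⟩
  have e4 : ∀ f : ℝ → ℝ → ℝ, (fun x y => f x y - sX 0 n₁ f x y - sY 0 n₂ f x y +
      sX 0 n₁ (sY 0 n₂ f) x y) = fun x y => f x y - sX 0 n₁ f x y -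
      (sY 0 n₂ f x y - sX 0 n₁ (sY 0 n₂ f) x y) := fun f => by ext; ring
  simp only [realizationRHS, sXY_eq, e4]
  refine (add_le_add (add_le_add (add_le_add (mul_le_mul_right (T1.Lp2Norm_le hp hf hg) a)
    (mul_le_mul_right (T2.Lp2Norm_le hp hf hg) b)) (mul_le_mul_right (T3.Lp2Norm_le hp hf hg) d))
    (T4.Lp2Norm_le hp hf hg)).trans (le_of_eq ?_)
  ring

theorem exists_diff_lipOp {p : ℝ} (hp : 1 < p) {α₁ α₂ : ℝ} (hα₁ : 0 < α₁) (hα₂ : 0 < α₂) :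
    ∃ A ≠ ⊤, ∀ h₁ h₂, LipOp p (fun f => diffX α₁ h₁ (diffY α₂ h₂ f)) A :=
  ⟨_, ENNReal.mul_ne_top (integrable_diffCoeff hα₁).2.ne (integrable_diffCoeff hα₂).2.ne,
    fun h₁ h₂ => (lipOp_diffX hp hα₁ h₁).comp (lipOp_diffY hp hα₂ h₂)⟩

theorem le_of_forall_le_add_mul {a b D : ℝ≥0∞} (hD : D ≠ ⊤)
    (h : ∀ ε ≠ 0, ε ≠ ⊤ → a ≤ b + D * ε) : a ≤ b := by
  refine ENNReal.le_of_forall_pos_le_add fun δ hδ _ => ?_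
  obtain ⟨ε, hε, hεδ⟩ := ENNReal.exists_nnreal_pos_mul_lt hD
    (show (δ : ℝ≥0∞) ≠ 0 by exact_mod_cast hδ.ne')
  refine (h ε (by exact_mod_cast hε.ne') ENNReal.coe_ne_top).trans ?_
  gcongr
  rw [mul_comm]
  exact hεδ.le

/-- Realization theorem for the mixed modulus of smoothness. -/
theorem realization_theorem (p α₁ α₂ : ℝ) (hp : 1 < p) (hα₁ : 0 < α₁) (hα₂ : 0 < α₂) :
    ∃ C : ℝ, 0 < C ∧ ∀ (f : ℝ → ℝ → ℝ) (n₁ n₂ : ℕ), 1 ≤ n₁ → 1 ≤ n₂ → MemLp0 p f →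
      mixedMod p α₁ α₂ (π / (n₁ : ℝ)) (π / (n₂ : ℝ)) f ≤
          ENNReal.ofReal C * realizationRHS p α₁ α₂ n₁ n₂ f ∧
      realizationRHS p α₁ α₂ n₁ n₂ f ≤
          ENNReal.ofReal C * mixedMod p α₁ α₂ (π / (n₁ : ℝ)) (π / (n₂ : ℝ)) f := by
  obtain ⟨C, hC, H⟩ := exists_trig_realization hp hα₁ hα₂
  obtain ⟨A, hA, L⟩ := exists_diff_lipOp hp hα₁ hα₂
  refine ⟨C, hC, fun f n₁ n₂ hn₁ hn₂ hf => ?_⟩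
  obtain ⟨B, hB, R⟩ := exists_realizationRHS_le hp α₁ α₂ n₁ n₂
  have hfp := hf.periodicLp
  constructor
  · refine iSup₂_le fun h₁ hh₁ => iSup₂_le fun h₂ hh₂ => ?_
    refine le_of_forall_le_add_mul (D := ENNReal.ofReal C * B + A) (by finiteness) fun ε hε _ => ?_
    obtain ⟨N, c, g, hg, hfg⟩ := exists_isExpSum_freqs_near hp hf hε
    have hgp := hg.periodicLp hp
    have h := ENNReal.ofReal_le_ofReal
      ((H n₁ n₂ N (fun k l => c (k, l)) hn₁ hn₂).1 h₁ h₂ hh₁ hh₂)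
    rw [← hg.Lp2Norm_diff hp hα₁ hα₂, ENNReal.ofReal_mul hC.le, ← hg.realizationRHS_eq hp] at h
    have hgf := R g f hgp hfp
    rw [Lp2Norm_sub_comm] at hgf
    calc _ ≤ _ := (L h₁ h₂).Lp2Norm_le hp hfp hgp
      _ ≤ ENNReal.ofReal C * (realizationRHS p α₁ α₂ n₁ n₂ f + B * ε) + A * ε := by
        gcongr
        refine h.trans ?_
        gcongr
        refine hgf.trans ?_
        gcongr
      _ = _ := by ring
  · set ω := mixedMod p α₁ α₂ (π / (n₁ : ℝ)) (π / (n₂ : ℝ)) f with hω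
    by_cases hωt : ω = ⊤
    · rw [hωt, ENNReal.mul_top (by simpa using hC)]; exact le_top
    refine le_of_forall_le_add_mul (D := ENNReal.ofReal C * A + B) (by finiteness) fun ε hε hεt => ?_
    obtain ⟨N, c, g, hg, hfg⟩ := exists_isExpSum_freqs_near hp hf hε
    have hgp := hg.periodicLp hp
    have hW : ω + A * ε ≠ ⊤ := by finiteness
    have h := ENNReal.ofReal_le_ofReal ((H n₁ n₂ N (fun k l => c (k, l)) hn₁ hn₂).2
      (ω + A * ε).toReal fun h₁ h₂ hh₁ hh₂ => by
        rw [← ENNReal.ofReal_le_iff_le_toReal hW, ← hg.Lp2Norm_diff hp hα₁ hα₂]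
        have h1 := (L h₁ h₂).Lp2Norm_le hp hgp hfp
        rw [Lp2Norm_sub_comm] at h1
        refine h1.trans ?_
        gcongr
        exact le_iSup₂_of_le h₁ hh₁ (le_iSup₂_of_le h₂ hh₂ le_rfl))
    rw [← hg.realizationRHS_eq hp, ENNReal.ofReal_mul hC.le, ENNReal.ofReal_toReal hW] at h
    calc _ ≤ _ := R f g hfp hgp
      _ ≤ ENNReal.ofReal C * (ω + A * ε) + B * ε := by gcongr
      _ = _ := by ring

end
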